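/- arXiv:1710.00375 — 2 statements merged into one kernel-verified Lean document; each statement's English description precedes it below -/
import Mathlib

section
/- Let Ω be a triangle with sides S, M, L ordered nondecreasingly by length, and suppose both interior angles adjacent to the middle side M are strictly less than π/2. Then λ₁^M ≤ λ₁^{L∪S}. -/
open MeasureTheory EuclideanGeometry Real

noncomputable section

/-- Points of the plane. -/
abbrev Pt := EuclideanSpace ℝ (Fin 2)

/-- `i`-th partial derivative of `u`. -/
def pd (i : Fin 2) (u : Pt → ℝ) (x : Pt) : ℝ := fderiv ℝ u x (EuclideanSpace.single i 1)

/-- Second partial derivative `∂ᵢ∂ⱼ u`. -/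
def pdd (i j : Fin 2) (u : Pt → ℝ) : Pt → ℝ := pd i (pd j u)

/-- A (closed, nondegenerate) line segment in the plane. -/
def IsSegSet (s : Set Pt) : Prop := ∃ a b : Pt, a ≠ b ∧ s = segment ℝ a b

/-- `Ω` is an open bounded convex polygon whose boundary is the union of the finitely
many sides in `Sides`. -/
def IsConvexPolygon (Ω : Set Pt) (Sides : Finset (Set Pt)) : Prop :=
  IsOpen Ω ∧ Convex ℝ Ω ∧ Bornology.IsBounded Ω ∧ Ω.Nonempty ∧
    (∀ s ∈ Sides, IsSegSet s) ∧ frontier Ω = ⋃ s ∈ Sides, s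

/-- `Γ` is the union of the sides in the subcollection `T` of `Sides`. -/
def UnionOfSides (Γ : Set Pt) (Sides T : Finset (Set Pt)) : Prop :=
  T ⊆ Sides ∧ Γ = ⋃ s ∈ T, s

/-- `n` is the outward unit normal of `Ω` along the side `s`. -/
def IsOuterNormal (Ω s : Set Pt) (n : Pt) : Prop :=
  ‖n‖ = 1 ∧ ∀ x ∈ s, ∀ y ∈ Ω, n 0 * (y 0 - x 0) + n 1 * (y 1 - x 1) ≤ 0

/-- `u` satisfies a (pointwise) Neumann boundary condition on the side `s` of `Ω`. -/
def NeumannOn (Ω s : Set Pt) (u : Pt → ℝ) : Prop :=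
  ∃ n : Pt, IsOuterNormal Ω s n ∧ ∀ x ∈ s, pd 0 u x * n 0 + pd 1 u x * n 1 = 0

/-- (Regular representative of) membership in `H²(Ω)`. -/
def MemH2 (Ω : Set Pt) (u : Pt → ℝ) : Prop := ContDiffOn ℝ 2 u (closure Ω)

/-- (Regular representative of) membership in `H¹(Ω)`. -/
def MemH1 (Ω : Set Pt) (u : Pt → ℝ) : Prop := ContDiffOn ℝ 1 u (closure Ω)

/-- The set of Rayleigh quotients of admissible test functions vanishing on `Sig`. -/
def RayleighSet (Ω Sig : Set Pt) : Set ℝ :=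
  { r | ∃ u : Pt → ℝ, MemH1 Ω u ∧ (∀ x ∈ Sig, u x = 0) ∧ (∫ x in Ω, (u x) ^ 2) ≠ 0 ∧
      r = (∫ x in Ω, ((pd 0 u x) ^ 2 + (pd 1 u x) ^ 2)) / (∫ x in Ω, (u x) ^ 2) }

/-- The lowest eigenvalue `λ₁^Σ` of the mixed Dirichlet(Σ)–Neumann Laplacian on `Ω`,
as the infimum of the Rayleigh quotient. -/
def lambda1 (Ω Sig : Set Pt) : ℝ := sInf (RayleighSet Ω Sig)

lemma pd_sq (u : Pt → ℝ) (x : Pt) :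
    (pd 0 u x) ^ 2 + (pd 1 u x) ^ 2 = ‖fderiv ℝ u x‖ ^ 2 := by
  set L := fderiv ℝ u x with hL
  obtain ⟨z, hz⟩ := (InnerProductSpace.toDual ℝ Pt).surjective L
  have h1 : ‖L‖ = ‖z‖ := by rw [← hz]; simp
  have h2 : ∀ i, pd i u x = z i := by
    intro i
    unfold pd
    rw [← hL, ← hz]
    simp [InnerProductSpace.toDual_apply_apply, EuclideanSpace.inner_single_right]
  rw [h1, EuclideanSpace.norm_sq_eq]
  simp [h2]

/-- one-sided threshold -/
def pp (ε s : ℝ) : ℝ := (max s 0) ^ 2 / (max s 0 + ε)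

/-- its derivative -/
def pp' (ε s : ℝ) : ℝ := 1 - ε ^ 2 / (max s 0 + ε) ^ 2

lemma pp_nonpos {ε s : ℝ} (h : s ≤ 0) : pp ε s = 0 := by simp [pp, h]

lemma pp'_nonpos {ε s : ℝ} (hε : 0 < ε) (h : s ≤ 0) : pp' ε s = 0 := by
  simp [pp', h, hε.ne']

lemma pp'_cont {ε : ℝ} (hε : 0 < ε) : Continuous (pp' ε) := by
  unfold pp'
  have : ∀ s : ℝ, (max s 0 + ε) ^ 2 ≠ 0 := fun s => by positivity
  fun_prop (disch := assumption)

lemma pp_cont {ε : ℝ} (hε : 0 < ε) : Continuous (pp ε) := by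
  unfold pp
  have : ∀ s : ℝ, (max s 0 + ε) ≠ 0 := fun s => by positivity
  fun_prop (disch := assumption)

lemma pp'_mem {ε : ℝ} (hε : 0 < ε) (s : ℝ) : 0 ≤ pp' ε s ∧ pp' ε s ≤ 1 := by
  unfold pp'
  have h0 : 0 ≤ max s 0 := le_max_right _ _
  constructor
  · rw [sub_nonneg, div_le_one (by positivity)]
    gcongr
    linarith
  · have : 0 ≤ ε ^ 2 / (max s 0 + ε) ^ 2 := by positivity
    linarith

lemma pp_deriv {ε : ℝ} (hε : 0 < ε) (s : ℝ) : HasDerivAt (pp ε) (pp' ε s) s := by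
  have key : ∀ y : ℝ, y ≠ 0 → HasDerivAt (pp ε) (pp' ε y) y := by
    intro y hy
    rcases lt_or_gt_of_ne hy with h | h
    · rw [pp'_nonpos hε h.le]
      refine (hasDerivAt_const y (0:ℝ)).congr_of_eventuallyEq ?_
      filter_upwards [Iio_mem_nhds h] with z hz
      exact pp_nonpos (le_of_lt hz)
    · have h1 : HasDerivAt (fun z : ℝ => z ^ 2 / (z + ε)) (pp' ε y) y := by
        have hne : y + ε ≠ 0 := by positivity
        refine (((hasDerivAt_id y).pow 2).div ((hasDerivAt_id y).add_const ε) hne).congr_deriv ?_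
        simp only [pp', max_eq_left h.le, id]
        field_simp
        norm_num
        ring
      refine h1.congr_of_eventuallyEq ?_
      filter_upwards [Ioi_mem_nhds h] with z hz
      simp [pp, max_eq_left (le_of_lt (Set.mem_Ioi.1 hz))]
  by_cases hs : s = 0
  · subst hs
    exact hasDerivAt_of_hasDerivAt_of_ne key (pp_cont hε).continuousAt (pp'_cont hε).continuousAt
  · exact key s hs

/-- two-sided threshold -/
def ph (ε t : ℝ) : ℝ := pp ε (t - ε) - pp ε (-t - ε)

def ph' (ε t : ℝ) : ℝ := pp' ε (t - ε) + pp' ε (-t - ε)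

lemma ph_deriv {ε : ℝ} (hε : 0 < ε) (t : ℝ) : HasDerivAt (ph ε) (ph' ε t) t := by
  have h1 : HasDerivAt (fun t => pp ε (t - ε)) (pp' ε (t - ε)) t := by
    refine ((pp_deriv hε (t - ε)).comp t ((hasDerivAt_id t).sub_const ε)).congr_deriv ?_; simp
  have h2 : HasDerivAt (fun t => pp ε (-t - ε)) (-pp' ε (-t - ε)) t := by
    refine ((pp_deriv hε (-t - ε)).comp t ((hasDerivAt_id t).neg.sub_const ε)).congr_deriv ?_; simp
  exact (h1.sub h2).congr_deriv (by unfold ph'; ring)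

lemma ph_contDiff {ε : ℝ} (hε : 0 < ε) : ContDiff ℝ 1 (ph ε) := by
  rw [contDiff_one_iff_deriv]
  refine ⟨fun t => (ph_deriv hε t).differentiableAt, ?_⟩
  have : deriv (ph ε) = ph' ε := funext fun t => (ph_deriv hε t).deriv
  rw [this]
  unfold ph'
  have := pp'_cont hε
  fun_prop

lemma ph'_mem {ε : ℝ} (hε : 0 < ε) (t : ℝ) : |ph' ε t| ≤ 1 := by
  unfold ph'
  have h1 := pp'_mem hε (t - ε)
  have h2 := pp'_mem hε (-t - ε)
  rw [abs_of_nonneg (by linarith)]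
  rcases le_total t 0 with h | h
  · rw [pp'_nonpos hε (by linarith : t - ε ≤ 0)]; linarith
  · rw [pp'_nonpos hε (by linarith : -t - ε ≤ 0)]; linarith

lemma ph_zero {ε t : ℝ} (h : |t| ≤ ε) : ph ε t = 0 := by
  have := abs_le.1 h
  unfold ph
  rw [pp_nonpos (by linarith), pp_nonpos (by linarith)]; simp

lemma pp_est {ε s : ℝ} (hε : 0 < ε) (hs : 0 ≤ s) : s - ε ≤ pp ε s ∧ pp ε s ≤ s := by
  unfold pp
  rw [max_eq_left hs]
  constructor
  · rw [le_div_iff₀ (by positivity)]; nlinarith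
  · rw [div_le_iff₀ (by positivity)]; nlinarith

lemma ph_est {ε : ℝ} (hε : 0 < ε) (t : ℝ) : t ^ 2 - 4 * ε * |t| ≤ (ph ε t) ^ 2 := by
  have ht := abs_nonneg t
  have h2 : t ^ 2 = |t| ^ 2 := (sq_abs t).symm
  by_cases h : |t| ≤ 2 * ε
  · nlinarith [sq_nonneg (ph ε t)]
  · push Not at h
    have : |t| - 2 * ε ≤ |ph ε t| := by
      unfold ph
      rcases le_total t 0 with h0 | h0
      · rw [abs_of_nonpos h0] at *
        rw [pp_nonpos (by linarith : t - ε ≤ 0)]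
        have := (pp_est hε (by linarith : 0 ≤ -t - ε)).1
        rw [zero_sub, abs_neg]
        refine le_trans ?_ (le_abs_self _)
        linarith
      · rw [abs_of_nonneg h0] at *
        rw [pp_nonpos (by linarith : -t - ε ≤ 0)]
        have := (pp_est hε (by linarith : 0 ≤ t - ε)).1
        rw [sub_zero]
        refine le_trans ?_ (le_abs_self _)
        linarith
    rw [← sq_abs (ph ε t), h2]
    nlinarith

lemma jensen_sq {α : Type*} [MeasurableSpace α] (μ : Measure α) [IsFiniteMeasure μ] (h : α → ℝ)
    (h1 : Integrable h μ) (h2 : Integrable (fun x => h x ^ 2) μ) :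
    (∫ x, h x ∂μ) ^ 2 ≤ μ.real Set.univ * ∫ x, h x ^ 2 ∂μ := by
  set V := μ.real Set.univ with hV
  set m := ∫ x, h x ∂μ with hm
  set q := ∫ x, h x ^ 2 ∂μ with hq
  have hV0 : 0 ≤ V := measureReal_nonneg
  have key : ∀ c : ℝ, 0 ≤ q - 2 * c * m + c ^ 2 * V := by
    intro c
    have : 0 ≤ ∫ x, (h x - c) ^ 2 ∂μ := integral_nonneg fun x => sq_nonneg _
    have e : ∫ x, (h x - c) ^ 2 ∂μ = q - 2 * c * m + c ^ 2 * V := by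
      have : (fun x => (h x - c) ^ 2) = fun x => (h x ^ 2 - (2 * c) * h x) + c ^ 2 := by
        funext x; ring
      rw [this, integral_add (f := fun x => h x ^ 2 - (2 * c) * h x)
        (h2.sub (h1.const_mul _)) (integrable_const _), integral_sub h2 (h1.const_mul _), integral_const_mul, integral_const]
      simp [hV, hm, hq, mul_comm]
    rwa [e] at this
  rcases hV0.eq_or_lt with h0 | h0
  · have hμ : μ = 0 := by
      rw [← Measure.measure_univ_eq_zero]
      rw [eq_comm, hV, measureReal_eq_zero_iff] at h0
      exact h0
    have : m = 0 := by simp [hm, hμ]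
    rw [this, ← h0]; simp
  · have := key (m / V)
    have e : q - 2 * (m / V) * m + (m / V) ^ 2 * V = q - m ^ 2 / V := by field_simp; ring
    rw [e, sub_nonneg, div_le_iff₀ h0] at this
    linarith

abbrev AB3 := AffineBasis (Fin 3) ℝ Pt

def Om (bs : AB3) : Set Pt := {x | ∀ i, 0 < bs.coord i x}
def Cl (bs : AB3) : Set Pt := {x | ∀ i, 0 ≤ bs.coord i x}

lemma coord_cont (bs : AB3) (i : Fin 3) : Continuous (bs.coord i) :=
  AffineMap.continuous_of_finiteDimensional _

lemma coord_add (bs : AB3) (i : Fin 3) (x v : Pt) :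
    bs.coord i (x + v) = bs.coord i x + (bs.coord i).linear v := by
  have := (bs.coord i).map_vadd x v
  simp only [vadd_eq_add] at this
  rw [add_comm, this, add_comm]

lemma lin_sub (bs : AB3) (i : Fin 3) (x y : Pt) :
    (bs.coord i).linear (x - y) = bs.coord i x - bs.coord i y := by
  have := (bs.coord i).linearMap_vsub x y
  simpa using this

lemma coord_sum (bs : AB3) (x : Pt) : bs.coord 0 x + bs.coord 1 x + bs.coord 2 x = 1 := by
  have := bs.sum_coord_apply_eq_one x
  rwa [Fin.sum_univ_three] at this

lemma repr3 (bs : AB3) (x : Pt) :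
    x = bs 0 + bs.coord 1 x • (bs 1 - bs 0) + bs.coord 2 x • (bs 2 - bs 0) := by
  have h := bs.linear_combination_coord_eq_self x
  have h2 := coord_sum bs x
  rw [Fin.sum_univ_three] at h
  have : bs.coord 0 x = 1 - bs.coord 1 x - bs.coord 2 x := by linarith
  rw [this] at h
  nth_rewrite 1 [← h]
  module

lemma coord1_comb (bs : AB3) (s t : ℝ) :
    bs.coord 1 (bs 0 + s • (bs 1 - bs 0) + t • (bs 2 - bs 0)) = s := by
  rw [coord_add, coord_add, map_smul, map_smul, lin_sub, lin_sub]
  simp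

lemma coord2_comb (bs : AB3) (s t : ℝ) :
    bs.coord 2 (bs 0 + s • (bs 1 - bs 0) + t • (bs 2 - bs 0)) = t := by
  rw [coord_add, coord_add, map_smul, map_smul, lin_sub, lin_sub]
  simp

lemma Om_open (bs : AB3) : IsOpen (Om bs) := by
  unfold Om
  rw [Set.ofPred_forall]
  exact isOpen_iInter_of_finite fun i => isOpen_lt continuous_const (coord_cont bs i)

lemma Cl_closed (bs : AB3) : IsClosed (Cl bs) := by
  unfold Cl
  rw [Set.ofPred_forall]
  exact isClosed_iInter fun i => isClosed_le continuous_const (coord_cont bs i)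

lemma Om_sub_Cl (bs : AB3) : Om bs ⊆ Cl bs := fun _ h i => (h i).le

lemma Cl_eq (bs : AB3) : Cl bs = convexHull ℝ (Set.range bs) :=
  bs.convexHull_eq_nonneg_coord.symm

lemma Om_eq (bs : AB3) : Om bs = interior (Cl bs) := by
  rw [Cl_eq, bs.interior_convexHull]; rfl

lemma Cl_compact (bs : AB3) : IsCompact (Cl bs) := by
  rw [Cl_eq]
  exact Set.Finite.isCompact_convexHull ℝ (Set.finite_range bs)

lemma Cl_convex (bs : AB3) : Convex ℝ (Cl bs) := by
  rw [Cl_eq]; exact convex_convexHull _ _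

lemma Om_nonempty (bs : AB3) : (Om bs).Nonempty := by
  refine ⟨bs 0 + (1/3:ℝ) • (bs 1 - bs 0) + (1/3:ℝ) • (bs 2 - bs 0), ?_⟩
  intro i
  have h1 := coord1_comb bs (1/3) (1/3)
  have h2 := coord2_comb bs (1/3) (1/3)
  have h0 := coord_sum bs (bs 0 + (1/3:ℝ) • (bs 1 - bs 0) + (1/3:ℝ) • (bs 2 - bs 0))
  fin_cases i
  · simp only [Fin.zero_eta]; linarith
  · simp only [Fin.mk_one]; linarith
  · simp only [Fin.reduceFinMk]; linarith

lemma closure_Om (bs : AB3) : closure (Om bs) = Cl bs := by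
  have hn := Om_nonempty bs
  rw [Om_eq] at hn ⊢
  rw [(Cl_convex bs).closure_interior_eq_closure_of_nonempty_interior hn,
    (Cl_closed bs).closure_eq]

lemma Om_meas (bs : AB3) : MeasurableSet (Om bs) := (Om_open bs).measurableSet

lemma Om_fin (bs : AB3) : volume (Om bs) < ⊤ :=
  lt_of_le_of_lt (measure_mono (Om_sub_Cl bs)) (Cl_compact bs).measure_lt_top

lemma Om_pos (bs : AB3) : 0 < volume (Om bs) := (Om_open bs).measure_pos _ (Om_nonempty bs)

lemma intOn_of_cont (bs : AB3) {f : Pt → ℝ} (hf : ContinuousOn f (Cl bs)) :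
    IntegrableOn f (Om bs) :=
  (hf.integrableOn_compact (Cl_compact bs)).mono_set (Om_sub_Cl bs)

lemma mp_invol (L : Pt →ₗ[ℝ] Pt) (hL : L ∘ₗ L = LinearMap.id) (c : Pt) :
    MeasurePreserving (fun x => L x + c) volume volume := by
  have hdet : LinearMap.det L * LinearMap.det L = 1 := by
    rw [← LinearMap.det_comp, hL, LinearMap.det_id]
  have hne : LinearMap.det L ≠ 0 := by
    intro h; rw [h] at hdet; simp at hdet
  have habs : |(LinearMap.det L)⁻¹| = 1 := by
    rw [abs_inv]
    rcases mul_self_eq_one_iff.1 hdet with h | h <;> simp [h]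
  have h1 : MeasurePreserving L volume volume := by
    refine ⟨(LinearMap.continuous_of_finiteDimensional L).measurable, ?_⟩
    rw [Measure.map_linearMap_addHaar_eq_smul_addHaar _ hne, habs]
    simp
  exact (measurePreserving_add_right volume c).comp h1

lemma swap_int (bs : AB3) (i j : Fin 3) (hij : i ≠ j) :
    ∫ x in Om bs, bs.coord i x = ∫ x in Om bs, bs.coord j x := by
  set v : Pt := bs i - bs j with hv
  set N : Pt →ₗ[ℝ] ℝ := (bs.coord j).linear - (bs.coord i).linear with hN
  have hNv : N v = -2 := by
    simp only [hN, hv, LinearMap.sub_apply, lin_sub, AffineBasis.coord_apply, hij, hij.symm]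
    norm_num
  set L : Pt →ₗ[ℝ] Pt := LinearMap.id + N.smulRight v with hL
  have hLL : L ∘ₗ L = LinearMap.id := by
    ext1 x
    simp only [hL, LinearMap.comp_apply, LinearMap.add_apply, LinearMap.id_apply,
      LinearMap.smulRight_apply, map_add, map_smul, hNv, smul_eq_mul]
    module
  set d : ℝ := bs.coord j 0 - bs.coord i 0 with hd
  set S : Pt → Pt := fun x => L x + d • v with hS
  have mp : MeasurePreserving S volume volume := mp_invol L hLL _
  have hSx : ∀ x, S x = x + (bs.coord j x - bs.coord i x) • v := by
    intro x
    have h1 := lin_sub bs j x 0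
    have h2 := lin_sub bs i x 0
    rw [sub_zero] at h1 h2
    simp only [hS, hL, hN, LinearMap.add_apply, LinearMap.id_apply, LinearMap.smulRight_apply,
      LinearMap.sub_apply, h1, h2, hd]
    module
  have hc : ∀ k x, bs.coord k (S x) = bs.coord k x + (bs.coord j x - bs.coord i x) *
      ((if k = i then 1 else 0) - (if k = j then 1 else 0)) := by
    intro k x
    rw [hSx, coord_add, map_smul, hv, lin_sub, AffineBasis.coord_apply, AffineBasis.coord_apply]
    simp
  have hi : ∀ x, bs.coord i (S x) = bs.coord j x := by
    intro x; rw [hc]; simp [hij]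
  have hj : ∀ x, bs.coord j (S x) = bs.coord i x := by
    intro x; rw [hc]; simp [hij.symm]
  have hk : ∀ k x, k ≠ i → k ≠ j → bs.coord k (S x) = bs.coord k x := by
    intro k x h1 h2; rw [hc]; simp [h1, h2]
  have hinv : ∀ x, S (S x) = x := by
    intro x
    apply bs.ext_elem
    intro k
    by_cases h1 : k = i
    · subst h1; rw [hi, hj]
    by_cases h2 : k = j
    · subst h2; rw [hj, hi]
    rw [hk k _ h1 h2, hk k _ h1 h2]
  have hpre : S ⁻¹' (Om bs) = Om bs := by
    have sub : Om bs ⊆ S ⁻¹' (Om bs) := by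
      intro x hx k
      by_cases h1 : k = i
      · subst h1; rw [hi]; exact hx _
      by_cases h2 : k = j
      · subst h2; rw [hj]; exact hx _
      rw [hk k _ h1 h2]; exact hx _
    refine Set.Subset.antisymm ?_ sub
    intro x hx
    have := sub hx
    simpa [hinv] using this
  have emb : MeasurableEmbedding S :=
    (MeasurableEquiv.mk ⟨S, S, hinv, hinv⟩ mp.measurable mp.measurable).measurableEmbedding
  have := mp.setIntegral_preimage_emb emb (bs.coord i) (Om bs)
  rw [hpre] at this
  rw [← this]
  simp only [hi]

lemma mean_coord (bs : AB3) : 3 * ∫ x in Om bs, bs.coord 1 x = volume.real (Om bs) := by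
  have hi : ∀ i, IntegrableOn (bs.coord i) (Om bs) := fun i =>
    intOn_of_cont bs (coord_cont bs i).continuousOn
  have h : ∫ x in Om bs, (bs.coord 0 x + bs.coord 1 x + bs.coord 2 x) = volume.real (Om bs) := by
    simp only [coord_sum]; simp
  rw [integral_add (f := fun x => bs.coord 0 x + bs.coord 1 x) ((hi 0).add (hi 1)) (hi 2),
    integral_add (hi 0) (hi 1),
    swap_int bs 0 1 (by decide), swap_int bs 2 1 (by decide)] at h
  linarith

lemma mean_coord_sq (bs : AB3) :
    volume.real (Om bs) ≤ 9 * ∫ x in Om bs, (bs.coord 1 x) ^ 2 := by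
  have : IsFiniteMeasure (volume.restrict (Om bs)) := ⟨by simpa using Om_fin bs⟩
  have h := jensen_sq (volume.restrict (Om bs)) (bs.coord 1)
    (intOn_of_cont bs (coord_cont bs 1).continuousOn)
    (intOn_of_cont bs ((coord_cont bs 1).pow 2).continuousOn)
  have hV : 0 < volume.real (Om bs) := by
    rw [measureReal_def]
    exact ENNReal.toReal_pos (Om_pos bs).ne' (Om_fin bs).ne
  have hm := mean_coord bs
  have e : (volume.restrict (Om bs)).real Set.univ = volume.real (Om bs) := by simp
  rw [e] at h
  have hm' : ∫ x in Om bs, bs.coord 1 x = volume.real (Om bs) / 3 := by linarith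
  rw [hm'] at h
  by_contra hc
  push Not at hc
  nlinarith

def gg (bs : AB3) (u : Pt → ℝ) (ε : ℝ) : Pt → ℝ := (Cl bs).indicator (fun x => ph ε (u x))

/-- test functions vanishing on the two sides -/
def Adm (bs : AB3) (u : Pt → ℝ) : Prop := ContDiffOn ℝ 1 u (Cl bs) ∧
  ∀ x ∈ Cl bs, (bs.coord 2 x = 0 ∨ bs.coord 0 x = 0) → u x = 0

lemma g_near {bs : AB3} {u : Pt → ℝ} {ε : ℝ} (hu : Adm bs u) (x : Pt)
    (hx : x ∈ Cl bs → |u x| < ε) : gg bs u ε =ᶠ[nhds x] fun _ => 0 := by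
  by_cases h : x ∈ Cl bs
  · have hc : ContinuousWithinAt (fun y => |u y|) (Cl bs) x := (hu.1.continuousOn x h).abs
    have := hc.eventually (gt_mem_nhds (hx h))
    rw [eventually_nhdsWithin_iff] at this
    filter_upwards [this] with y hy
    by_cases hyC : y ∈ Cl bs
    · rw [gg, Set.indicator_of_mem hyC]
      exact ph_zero (hy hyC).le
    · rw [gg, Set.indicator_of_notMem hyC]
  · filter_upwards [(Cl_closed bs).isOpen_compl.mem_nhds h] with y hy
    rw [gg, Set.indicator_of_notMem hy]

lemma ph_u_cd {bs : AB3} {u : Pt → ℝ} {ε : ℝ} (hε : 0 < ε) (hu : Adm bs u) :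
    ContDiffOn ℝ 1 (gg bs u ε) (Cl bs) := by
  have : ContDiffOn ℝ 1 (fun x => ph ε (u x)) (Cl bs) :=
    (ph_contDiff hε).comp_contDiffOn hu.1
  refine this.congr ?_
  intro x hx
  rw [gg, Set.indicator_of_mem hx]

lemma g_cd {bs : AB3} {u : Pt → ℝ} {ε : ℝ} (hε : 0 < ε) (hu : Adm bs u) :
    ContDiffOn ℝ 1 (gg bs u ε) {x | 0 ≤ bs.coord 1 x} := by
  intro x hx
  by_cases h : x ∈ Cl bs → |u x| < ε
  · exact ((contDiffAt_const (c := (0:ℝ))).congr_of_eventuallyEq (g_near hu x h)).contDiffWithinAt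
  · push Not at h
    obtain ⟨hC, hb⟩ := h
    have hne : u x ≠ 0 := by
      intro h0; rw [h0, abs_zero] at hb; linarith
    have h2 : 0 < bs.coord 2 x := lt_of_le_of_ne (hC 2) fun h => hne (hu.2 x hC (Or.inl h.symm))
    have h0 : 0 < bs.coord 0 x := lt_of_le_of_ne (hC 0) fun h => hne (hu.2 x hC (Or.inr h.symm))
    refine (ph_u_cd hε hu x hC).mono_of_mem_nhdsWithin ?_
    have e2 : ∀ᶠ y in nhds x, 0 < bs.coord 2 y := (coord_cont bs 2).continuousAt.eventually (lt_mem_nhds h2)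
    have e0 : ∀ᶠ y in nhds x, 0 < bs.coord 0 y := (coord_cont bs 0).continuousAt.eventually (lt_mem_nhds h0)
    filter_upwards [nhdsWithin_le_nhds e2, nhdsWithin_le_nhds e0, self_mem_nhdsWithin] with y y2 y0 y1
    intro i
    fin_cases i
    · exact y0.le
    · exact y1
    · exact y2.le

lemma g_out {bs : AB3} {u : Pt → ℝ} {ε : ℝ} (hε : 0 < ε) (hu : Adm bs u) (x : Pt)
    (hx : x ∉ Om bs) (h1 : 0 < bs.coord 1 x) : gg bs u ε =ᶠ[nhds x] fun _ => 0 := by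
  apply g_near hu
  intro hC
  have : bs.coord 2 x = 0 ∨ bs.coord 0 x = 0 := by
    by_contra hc
    push Not at hc
    apply hx
    intro i
    fin_cases i
    · exact lt_of_le_of_ne (hC 0) hc.2.symm
    · exact h1
    · exact lt_of_le_of_ne (hC 2) hc.1.symm
  rw [hu.2 x hC this]; simpa using hε

lemma g_out0 {bs : AB3} {u : Pt → ℝ} {ε : ℝ} (hε : 0 < ε) (hu : Adm bs u) (x : Pt)
    (hx : x ∉ Om bs) (h1 : 0 < bs.coord 1 x) : gg bs u ε x = 0 :=
  (g_out hε hu x hx h1).eq_of_nhds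

lemma g_out1 {bs : AB3} {u : Pt → ℝ} {ε : ℝ} (hε : 0 < ε) (hu : Adm bs u) (x : Pt)
    (hx : x ∉ Om bs) (h1 : 0 < bs.coord 1 x) : fderiv ℝ (gg bs u ε) x = 0 := by
  rw [(g_out hε hu x hx h1).fderiv_eq]; simp

lemma Cl_nhds {bs : AB3} {x : Pt} (hx : x ∈ Om bs) : Cl bs ∈ nhds x :=
  Filter.mem_of_superset ((Om_open bs).mem_nhds hx) (Om_sub_Cl bs)

lemma g_fderiv_le {bs : AB3} {u : Pt → ℝ} {ε : ℝ} (hε : 0 < ε) (hu : Adm bs u) (x : Pt)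
    (hx : x ∈ Om bs) : ‖fderiv ℝ (gg bs u ε) x‖ ≤ ‖fderiv ℝ u x‖ := by
  have hd : DifferentiableAt ℝ u x :=
    (hu.1.contDiffAt (Cl_nhds hx)).differentiableAt (by norm_num)
  have h1 : HasFDerivAt (fun y => ph ε (u y)) (ph' ε (u x) • fderiv ℝ u x) x :=
    (ph_deriv hε (u x)).comp_hasFDerivAt x hd.hasFDerivAt
  have h2 : gg bs u ε =ᶠ[nhds x] fun y => ph ε (u y) := by
    filter_upwards [Cl_nhds hx] with y hy
    rw [gg, Set.indicator_of_mem hy]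
  rw [(h1.congr_of_eventuallyEq h2).fderiv, norm_smul]
  have := ph'_mem hε (u x)
  calc ‖ph' ε (u x)‖ * ‖fderiv ℝ u x‖ ≤ 1 * ‖fderiv ℝ u x‖ := by gcongr; exact this
    _ = _ := one_mul _

lemma fd_bdd {bs : AB3} {u : Pt → ℝ} (hu : ContDiffOn ℝ 1 u (Cl bs)) :
    ∃ M, ∀ x ∈ Om bs, ‖fderiv ℝ u x‖ ≤ M := by
  have hU : UniqueDiffOn ℝ (Cl bs) :=
    uniqueDiffOn_convex (Cl_convex bs) (by rw [← Om_eq]; exact Om_nonempty bs)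
  have hc := hu.continuousOn_fderivWithin hU le_rfl
  obtain ⟨M, hM⟩ := (Cl_compact bs).exists_bound_of_continuousOn hc
  refine ⟨M, fun x hx => ?_⟩
  have := hM x (Om_sub_Cl bs hx)
  rwa [fderivWithin_of_mem_nhds (Cl_nhds hx)] at this

lemma fd_int {bs : AB3} {u : Pt → ℝ} (hu : ContDiffOn ℝ 1 u (Cl bs)) :
    IntegrableOn (fun x => ‖fderiv ℝ u x‖ ^ 2) (Om bs) := by
  obtain ⟨M, hM⟩ := fd_bdd hu
  have hm : Measurable (fun x => ‖fderiv ℝ u x‖ ^ 2) := (measurable_fderiv ℝ u).norm.pow_const 2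
  refine Measure.integrableOn_of_bounded (M := M ^ 2) (Om_fin bs).ne hm.aestronglyMeasurable ?_
  rw [ae_restrict_iff' (Om_meas bs)]
  refine Filter.Eventually.of_forall fun x hx => ?_
  rw [Real.norm_of_nonneg (by positivity)]
  have := hM x hx
  gcongr

lemma poincare {bs : AB3} {u : Pt → ℝ} {ε : ℝ} (hε : 0 < ε) (hu : Adm bs u) (t0 : ℝ)
    (T : Set Pt) (hT : T ⊆ Om bs) (hTm : MeasurableSet T)
    (h0 : ∀ x ∈ T, bs.coord 0 x ≤ t0)
    (hstay : ∀ x ∈ T, ∀ τ : ℝ, 0 ≤ τ → x + τ • (t0 • (bs 2 - bs 0)) ∈ Om bs →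
      x + τ • (t0 • (bs 2 - bs 0)) ∈ T) :
    ∫ x in T, (gg bs u ε x) ^ 2 ≤
      ‖t0 • (bs 2 - bs 0)‖ ^ 2 * ∫ x in T, ‖fderiv ℝ (gg bs u ε) x‖ ^ 2 := by
  set w := t0 • (bs 2 - bs 0) with hw
  set g := gg bs u ε with hg
  set k : Pt → ℝ := T.indicator (fun x => ‖fderiv ℝ g x‖ ^ 2) with hk
  have hkm : Measurable k := ((measurable_fderiv ℝ g).norm.pow_const 2).indicator hTm
  have hk0 : ∀ x, 0 ≤ k x := fun x => Set.indicator_nonneg (fun _ _ => by positivity) x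
  have c1 : ∀ x : Pt, ∀ τ : ℝ, bs.coord 1 (x + τ • w) = bs.coord 1 x := by
    intro x τ
    rw [coord_add, hw, map_smul, map_smul, lin_sub]; simp
  have c0 : ∀ x : Pt, bs.coord 0 (x + (1:ℝ) • w) = bs.coord 0 x - t0 := by
    intro x
    rw [coord_add, hw, map_smul, map_smul, lin_sub]; simp; ring
  have Hopen : IsOpen {x : Pt | 0 < bs.coord 1 x} := isOpen_lt continuous_const (coord_cont bs 1)
  have hcd : ContDiffOn ℝ 1 g {x | 0 < bs.coord 1 x} :=
    (g_cd hε hu).mono (by intro x hx; simp only [Set.mem_ofPred_eq] at hx ⊢; exact hx.le)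
  -- pointwise bound
  have pt : ∀ x ∈ T, g x ^ 2 ≤ ∫ τ in (0:ℝ)..1, ‖w‖ ^ 2 * k (x + τ • w) := by
    intro x hx
    have hx1 : 0 < bs.coord 1 x := hT hx 1
    have hmem : ∀ τ : ℝ, x + τ • w ∈ {x : Pt | 0 < bs.coord 1 x} := fun τ => by
      simp only [Set.mem_ofPred_eq, c1]; exact hx1
    have hder : ∀ τ : ℝ, HasDerivAt (fun τ : ℝ => g (x + τ • w)) (fderiv ℝ g (x + τ • w) w) τ := by
      intro τ
      have hd : HasFDerivAt g (fderiv ℝ g (x + τ • w)) (x + τ • w) :=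
        ((hcd.contDiffAt (Hopen.mem_nhds (hmem τ))).differentiableAt (by norm_num)).hasFDerivAt
      have hl : HasDerivAt (fun τ : ℝ => x + τ • w) w τ := by
        simpa using ((hasDerivAt_id τ).smul_const w).const_add x
      exact hd.comp_hasDerivAt τ hl
    have hfc : Continuous (fun τ : ℝ => fderiv ℝ g (x + τ • w)) := by
      have := hcd.continuousOn_fderiv_of_isOpen Hopen le_rfl
      exact this.comp_continuous (by fun_prop) hmem
    have hcont : Continuous (fun τ : ℝ => fderiv ℝ g (x + τ • w) w) := hfc.clm_apply continuous_const
    have ftc := intervalIntegral.integral_eq_sub_of_hasDerivAt (a := 0) (b := 1)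
      (fun τ _ => hder τ) (hcont.intervalIntegrable _ _)
    have hend : g (x + (1:ℝ) • w) = 0 := by
      refine g_out0 hε hu _ (fun hm => ?_) (hmem 1)
      have := hm 0
      rw [c0] at this
      linarith [h0 x hx]
    rw [hend, zero_smul, add_zero, zero_sub] at ftc
    have hj := jensen_sq (volume.restrict (Set.Ioc (0:ℝ) 1))
      (fun τ : ℝ => fderiv ℝ g (x + τ • w) w)
      ((hcont.intervalIntegrable (μ := volume) 0 1).1)
      (((hcont.pow 2).intervalIntegrable (μ := volume) 0 1).1)
    rw [← intervalIntegral.integral_of_le zero_le_one, ftc] at hj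
    have e1 : (volume.restrict (Set.Ioc (0:ℝ) 1)).real Set.univ = 1 := by simp
    rw [e1, one_mul, neg_sq, ← intervalIntegral.integral_of_le zero_le_one] at hj
    have hkeq : ∀ τ : ℝ, 0 ≤ τ → k (x + τ • w) = ‖fderiv ℝ g (x + τ • w)‖ ^ 2 := by
      intro τ hτ
      by_cases hm : x + τ • w ∈ Om bs
      · rw [hk, Set.indicator_of_mem (hstay x hx τ hτ hm)]
      · rw [hk, Set.indicator_of_notMem fun h => hm (hT h), hg,
          g_out1 hε hu _ hm (hmem τ)]
        simp
    refine hj.trans ?_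
    have e2 : ∫ τ in (0:ℝ)..1, ‖w‖ ^ 2 * k (x + τ • w) =
        ∫ τ in (0:ℝ)..1, ‖w‖ ^ 2 * ‖fderiv ℝ g (x + τ • w)‖ ^ 2 := by
      apply intervalIntegral.integral_congr
      intro τ hτ
      rw [Set.uIcc_of_le zero_le_one] at hτ
      simp only [hkeq τ hτ.1]
    rw [e2]
    apply intervalIntegral.integral_mono_on zero_le_one
    · exact (hcont.pow 2).intervalIntegrable _ _
    · exact (by fun_prop : Continuous fun τ : ℝ =>
        ‖w‖ ^ 2 * ‖fderiv ℝ g (x + τ • w)‖ ^ 2).intervalIntegrable _ _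
    · intro τ _
      have := (fderiv ℝ g (x + τ • w)).le_opNorm w
      rw [← mul_pow, ← sq_abs, mul_comm ‖w‖]
      exact pow_le_pow_left₀ (abs_nonneg _) this 2
  have gint : IntegrableOn (fun x => ‖fderiv ℝ g x‖ ^ 2) (Om bs) := fd_int (ph_u_cd hε hu)
  have kint : Integrable k := (integrable_indicator_iff hTm).2 (gint.mono_set hT)
  have kbd : ∃ M, ∀ x, k x ≤ M := by
    obtain ⟨M, hM⟩ := fd_bdd (ph_u_cd hε hu)
    refine ⟨M ^ 2, fun x => ?_⟩
    by_cases hx : x ∈ T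
    · rw [hk, Set.indicator_of_mem hx]
      have := hM x (hT hx)
      exact pow_le_pow_left₀ (norm_nonneg _) this 2
    · rw [hk, Set.indicator_of_notMem hx]; positivity
  have jm : Measurable (fun z : Pt × ℝ => k (z.1 + z.2 • w)) :=
    hkm.comp (by fun_prop)
  have main : ∫⁻ x in T, ENNReal.ofReal (g x ^ 2) ≤
      ENNReal.ofReal (‖w‖ ^ 2) * ∫⁻ x, ENNReal.ofReal (k x) := by
    calc ∫⁻ x in T, ENNReal.ofReal (g x ^ 2)
        ≤ ∫⁻ x in T, ∫⁻ τ in Set.Ioc (0:ℝ) 1, ENNReal.ofReal (‖w‖ ^ 2) * ENNReal.ofReal (k (x + τ • w)) := by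
          apply setLIntegral_mono' hTm
          intro x hx
          refine (ENNReal.ofReal_le_ofReal (pt x hx)).trans ?_
          rw [intervalIntegral.integral_of_le zero_le_one, ofReal_integral_eq_lintegral_ofReal]
          · refine lintegral_mono fun τ => ?_
            rw [ENNReal.ofReal_mul (by positivity)]
          · obtain ⟨M, hM⟩ := kbd
            refine Measure.integrableOn_of_bounded (M := ‖w‖ ^ 2 * M) (by simp) ?_ ?_
            · exact ((jm.comp (measurable_const.prodMk measurable_id)).const_mul _).aestronglyMeasurable
            · refine Filter.Eventually.of_forall fun τ => ?_
              have h3 := hk0 (x + τ • w)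
              rw [Real.norm_of_nonneg (by positivity)]
              have := hM (x + τ • w)
              gcongr
          · exact Filter.Eventually.of_forall fun τ => by
              have h3 := hk0 (x + τ • w)
              show 0 ≤ ‖w‖ ^ 2 * k (x + τ • w)
              positivity
      _ ≤ ∫⁻ x, ∫⁻ τ in Set.Ioc (0:ℝ) 1, ENNReal.ofReal (‖w‖ ^ 2) * ENNReal.ofReal (k (x + τ • w)) :=
          setLIntegral_le_lintegral _ _
      _ = ∫⁻ τ in Set.Ioc (0:ℝ) 1, ∫⁻ x, ENNReal.ofReal (‖w‖ ^ 2) * ENNReal.ofReal (k (x + τ • w)) := by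
          apply lintegral_lintegral_swap
          exact (jm.ennreal_ofReal.const_mul _).aemeasurable
      _ = ∫⁻ τ in Set.Ioc (0:ℝ) 1, ENNReal.ofReal (‖w‖ ^ 2) * ∫⁻ x, ENNReal.ofReal (k x) := by
          refine lintegral_congr fun τ => ?_
          rw [lintegral_const_mul' _ _ ENNReal.ofReal_ne_top,
            lintegral_add_right_eq_self (fun x => ENNReal.ofReal (k x)) (τ • w)]
      _ = _ := by simp
  have eT : ∫ x in T, ‖fderiv ℝ g x‖ ^ 2 = ∫ x, k x := by
    rw [hk, integral_indicator hTm]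
  have gsq : IntegrableOn (fun x => g x ^ 2) T :=
    (intOn_of_cont bs ((ph_u_cd hε hu).continuousOn.pow 2)).mono_set hT
  rw [eT]
  rw [← ofReal_integral_eq_lintegral_ofReal gsq (Filter.Eventually.of_forall fun x => sq_nonneg _),
    ← ofReal_integral_eq_lintegral_ofReal kint (Filter.Eventually.of_forall hk0),
    ← ENNReal.ofReal_mul (by positivity)] at main
  refine (ENNReal.ofReal_le_ofReal_iff ?_).1 main
  have : 0 ≤ ∫ x, k x := integral_nonneg hk0
  positivity

lemma exists_refl (bs : AB3) (l b : ℝ) (hl : l = ‖bs 1 - bs 0‖) (hb : b = ‖bs 2 - bs 0‖)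
    (hl0 : 0 < l) (hb0 : 0 < b) :
    ∃ ρ : Pt ≃ₗᵢ[ℝ] Pt, ∀ x : Pt,
      bs.coord 1 (ρ (x - bs 0) + bs 0) = (b / l) * bs.coord 2 x ∧
      bs.coord 2 (ρ (x - bs 0) + bs 0) = (l / b) * bs.coord 1 x := by
  set e : Pt := l⁻¹ • (bs 1 - bs 0) with he
  set f : Pt := b⁻¹ • (bs 2 - bs 0) with hf
  have hn : ‖e‖ = ‖f‖ := by
    rw [he, hf, norm_smul, norm_smul, ← hl, ← hb, norm_inv, norm_inv,
      Real.norm_of_nonneg hl0.le, Real.norm_of_nonneg hb0.le, inv_mul_cancel₀ hl0.ne',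
      inv_mul_cancel₀ hb0.ne']
  set ρ := (Submodule.span ℝ {e - f})ᗮ.reflection with hρ
  have h1 : ρ e = f := Submodule.reflection_sub hn
  have h2 : ρ f = e := by rw [← h1, hρ, Submodule.reflection_reflection]
  have hB : bs 1 - bs 0 = l • e := by rw [he, smul_smul, mul_inv_cancel₀ hl0.ne', one_smul]
  have hC : bs 2 - bs 0 = b • f := by rw [hf, smul_smul, mul_inv_cancel₀ hb0.ne', one_smul]
  refine ⟨ρ, fun x => ?_⟩
  have key : ρ (x - bs 0) + bs 0 = bs 0 + ((b / l) * bs.coord 2 x) • (bs 1 - bs 0) +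
      ((l / b) * bs.coord 1 x) • (bs 2 - bs 0) := by
    have : x - bs 0 = bs.coord 1 x • (bs 1 - bs 0) + bs.coord 2 x • (bs 2 - bs 0) := by
      nth_rewrite 1 [repr3 bs x]; module
    rw [this, hB, hC]
    simp only [map_add, map_smul, h1, h2, smul_smul]
    have a1 : b / l * bs.coord 2 x * l = bs.coord 2 x * b := by field_simp
    have a2 : l / b * bs.coord 1 x * b = bs.coord 1 x * l := by field_simp
    rw [a1, a2]
    abel
  rw [key]
  exact ⟨coord1_comb _ _ _, coord2_comb _ _ _⟩

lemma core (bs : AB3) (l b Λ : ℝ) (hl : l = ‖bs 1 - bs 0‖) (hb : b = ‖bs 2 - bs 0‖)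
    (hb0 : 0 < b) (hbl : b ≤ l) (hΛ0 : 0 ≤ Λ)
    (hΛ : ∀ v : Pt → ℝ, ContDiffOn ℝ 1 v (Cl bs) → (∀ x ∈ Cl bs, bs.coord 1 x = 0 → v x = 0) →
      Λ * ∫ x in Om bs, v x ^ 2 ≤ ∫ x in Om bs, ‖fderiv ℝ v x‖ ^ 2)
    (hw : Λ * (b * (l - b) / l) ^ 2 ≤ 1) (u : Pt → ℝ) (hu : Adm bs u) (ε : ℝ) (hε : 0 < ε) :
    Λ * ∫ x in Om bs, gg bs u ε x ^ 2 ≤ ∫ x in Om bs, ‖fderiv ℝ u x‖ ^ 2 := by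
  have hl0 : 0 < l := hb0.trans_le hbl
  obtain ⟨ρ, hρ⟩ := exists_refl bs l b hl hb hl0 hb0
  set R : Pt → Pt := fun x => ρ (x - bs 0) + bs 0 with hR
  have hR1 : ∀ x, bs.coord 1 (R x) = (b / l) * bs.coord 2 x := fun x => (hρ x).1
  have hR2 : ∀ x, bs.coord 2 (R x) = (l / b) * bs.coord 1 x := fun x => (hρ x).2
  have hRR : ∀ x, R (R x) = x := by
    intro x
    rw [repr3 bs (R (R x)), hR1, hR2, hR2, hR1]
    nth_rewrite 3 [repr3 bs x]
    have a1 : b / l * (l / b * bs.coord 1 x) = bs.coord 1 x := by field_simp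
    have a2 : l / b * (b / l * bs.coord 2 x) = bs.coord 2 x := by field_simp
    rw [a1, a2]
  have mp : MeasurePreserving R volume volume :=
    (measurePreserving_add_right volume (bs 0)).comp
      (ρ.measurePreserving.comp (measurePreserving_sub_right volume (bs 0)))
  have emb : MeasurableEmbedding R :=
    (MeasurableEquiv.mk ⟨R, R, hRR, hRR⟩ mp.measurable mp.measurable).measurableEmbedding
  set g := gg bs u ε with hg
  set v : Pt → ℝ := fun x => g (R x) with hv
  have hRd : ContDiff ℝ 1 R := by
    have : ContDiff ℝ 1 (ρ : Pt → Pt) := ρ.contDiff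
    exact (this.comp (contDiff_id.sub contDiff_const)).add contDiff_const
  have hvcd : ContDiffOn ℝ 1 v (Cl bs) := by
    refine (g_cd hε hu).comp hRd.contDiffOn ?_
    intro x hx
    simp only [Set.mem_ofPred_eq, hR1]
    have := hx 2
    positivity
  have hg0 : ∀ x ∈ Cl bs, (bs.coord 2 x = 0 ∨ bs.coord 0 x = 0) → g x = 0 := by
    intro x hx h
    rw [hg, gg, Set.indicator_of_mem hx, hu.2 x hx h]
    exact ph_zero (by simpa using hε.le)
  have hv0 : ∀ x ∈ Cl bs, bs.coord 1 x = 0 → v x = 0 := by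
    intro x hx h
    by_cases hC : R x ∈ Cl bs
    · exact hg0 _ hC (Or.inl (by rw [hR2, h, mul_zero]))
    · rw [hv]; simp only [hg, gg, Set.indicator_of_notMem hC]
  -- derivative of v
  have hOm1 : ∀ x ∈ R ⁻¹' Om bs, 0 < bs.coord 1 x := by
    intro x hx
    have : 0 < bs.coord 2 (R x) := hx 2
    rw [hR2] at this
    exact (mul_pos_iff_of_pos_left (by positivity)).1 this
  have hpos : ∀ x ∈ Om bs, 0 < bs.coord 1 (R x) := by
    intro x hx
    rw [hR1]; have := hx 2; positivity
  have hvd : ∀ x ∈ Om bs, ‖fderiv ℝ v x‖ ^ 2 = ‖fderiv ℝ g (R x)‖ ^ 2 := by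
    intro x hx
    have hn : {x | 0 ≤ bs.coord 1 x} ∈ nhds (R x) := by
      have : ∀ᶠ y in nhds (R x), 0 < bs.coord 1 y :=
        (coord_cont bs 1).continuousAt.eventually (lt_mem_nhds (hpos x hx))
      filter_upwards [this] with y hy
      exact hy.le
    have hgd : HasFDerivAt g (fderiv ℝ g (R x)) (R x) :=
      (((g_cd hε hu).contDiffAt hn).differentiableAt (by norm_num)).hasFDerivAt
    have hRf : HasFDerivAt R (ρ : Pt →L[ℝ] Pt) x := by
      have h1 : HasFDerivAt (fun y : Pt => y - bs 0) (ContinuousLinearMap.id ℝ Pt) x :=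
        (hasFDerivAt_id x).sub_const (bs 0)
      have h2 : HasFDerivAt (ρ : Pt → Pt) (ρ : Pt →L[ℝ] Pt) (x - bs 0) :=
        (ρ : Pt →L[ℝ] Pt).hasFDerivAt
      exact (h2.comp x h1).add_const (bs 0)
    have := (hgd.comp x hRf).fderiv
    have e : fderiv ℝ v x = (fderiv ℝ g (R x)).comp (ρ : Pt →L[ℝ] Pt) := this
    rw [e]
    congr 1
    exact ContinuousLinearMap.opNorm_comp_linearIsometryEquiv _ _
  set T : Set Pt := Om bs \ R ⁻¹' Om bs with hT
  set K : Set Pt := Om bs ∩ R ⁻¹' Om bs with hK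
  have hpm : MeasurableSet (R ⁻¹' Om bs) := mp.measurable (Om_meas bs)
  have hpp : R ⁻¹' (R ⁻¹' Om bs) = Om bs := by
    ext x; simp [hRR]
  have tr : ∀ q : Pt → ℝ, (∀ x, x ∉ Om bs → 0 < bs.coord 1 x → q x = 0) →
      ∫ x in Om bs, q (R x) = ∫ x in K, q x := by
    intro q hq
    have := mp.setIntegral_preimage_emb emb q (R ⁻¹' Om bs)
    rw [hpp] at this
    rw [this, hK, Set.inter_comm]
    apply setIntegral_eq_of_subset_of_forall_sdiff_eq_zero hpm Set.inter_subset_left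
    intro x hx
    refine hq x (fun h => hx.2 ⟨hx.1, h⟩) (hOm1 x hx.1)
  have i1 : ∫ x in Om bs, v x ^ 2 = ∫ x in K, g x ^ 2 :=
    tr (fun x => g x ^ 2) fun x h1 h2 => by simp only [hg, g_out0 hε hu x h1 h2]; simp
  have i2 : ∫ x in Om bs, ‖fderiv ℝ v x‖ ^ 2 = ∫ x in K, ‖fderiv ℝ g x‖ ^ 2 := by
    rw [setIntegral_congr_fun (Om_meas bs) hvd]
    exact tr (fun x => ‖fderiv ℝ g x‖ ^ 2) fun x h1 h2 => by
      simp only [hg, g_out1 hε hu x h1 h2]; simp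
  have hKin := hΛ v hvcd hv0
  rw [i1, i2] at hKin
  -- T part
  set t0 : ℝ := 1 - b / l with ht0
  have ht0' : 0 ≤ t0 := by rw [ht0, sub_nonneg, div_le_one hl0]; exact hbl
  have hR0 : ∀ x, bs.coord 0 (R x) = 1 - (b / l) * bs.coord 2 x - (l / b) * bs.coord 1 x := by
    intro x
    have := coord_sum bs (R x)
    rw [hR1, hR2] at this
    linarith
  have hTiff : ∀ x ∈ Om bs, (x ∈ R ⁻¹' Om bs ↔ 0 < bs.coord 0 (R x)) := by
    intro x hx
    constructor
    · intro h; exact h 0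
    · intro h i
      have p1 := hx 1
      have p2 := hx 2
      fin_cases i
      · exact h
      · exact hpos x hx
      · show 0 < bs.coord 2 (R x)
        rw [hR2]; positivity
  have hkk : 1 ≤ l / b := by rw [le_div_iff₀ hb0]; linarith
  have hP := poincare hε hu t0 T Set.sdiff_subset ((Om_meas bs).diff hpm) (by
      intro x hx
      have h3 : ¬ 0 < bs.coord 0 (R x) := fun h => hx.2 ((hTiff x hx.1).2 h)
      rw [hR0] at h3
      push Not at h3
      have hs := coord_sum bs x
      have p1 := hx.1 1
      have p2 := hx.1 2
      have : b / l ≤ bs.coord 1 x + bs.coord 2 x := by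
        have h4 : (b / l) * 1 ≤ (b / l) * ((b / l) * bs.coord 2 x + (l / b) * bs.coord 1 x) := by
          gcongr; linarith
        have h5 : (b / l) * ((b / l) * bs.coord 2 x + (l / b) * bs.coord 1 x) =
            (b / l) ^ 2 * bs.coord 2 x + bs.coord 1 x := by field_simp
        have h6 : (b / l) ^ 2 ≤ 1 := by
          apply pow_le_one₀ (by positivity)
          rw [div_le_one hl0]; exact hbl
        nlinarith
      linarith) (by
      intro x hx τ hτ hm
      refine ⟨hm, fun h => ?_⟩
      have h3 := (hTiff _ hm).1 h
      apply hx.2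
      rw [hTiff x hx.1]
      rw [hR0] at h3 ⊢
      have c1 : bs.coord 1 (x + τ • t0 • (bs 2 - bs 0)) = bs.coord 1 x := by
        rw [coord_add, map_smul, map_smul, lin_sub]; simp
      have c2 : bs.coord 2 (x + τ • t0 • (bs 2 - bs 0)) = bs.coord 2 x + τ * t0 := by
        rw [coord_add, map_smul, map_smul, lin_sub]; simp
      rw [c1, c2] at h3
      have : 0 ≤ b / l * (τ * t0) := by positivity
      linarith)
  rw [← hg] at hP
  have hnw : ‖t0 • (bs 2 - bs 0)‖ = b * (l - b) / l := by
    rw [norm_smul, ← hb, Real.norm_of_nonneg ht0', ht0]; field_simp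
  rw [hnw] at hP
  have gint : IntegrableOn (fun x => ‖fderiv ℝ g x‖ ^ 2) (Om bs) := fd_int (ph_u_cd hε hu)
  have gsq : IntegrableOn (fun x => g x ^ 2) (Om bs) :=
    intOn_of_cont bs ((ph_u_cd hε hu).continuousOn.pow 2)
  have hI : 0 ≤ ∫ x in T, ‖fderiv ℝ g x‖ ^ 2 := integral_nonneg fun _ => by positivity
  have hTin : Λ * ∫ x in T, g x ^ 2 ≤ ∫ x in T, ‖fderiv ℝ g x‖ ^ 2 := by
    calc Λ * ∫ x in T, g x ^ 2 ≤ Λ * ((b * (l - b) / l) ^ 2 * ∫ x in T, ‖fderiv ℝ g x‖ ^ 2) := by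
          gcongr
      _ = (Λ * (b * (l - b) / l) ^ 2) * ∫ x in T, ‖fderiv ℝ g x‖ ^ 2 := by ring
      _ ≤ 1 * ∫ x in T, ‖fderiv ℝ g x‖ ^ 2 := by gcongr
      _ = _ := one_mul _
  have s1 := integral_inter_add_sdiff hpm gsq
  have s2 := integral_inter_add_sdiff hpm gint
  calc Λ * ∫ x in Om bs, g x ^ 2 ≤ ∫ x in Om bs, ‖fderiv ℝ g x‖ ^ 2 := by
        rw [← s1, ← s2, mul_add]; exact add_le_add hKin hTin
    _ ≤ _ := by
        apply setIntegral_mono_on gint (fd_int hu.1) (Om_meas bs)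
        intro x hx
        exact pow_le_pow_left₀ (norm_nonneg _) (g_fderiv_le hε hu x hx) 2

lemma core2 (bs : AB3) (l b Λ : ℝ) (hl : l = ‖bs 1 - bs 0‖) (hb : b = ‖bs 2 - bs 0‖)
    (hb0 : 0 < b) (hbl : b ≤ l) (hΛ0 : 0 ≤ Λ)
    (hΛ : ∀ v : Pt → ℝ, ContDiffOn ℝ 1 v (Cl bs) → (∀ x ∈ Cl bs, bs.coord 1 x = 0 → v x = 0) →
      Λ * ∫ x in Om bs, v x ^ 2 ≤ ∫ x in Om bs, ‖fderiv ℝ v x‖ ^ 2)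
    (hw : Λ * (b * (l - b) / l) ^ 2 ≤ 1) (u : Pt → ℝ) (hu : Adm bs u) :
    Λ * ∫ x in Om bs, u x ^ 2 ≤ ∫ x in Om bs, ‖fderiv ℝ u x‖ ^ 2 := by
  set I := ∫ x in Om bs, |u x| with hI
  have hI0 : 0 ≤ I := integral_nonneg fun _ => abs_nonneg _
  have uint : IntegrableOn (fun x => |u x|) (Om bs) := intOn_of_cont bs hu.1.continuousOn.abs
  have usq : IntegrableOn (fun x => u x ^ 2) (Om bs) := intOn_of_cont bs (hu.1.continuousOn.pow 2)
  apply le_of_forall_pos_le_add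
  intro δ hδ
  set ε := δ / (4 * (Λ * I + 1)) with hεd
  have hε : 0 < ε := by positivity
  have h := core bs l b Λ hl hb hb0 hbl hΛ0 hΛ hw u hu ε hε
  have gsq : IntegrableOn (fun x => gg bs u ε x ^ 2) (Om bs) :=
    intOn_of_cont bs ((ph_u_cd hε hu).continuousOn.pow 2)
  have h2 : (∫ x in Om bs, u x ^ 2) - 4 * ε * I ≤ ∫ x in Om bs, gg bs u ε x ^ 2 := by
    rw [hI, ← integral_const_mul, ← integral_sub usq (uint.const_mul _)]
    apply setIntegral_mono_on (usq.sub (uint.const_mul _)) gsq (Om_meas bs)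
    intro x hx
    rw [gg, Set.indicator_of_mem (Om_sub_Cl bs hx)]
    exact ph_est hε (u x)
  have h3 : Λ * (4 * ε * I) ≤ δ := by
    have : Λ * (4 * ε * I) = δ * ((Λ * I) / (Λ * I + 1)) := by rw [hεd]; field_simp
    rw [this]
    have : (Λ * I) / (Λ * I + 1) ≤ 1 := by
      rw [div_le_one (by positivity)]; linarith
    nlinarith
  have h4 := mul_le_mul_of_nonneg_left h2 hΛ0
  linarith

lemma inner_nonneg_of_angle (x y : Pt) (h : InnerProductGeometry.angle x y ≤ π / 2) :
    0 ≤ (inner ℝ x y : ℝ) := by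
  rw [← InnerProductGeometry.cos_angle_mul_norm_mul_norm x y]
  have := InnerProductGeometry.angle_nonneg x y
  exact mul_nonneg (Real.cos_nonneg_of_neg_pi_div_two_le_of_le (by linarith [Real.pi_pos]) h)
    (by positivity)

lemma lin_bound (bs : AB3) (l b m : ℝ) (hl : l = ‖bs 1 - bs 0‖) (hb : b = ‖bs 2 - bs 0‖)
    (hm : m = inner ℝ (bs 1 - bs 0) (bs 2 - bs 0)) (hm0 : 0 ≤ m) (hmb : m ≤ b ^ 2) (v : Pt) :
    ((bs.coord 1).linear v) ^ 2 * (l ^ 2 - b ^ 2) ≤ ‖v‖ ^ 2 := by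
  have h := repr3 bs (bs 0 + v)
  set s := bs.coord 1 (bs 0 + v) with hs
  set t := bs.coord 2 (bs 0 + v) with ht
  have e : (bs.coord 1).linear v = s := by
    rw [hs, coord_add]; simp
  have hv : v = s • (bs 1 - bs 0) + t • (bs 2 - bs 0) := by
    rw [add_assoc] at h
    exact add_left_cancel h
  have hn : ‖v‖ ^ 2 = s ^ 2 * l ^ 2 + 2 * s * t * m + t ^ 2 * b ^ 2 := by
    rw [hv, norm_add_sq_real, norm_smul, norm_smul, ← hl, ← hb, real_inner_smul_left,
      real_inner_smul_right, ← hm, mul_pow, mul_pow, Real.norm_eq_abs, Real.norm_eq_abs,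
      sq_abs, sq_abs]
    ring
  rw [e, hn]
  nlinarith [mul_nonneg hm0 (sq_nonneg (s + t)),
    mul_nonneg (sub_nonneg.2 hmb) (add_nonneg (sq_nonneg s) (sq_nonneg t))]

lemma hw_bound (bs : AB3) (l b m Λ : ℝ) (hl : l = ‖bs 1 - bs 0‖) (hb : b = ‖bs 2 - bs 0‖)
    (hm : m = inner ℝ (bs 1 - bs 0) (bs 2 - bs 0)) (hm0 : 0 ≤ m) (hmb : m ≤ b ^ 2)
    (hb0 : 0 < b) (hbl : b ≤ l) (hΛ0 : 0 ≤ Λ)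
    (hΛ : ∀ v : Pt → ℝ, ContDiffOn ℝ 1 v (Cl bs) → (∀ x ∈ Cl bs, bs.coord 1 x = 0 → v x = 0) →
      Λ * ∫ x in Om bs, v x ^ 2 ≤ ∫ x in Om bs, ‖fderiv ℝ v x‖ ^ 2) :
    Λ * (b * (l - b) / l) ^ 2 ≤ 1 := by
  have hl0 : 0 < l := hb0.trans_le hbl
  rcases hbl.eq_or_lt with h | hlt
  · rw [h]; simp
  set L : Pt →L[ℝ] ℝ := LinearMap.toContinuousLinearMap (bs.coord 1).linear with hL
  have hfd : ∀ x, HasFDerivAt (fun x => bs.coord 1 x) L x := by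
    intro x
    have e : (fun x => bs.coord 1 x) = fun x => L x + bs.coord 1 0 := by
      funext y
      have := lin_sub bs 1 y 0
      rw [sub_zero] at this
      show bs.coord 1 y = (bs.coord 1).linear y + bs.coord 1 0
      rw [this]; ring
    rw [e]
    exact L.hasFDerivAt.add_const _
  have hcd : ContDiff ℝ 1 (fun x => bs.coord 1 x) := by
    have e : (fun x => bs.coord 1 x) = fun x => L x + bs.coord 1 0 := by
      funext y
      have := lin_sub bs 1 y 0
      rw [sub_zero] at this
      show bs.coord 1 y = (bs.coord 1).linear y + bs.coord 1 0
      rw [this]; ring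
    rw [e]
    exact L.contDiff.add contDiff_const
  have hd : 0 < l ^ 2 - b ^ 2 := by nlinarith
  have hLn : ‖L‖ ^ 2 * (l ^ 2 - b ^ 2) ≤ 1 := by
    have hs : 0 < √(l ^ 2 - b ^ 2) := Real.sqrt_pos.2 hd
    have hs2 : √(l ^ 2 - b ^ 2) ^ 2 = l ^ 2 - b ^ 2 := Real.sq_sqrt hd.le
    have : ‖L‖ ≤ 1 / √(l ^ 2 - b ^ 2) := by
      refine L.opNorm_le_bound (by positivity) fun v => ?_
      have h := lin_bound bs l b m hl hb hm hm0 hmb v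
      rw [← hs2, ← mul_pow] at h
      have h2 := sq_le_sq.1 h
      rw [abs_mul, abs_of_pos hs, abs_norm] at h2
      rw [div_mul_eq_mul_div, one_mul, le_div_iff₀ hs]
      exact h2
    rw [le_div_iff₀ hs] at this
    rw [← hs2, ← mul_pow]
    exact pow_le_one₀ (by positivity) this
  have h1 := hΛ (fun x => bs.coord 1 x) hcd.contDiffOn (fun x _ h => h)
  have h2 := mean_coord_sq bs
  have h3 : ∫ x in Om bs, ‖fderiv ℝ (fun x => bs.coord 1 x) x‖ ^ 2 = ‖L‖ ^ 2 * volume.real (Om bs) := by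
    simp only [(hfd _).fderiv]
    simp [mul_comm]
  have hV : 0 < volume.real (Om bs) := by
    rw [measureReal_def]
    exact ENNReal.toReal_pos (Om_pos bs).ne' (Om_fin bs).ne
  rw [h3] at h1
  set J := ∫ x in Om bs, (bs.coord 1 x) ^ 2 with hJ
  have hJ0 : 0 < J := by linarith
  have h4 : Λ ≤ 9 * ‖L‖ ^ 2 := by
    have : Λ * J ≤ (9 * ‖L‖ ^ 2) * J := by
      calc _ ≤ _ := h1
        _ ≤ ‖L‖ ^ 2 * (9 * J) := by gcongr
        _ = _ := by ring
    exact le_of_mul_le_mul_right this hJ0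
  have h5 : Λ * (l ^ 2 - b ^ 2) ≤ 9 := by nlinarith
  have h6 : 9 * (b ^ 2 * (l - b)) ≤ l ^ 2 * (l + b) := by
    nlinarith [sq_nonneg (b - 2 * (l - b)), mul_nonneg hb0.le (sq_nonneg (b - 2 * (l - b))),
      pow_pos hb0 3, pow_pos (sub_pos.2 hlt) 3]
  rw [div_pow, mul_div_assoc', div_le_one (by positivity)]
  have h7 : Λ * (b * (l - b)) ^ 2 * (l + b) ≤ l ^ 2 * (l + b) := by
    calc Λ * (b * (l - b)) ^ 2 * (l + b) = (Λ * (l ^ 2 - b ^ 2)) * (b ^ 2 * (l - b)) := by ring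
      _ ≤ 9 * (b ^ 2 * (l - b)) := by
        have : 0 ≤ b ^ 2 * (l - b) := mul_nonneg (by positivity) (by linarith)
        gcongr
      _ ≤ _ := h6
  exact le_of_mul_le_mul_right h7 (by linarith)

lemma rayleigh_nonneg {Ω Sig : Set Pt} {r : ℝ} (h : r ∈ RayleighSet Ω Sig) : 0 ≤ r := by
  obtain ⟨u, -, -, -, rfl⟩ := h
  exact div_nonneg (integral_nonneg fun _ => by positivity) (integral_nonneg fun _ => by positivity)

/-- if both angles adjacent to the middle side `M = [A,C]` are strictly
less than `π/2`, then `λ₁^M ≤ λ₁^{L ∪ S}`. Sides: `S = [B,C]`, `M = [A,C]`, `L = [A,B]`. -/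
theorem lambda1_middle_le (A B C : Pt)
    (hnd : AffineIndependent ℝ ![A, B, C])
    (hSM : dist B C ≤ dist A C) (hML : dist A C ≤ dist A B)
    (hA : EuclideanGeometry.angle B A C < π / 2)
    (hC : EuclideanGeometry.angle B C A < π / 2) :
    lambda1 (interior (convexHull ℝ {A, B, C})) (segment ℝ A C) ≤
      lambda1 (interior (convexHull ℝ {A, B, C})) (segment ℝ A B ∪ segment ℝ B C) := by
  have htop : affineSpan ℝ (Set.range ![A, B, C]) = ⊤ := by
    rw [hnd.affineSpan_eq_top_iff_card_eq_finrank_add_one]; simp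
  let bs : AB3 := ⟨![A, B, C], hnd, htop⟩
  have b0 : bs 0 = A := rfl
  have b1 : bs 1 = B := rfl
  have b2 : bs 2 = C := rfl
  have hrange : Set.range bs = {A, B, C} := by
    ext x
    constructor
    · rintro ⟨i, rfl⟩
      fin_cases i
      · exact Or.inl rfl
      · exact Or.inr (Or.inl rfl)
      · exact Or.inr (Or.inr rfl)
    · rintro (rfl | rfl | rfl)
      · exact ⟨0, rfl⟩
      · exact ⟨1, rfl⟩
      · exact ⟨2, rfl⟩
  have hOm : interior (convexHull ℝ {A, B, C}) = Om bs := by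
    rw [Om_eq, Cl_eq, hrange]
  rw [hOm]
  have d0 : ∀ i j : Fin 3, bs.coord i (bs j) = if i = j then 1 else 0 := fun i j =>
    AffineBasis.coord_apply bs i j
  have seg : ∀ (i j : Fin 3), segment ℝ (bs i) (bs j) ⊆ Cl bs := by
    intro i j
    apply (Cl_convex bs).segment_subset
    · intro k; rw [d0]; split_ifs <;> norm_num
    · intro k; rw [d0]; split_ifs <;> norm_num
  have segc : ∀ (i j k : Fin 3), k ≠ i → k ≠ j → ∀ x ∈ segment ℝ (bs i) (bs j), bs.coord k x = 0 := by
    intro i j k h1 h2 x hx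
    rw [segment_eq_image_lineMap] at hx
    obtain ⟨t, -, rfl⟩ := hx
    rw [AffineMap.apply_lineMap, d0, d0]
    simp [h1, h2]
  have segAC : ∀ x ∈ Cl bs, bs.coord 1 x = 0 → x ∈ segment ℝ A C := by
    intro x hx h
    have hr := bs.linear_combination_coord_eq_self x
    have hs := coord_sum bs x
    rw [Fin.sum_univ_three, h, zero_smul, add_zero] at hr
    exact ⟨bs.coord 0 x, bs.coord 2 x, hx 0, hx 2, by linarith, hr⟩
  have segAB : ∀ x ∈ Cl bs, bs.coord 2 x = 0 → x ∈ segment ℝ A B := by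
    intro x hx h
    have hr := bs.linear_combination_coord_eq_self x
    have hs := coord_sum bs x
    rw [Fin.sum_univ_three, h, zero_smul, add_zero] at hr
    exact ⟨bs.coord 0 x, bs.coord 1 x, hx 0, hx 1, by linarith, hr⟩
  have segBC : ∀ x ∈ Cl bs, bs.coord 0 x = 0 → x ∈ segment ℝ B C := by
    intro x hx h
    have hr := bs.linear_combination_coord_eq_self x
    have hs := coord_sum bs x
    rw [Fin.sum_univ_three, h, zero_smul, zero_add] at hr
    exact ⟨bs.coord 1 x, bs.coord 2 x, hx 1, hx 2, by linarith, hr⟩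
  set Λ := lambda1 (Om bs) (segment ℝ A C) with hΛd
  have hΛ0 : 0 ≤ Λ := Real.sInf_nonneg fun r hr => rayleigh_nonneg hr
  have hΛ : ∀ v : Pt → ℝ, ContDiffOn ℝ 1 v (Cl bs) → (∀ x ∈ Cl bs, bs.coord 1 x = 0 → v x = 0) →
      Λ * ∫ x in Om bs, v x ^ 2 ≤ ∫ x in Om bs, ‖fderiv ℝ v x‖ ^ 2 := by
    intro v hv hv0
    have n1 : 0 ≤ ∫ x in Om bs, ‖fderiv ℝ v x‖ ^ 2 := integral_nonneg fun _ => by positivity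
    have n2 : 0 ≤ ∫ x in Om bs, v x ^ 2 := integral_nonneg fun _ => by positivity
    by_cases hz : ∫ x in Om bs, v x ^ 2 = 0
    · rw [hz, mul_zero]; exact n1
    · have : Λ ≤ (∫ x in Om bs, ‖fderiv ℝ v x‖ ^ 2) / ∫ x in Om bs, v x ^ 2 := by
        apply csInf_le ⟨0, fun r hr => rayleigh_nonneg hr⟩
        refine ⟨v, ?_, ?_, hz, ?_⟩
        · unfold MemH1; rw [closure_Om]; exact hv
        · intro x hx
          exact hv0 x (seg 0 2 hx) (segc 0 2 1 (by decide) (by decide) x hx)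
        · simp only [pd_sq]
      rwa [le_div_iff₀ (lt_of_le_of_ne n2 (Ne.symm hz))] at this
  have hAC : A ≠ C := by
    intro h
    have := hnd.injective.ne (show (0 : Fin 3) ≠ 2 by decide)
    exact this h
  have hb0 : 0 < ‖bs 2 - bs 0‖ := by
    rw [norm_pos_iff, sub_ne_zero]; exact hAC.symm
  have hbl : ‖bs 2 - bs 0‖ ≤ ‖bs 1 - bs 0‖ := by
    rw [← dist_eq_norm, ← dist_eq_norm, dist_comm (bs 2), dist_comm (bs 1)]; exact hML
  have hm0 : 0 ≤ inner ℝ (bs 1 - bs 0) (bs 2 - bs 0) := by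
    by_contra hc
    push Not at hc
    have := inner_nonneg_of_angle (B - A) (C - A)
      (by simpa [EuclideanGeometry.angle] using hA.le)
    exact absurd this (not_le.2 hc)
  have hmb : inner ℝ (bs 1 - bs 0) (bs 2 - bs 0) ≤ ‖bs 2 - bs 0‖ ^ 2 := by
    have h := inner_nonneg_of_angle (B - C) (A - C)
      (by simpa [EuclideanGeometry.angle] using hC.le)
    have e : (inner ℝ (B - C) (A - C) : ℝ) = ‖C - A‖ ^ 2 - inner ℝ (B - A) (C - A) := by
      have h1 : B - C = (B - A) - (C - A) := by abel
      have h2 : A - C = -(C - A) := by abel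
      rw [h1, h2, inner_neg_right, inner_sub_left, real_inner_self_eq_norm_sq]
      ring
    rw [e] at h
    show (inner ℝ (B - A) (C - A) : ℝ) ≤ ‖C - A‖ ^ 2
    linarith
  have hw := hw_bound bs _ _ _ Λ rfl rfl rfl hm0 hmb hb0 hbl hΛ0 hΛ
  unfold lambda1
  apply le_csInf
  · -- nonempty
    have hcc : ∀ i, ContDiff ℝ 1 (fun x => bs.coord i x) := by
      intro i
      have e : (fun x => bs.coord i x) =
          fun x => LinearMap.toContinuousLinearMap (bs.coord i).linear x + bs.coord i 0 := by
        funext y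
        have := lin_sub bs i y 0
        rw [sub_zero] at this
        show bs.coord i y = (bs.coord i).linear y + bs.coord i 0
        rw [this]; ring
      rw [e]
      exact (ContinuousLinearMap.contDiff _).add contDiff_const
    have hcd : ContDiff ℝ 1 (fun x => bs.coord 2 x * bs.coord 0 x) := (hcc 2).mul (hcc 0)
    refine ⟨_, fun x => bs.coord 2 x * bs.coord 0 x, hcd.contDiffOn, ?_, ?_, rfl⟩
    · rintro x (hx | hx)
      · simp only [segc 0 1 2 (by decide) (by decide) x hx, zero_mul]
      · simp only [segc 1 2 0 (by decide) (by decide) x hx, mul_zero]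
    · apply ne_of_gt
      rw [setIntegral_pos_iff_support_of_nonneg_ae]
      · refine lt_of_lt_of_le (Om_pos bs) (measure_mono fun x hx => ⟨?_, hx⟩)
        have p2 := hx 2
        have p0 := hx 0
        rw [Function.mem_support]
        positivity
      · exact Filter.Eventually.of_forall fun x => by positivity
      · exact intOn_of_cont bs (hcd.continuous.pow 2).continuousOn
  · rintro r ⟨u, hu, hu0, hne, rfl⟩
    have hadm : Adm bs u := by
      refine ⟨by unfold MemH1 at hu; rwa [closure_Om] at hu, ?_⟩
      rintro x hx (h | h)
      · exact hu0 x (Or.inl (segAB x hx h))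
      · exact hu0 x (Or.inr (segBC x hx h))
    have n2 : 0 ≤ ∫ x in Om bs, u x ^ 2 := integral_nonneg fun _ => by positivity
    rw [le_div_iff₀ (lt_of_le_of_ne n2 (Ne.symm hne))]
    simp only [pd_sq]
    exact core2 bs _ _ Λ rfl rfl hb0 hbl hΛ0 hΛ hw u hadm
end
end

section
/- Let Ω be a right triangle with sides S, M, L ordered nondecreasingly by length (so L is the hypotenuse). Then max{λ₁^S, λ₁^M} ≤ λ₁^L, i.e., imposing the Dirichlet condition on the hypotenuse yields a lowest eigenvalue at least as large as imposing it on either cathetus. -/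
open MeasureTheory EuclideanGeometry Real

noncomputable section

/-- index set `i + j < N`. -/
def SS (N : ℕ) : Finset (ℕ × ℕ) := (Finset.range N ×ˢ Finset.range N).filter (fun p => p.1 + p.2 < N)

lemma mem_SS {N : ℕ} {p : ℕ × ℕ} : p ∈ SS N ↔ p.1 + p.2 < N := by
  unfold SS; simp only [Finset.mem_filter, Finset.mem_product, Finset.mem_range]; omega

/-- discrete bilinear form. -/
def BB (N : ℕ) (α β : ℝ) (u f : ℕ → ℕ → ℝ) : ℝ :=
  ∑ p ∈ SS N, (α * (u (p.1+1) p.2 - u p.1 p.2) * (f (p.1+1) p.2 - f p.1 p.2)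
    + β * (u p.1 (p.2+1) - u p.1 p.2) * (f p.1 (p.2+1) - f p.1 p.2))

def MM (N : ℕ) (u f : ℕ → ℕ → ℝ) : ℝ := ∑ p ∈ SS N, u p.1 p.2 * f p.1 p.2

lemma sum_SS (N : ℕ) (F : ℕ → ℕ → ℝ) {L : ℕ} (hL : N ≤ L) :
    ∑ p ∈ SS N, F p.1 p.2 =
      ∑ i ∈ Finset.range L, ∑ j ∈ Finset.range L, if i + j < N then F i j else 0 := by
  rw [← Finset.sum_product', ← Finset.sum_filter]
  apply Finset.sum_congr _ (fun _ _ => rfl)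
  ext p; rw [mem_SS]; simp only [Finset.mem_filter, Finset.mem_product, Finset.mem_range]; omega

lemma exists_min_quad {ι : Type*} [Fintype ι] [Nonempty ι] (Q : (ι → ℝ) → ℝ) (hc : Continuous Q)
    (hh : ∀ (c : ℝ) x, Q (c • x) = c^2 * Q x) :
    ∃ x : ι → ℝ, ∑ i, x i ^ 2 = 1 ∧ ∀ y, Q x * ∑ i, y i ^ 2 ≤ Q y := by
  classical
  have hcomp : IsCompact {x : ι → ℝ | ∑ i, x i ^ 2 = 1} := by
    apply Metric.isCompact_of_isClosed_isBounded
    · exact isClosed_eq (by fun_prop) continuous_const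
    · refine (Metric.isBounded_closedBall (x := (0 : ι → ℝ)) (r := 1)).subset ?_
      intro x hx
      rw [mem_closedBall_zero_iff, pi_norm_le_iff_of_nonneg zero_le_one]
      intro i
      have : x i ^ 2 ≤ ∑ i, x i ^ 2 :=
        Finset.single_le_sum (f := fun i => x i ^ 2) (fun _ _ => sq_nonneg _) (Finset.mem_univ i)
      rw [hx] at this
      rw [Real.norm_eq_abs]
      exact abs_le_one_iff_mul_self_le_one.mpr (by nlinarith)
  have hne : {x : ι → ℝ | ∑ i, x i ^ 2 = 1}.Nonempty := by
    obtain ⟨i⟩ := ‹Nonempty ι›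
    refine ⟨Pi.single i 1, ?_⟩
    simp [Pi.single_apply]
  obtain ⟨x, hx, hmin⟩ := hcomp.exists_isMinOn hne hc.continuousOn
  refine ⟨x, hx, fun y => ?_⟩
  set s := ∑ i, y i ^ 2 with hs
  have hs0 : 0 ≤ s := Finset.sum_nonneg (fun _ _ => sq_nonneg _)
  rcases hs0.eq_or_lt with h | h
  · have hy : y = (0:ℝ) • x := by
      have := (Finset.sum_eq_zero_iff_of_nonneg (fun i _ => sq_nonneg (y i))).1 (hs.symm.trans h.symm)
      ext i
      have h2 := this i (Finset.mem_univ i)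
      simpa using h2
    rw [hy, hh, ← h]; simp
  · have hq : (√s)^2 = s := Real.sq_sqrt hs0
    have hsp : 0 < √s := Real.sqrt_pos.2 h
    have h1 : (√s)⁻¹ • y ∈ {x : ι → ℝ | ∑ i, x i ^ 2 = 1} := by
      simp only [Set.mem_ofPred_eq, Pi.smul_apply, smul_eq_mul, mul_pow]
      rw [← Finset.mul_sum, ← hs, inv_pow, hq]; field_simp
    have h2 := hmin h1
    simp only [Set.mem_ofPred_eq] at h2
    rw [hh, inv_pow, hq] at h2
    calc Q x * s ≤ (s⁻¹ * Q y) * s := by gcongr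
      _ = Q y := by field_simp

lemma lin_zero {a b : ℝ} (h : ∀ t : ℝ, 0 ≤ 2 * t * a + t^2 * b) : a = 0 := by
  by_contra ha
  by_cases hb : b ≤ 0
  · have := h (-a)
    have : 0 < a^2 := by positivity
    nlinarith [sq_nonneg a]
  · push Not at hb
    have h1 := h (-a / b)
    have : 0 < a^2 / b := by positivity
    have e : 2 * (-a / b) * a + (-a/b)^2 * b = - (a^2/b) := by field_simp; ring
    linarith

lemma disc_min (N : ℕ) (hN : 1 ≤ N) (α β : ℝ) :
    ∃ (u : ℕ → ℕ → ℝ) (lam : ℝ), (∀ i j, N ≤ i + j → u i j = 0) ∧ MM N u u = 1 ∧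
      (∀ f : ℕ → ℕ → ℝ, (∀ i j, N ≤ i + j → f i j = 0) → lam * MM N f f ≤ BB N α β f f) ∧
      (∀ f : ℕ → ℕ → ℝ, (∀ i j, N ≤ i + j → f i j = 0) → BB N α β u f = lam * MM N u f) := by
  classical
  let ext : (SS N → ℝ) → ℕ → ℕ → ℝ := fun x i j => if h : (i, j) ∈ SS N then x ⟨(i,j), h⟩ else 0
  have hext0 : ∀ x i j, N ≤ i + j → ext x i j = 0 := by
    intro x i j h
    have : (i, j) ∉ SS N := by rw [mem_SS]; simpa using h
    simp [ext, this]
  have hext1 : ∀ f : ℕ → ℕ → ℝ, (∀ i j, N ≤ i + j → f i j = 0) →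
      ext (fun p => f p.1.1 p.1.2) = f := by
    intro f hf
    ext i j
    by_cases h : (i, j) ∈ SS N
    · simp [ext, h]
    · have h' : N ≤ i + j := by rw [mem_SS] at h; simpa using h
      simp [ext, h, hf _ _ h']
  have hM : ∀ x, MM N (ext x) (ext x) = ∑ i, x i ^ 2 := by
    intro x
    unfold MM
    rw [← Finset.sum_coe_sort (SS N)]
    apply Finset.sum_congr rfl
    rintro ⟨⟨i, j⟩, h⟩ _
    simp [ext, h]; ring
  have hextc : ∀ i j, Continuous (fun x => ext x i j) := by
    intro i j
    by_cases h : (i, j) ∈ SS N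
    · simp only [ext, h, dite_true]; fun_prop
    · simp only [ext, h, dite_false]; fun_prop
  have : Nonempty (SS N) := ⟨⟨(0,0), by rw [mem_SS]; change 0 + 0 < N; omega⟩⟩
  obtain ⟨x, hx, hmin⟩ := exists_min_quad (fun x => BB N α β (ext x) (ext x))
    (by unfold BB; fun_prop) (by
      intro c x
      have : ∀ i j, ext (c • x) i j = c * ext x i j := by
        intro i j; simp only [ext, Pi.smul_apply, smul_eq_mul]; split_ifs <;> simp
      simp only [BB, this, Finset.mul_sum]
      apply Finset.sum_congr rfl; intros; ring)
  have key : ∀ f : ℕ → ℕ → ℝ, (∀ i j, N ≤ i + j → f i j = 0) →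
      BB N α β (ext x) (ext x) * MM N f f ≤ BB N α β f f := by
    intro f hf
    have := hmin (fun p => f p.1.1 p.1.2)
    rwa [← hM, hext1 f hf] at this
  refine ⟨ext x, BB N α β (ext x) (ext x), hext0 x, by rw [hM, hx], key, ?_⟩
  intro f hf
  set lam := BB N α β (ext x) (ext x) with hlam
  set u := ext x
  have hMu : MM N u u = 1 := by rw [hM, hx]
  have : BB N α β u f - lam * MM N u f = 0 := by
    apply lin_zero (b := BB N α β f f - lam * MM N f f)
    intro t
    have h := key (fun i j => u i j + t * f i j) (by
      intro i j h; simp only [u]; rw [hext0 _ _ _ h, hf _ _ h]; ring)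
    have e1 : MM N (fun i j => u i j + t * f i j) (fun i j => u i j + t * f i j)
        = MM N u u + 2 * t * MM N u f + t^2 * MM N f f := by
      simp only [MM, Finset.mul_sum, ← Finset.sum_add_distrib]
      apply Finset.sum_congr rfl; intros; ring
    have e2 : BB N α β (fun i j => u i j + t * f i j) (fun i j => u i j + t * f i j)
        = BB N α β u u + 2 * t * BB N α β u f + t^2 * BB N α β f f := by
      simp only [BB, Finset.mul_sum, ← Finset.sum_add_distrib]
      apply Finset.sum_congr rfl; intros; ring
    rw [e1, e2, hMu, ← hlam] at h
    linarith
  linarith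

lemma abel (f g : ℕ → ℝ) (L : ℕ) :
    ∑ i ∈ Finset.range L, g (i+1) * (f (i+1) - f i) =
      f L * g L - f 0 * g 0 - ∑ i ∈ Finset.range L, f i * (g (i+1) - g i) := by
  induction L with
  | zero => simp
  | succ n ih => rw [Finset.sum_range_succ, Finset.sum_range_succ, ih]; ring

/-- backward difference, zero at 0 -/
def bd (f : ℕ → ℝ) : ℕ → ℝ
  | 0 => 0
  | (i+1) => f (i+1) - f i

lemma disc_main (N : ℕ) (hN : 1 ≤ N) (α β : ℝ) (hβ : 0 < β) :
    ∃ (v : ℕ → ℕ → ℝ) (lam : ℝ), (∀ j, v 0 j = 0) ∧ 0 < MM (N+1) v v ∧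
      BB N α β v v ≤ lam * MM (N+1) v v ∧
      (∀ f : ℕ → ℕ → ℝ, (∀ i j, N ≤ i + j → f i j = 0) → lam * MM N f f ≤ BB N α β f f) := by
  obtain ⟨u, lam, hu, hu1, hmin, hEL⟩ := disc_min N hN α β
  let v : ℕ → ℕ → ℝ := fun i j => bd (fun i => u i j) i
  let w : ℕ → ℕ → ℝ := fun i j => bd (fun j => u i j) j
  let z : ℕ → ℕ → ℝ := fun i j => bd (fun j => v i j) j
  let X : ℕ → ℕ → ℝ := fun i j => v (i+1) j - v i j
  let Y : ℕ → ℕ → ℝ := fun i j => w i (j+1) - w i j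
  have v0 : ∀ j, v 0 j = 0 := fun j => rfl
  have w0 : ∀ i, w i 0 = 0 := fun j => rfl
  have z0 : ∀ i, z i 0 = 0 := fun j => rfl
  have vs : ∀ i j, v (i+1) j = u (i+1) j - u i j := fun _ _ => rfl
  have ws : ∀ i j, w i (j+1) = u i (j+1) - u i j := fun _ _ => rfl
  have zs : ∀ i j, z i (j+1) = v i (j+1) - v i j := fun _ _ => rfl
  have vbig : ∀ i j, N + 1 ≤ i + j → v i j = 0 := by
    intro i j h
    rcases i with _ | i
    · rfl
    · rw [vs, hu _ _ (by omega), hu _ _ (by omega)]; ring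
  have wbig : ∀ i j, N + 1 ≤ i + j → w i j = 0 := by
    intro i j h
    rcases j with _ | j
    · rfl
    · rw [ws, hu _ _ (by omega), hu _ _ (by omega)]; ring
  have hYz : ∀ i j, Y (i+1) j - Y i j = z (i+1) (j+1) - z (i+1) j := by
    intro i j
    rcases j with _ | j
    · simp only [Y, ws, w0, zs, z0, vs]; ring
    · simp only [Y, ws, zs, vs]; ring
  let L := N + 2
  -- (a)
  have ha : MM N u X = - MM (N+1) v v := by
    have e1 : MM N u X = ∑ j ∈ Finset.range L, ∑ i ∈ Finset.range L, u i j * X i j := by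
      unfold MM
      rw [sum_SS N (fun i j => u i j * X i j) (L := L) (by omega), Finset.sum_comm]
      refine Finset.sum_congr rfl fun j _ => Finset.sum_congr rfl fun i _ => ?_
      split_ifs with h
      · rfl
      · rw [hu _ _ (by omega)]; ring
    have e2 : MM (N+1) v v = ∑ j ∈ Finset.range L, ∑ i ∈ Finset.range L, v (i+1) j * v (i+1) j := by
      unfold MM
      rw [sum_SS (N+1) (fun i j => v i j * v i j) (L := L+1) (by omega), Finset.sum_comm, Finset.sum_range_succ]
      have : ∑ x ∈ Finset.range (L+1), (if x + L < N + 1 then v x L * v x L else 0) = 0 := by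
        apply Finset.sum_eq_zero; intro i _; rw [if_neg (by omega)]
      rw [this, add_zero]
      refine Finset.sum_congr rfl fun j _ => ?_
      rw [Finset.sum_range_succ', v0]
      simp only [mul_zero, ite_self, add_zero]
      refine Finset.sum_congr rfl fun i _ => ?_
      split_ifs with h
      · rfl
      · rw [vbig _ _ (by omega)]; ring
    rw [e1, e2, ← Finset.sum_neg_distrib]
    refine Finset.sum_congr rfl fun j _ => ?_
    have := abel (fun i => u i j) (fun i => v i j) L
    simp only [v0, hu L j (by omega)] at this
    simp only [X]
    have h2 : ∑ i ∈ Finset.range L, v (i + 1) j * (u (i + 1) j - u i j) =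
      ∑ i ∈ Finset.range L, v (i + 1) j * v (i+1) j := rfl
    linarith
  -- test function
  let g : ℕ → ℕ → ℝ := fun i j => if i + j < N then X i j else 0
  have hg : ∀ i j, N ≤ i + j → g i j = 0 := by
    intro i j h; simp only [g]; rw [if_neg (by omega)]
  have hMg : MM N u g = MM N u X := by
    unfold MM
    refine Finset.sum_congr rfl fun p hp => ?_
    rw [mem_SS] at hp
    simp only [g, if_pos hp]
  have hB : BB N α β u g = - ∑ p ∈ SS N, (α * X p.1 p.2 ^ 2 + β * (X p.1 p.2 * Y p.1 p.2)) := by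
    have e1 : BB N α β u g = α * (∑ j ∈ Finset.range L, ∑ i ∈ Finset.range L, v (i+1) j * (g (i+1) j - g i j))
       + β * (∑ i ∈ Finset.range L, ∑ j ∈ Finset.range L, w i (j+1) * (g i (j+1) - g i j)) := by
      unfold BB
      rw [sum_SS N (fun i j => α * (u (i+1) j - u i j) * (g (i+1) j - g i j)
        + β * (u i (j+1) - u i j) * (g i (j+1) - g i j)) (L := L) (by omega)]
      rw [Finset.sum_comm (s := Finset.range L) (t := Finset.range L) (f := fun j i => v (i+1) j * (g (i+1) j - g i j))]
      simp only [Finset.mul_sum, ← Finset.sum_add_distrib]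
      refine Finset.sum_congr rfl fun i _ => Finset.sum_congr rfl fun j _ => ?_
      split_ifs with h
      · rw [vs, ws]; ring
      · rw [vbig _ _ (by omega), wbig _ _ (by omega)]; ring
    have e2 : ∑ p ∈ SS N, (α * X p.1 p.2 ^ 2 + β * (X p.1 p.2 * Y p.1 p.2)) =
        α * (∑ j ∈ Finset.range L, ∑ i ∈ Finset.range L, g i j * (v (i+1) j - v i j))
       + β * (∑ i ∈ Finset.range L, ∑ j ∈ Finset.range L, g i j * (w i (j+1) - w i j)) := by
      rw [sum_SS N (fun i j => α * X i j ^ 2 + β * (X i j * Y i j)) (L := L) (by omega)]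
      rw [Finset.sum_comm (s := Finset.range L) (t := Finset.range L) (f := fun j i => g i j * (v (i+1) j - v i j))]
      simp only [Finset.mul_sum, ← Finset.sum_add_distrib]
      refine Finset.sum_congr rfl fun i _ => Finset.sum_congr rfl fun j _ => ?_
      simp only [g]
      split_ifs with h
      · simp only [X, Y]; ring
      · ring
    rw [e1, e2]
    have e3 : ∀ j, ∑ i ∈ Finset.range L, v (i+1) j * (g (i+1) j - g i j) =
        - ∑ i ∈ Finset.range L, g i j * (v (i+1) j - v i j) := by
      intro j
      have := abel (fun i => g i j) (fun i => v i j) L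
      simp only [v0, hg L j (by omega)] at this
      linarith
    have e4 : ∀ i, ∑ j ∈ Finset.range L, w i (j+1) * (g i (j+1) - g i j) =
        - ∑ j ∈ Finset.range L, g i j * (w i (j+1) - w i j) := by
      intro i
      have := abel (fun j => g i j) (fun j => w i j) L
      simp only [w0, hg i L (by omega)] at this
      linarith
    simp only [e3, e4, Finset.sum_neg_distrib]; ring
  -- (b)
  have hb : ∑ i ∈ Finset.range L, ∑ j ∈ Finset.range L, X i j * Y i j =
      ∑ i ∈ Finset.range L, ∑ j ∈ Finset.range L, z i (j+1) ^ 2 := by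
    have e1 : ∑ i ∈ Finset.range L, ∑ j ∈ Finset.range L, X i j * Y i j =
       - ∑ j ∈ Finset.range L, ∑ i ∈ Finset.range L, v (i+1) j * (z (i+1) (j+1) - z (i+1) j) := by
      rw [Finset.sum_comm, ← Finset.sum_neg_distrib]
      refine Finset.sum_congr rfl fun j _ => ?_
      have := abel (fun i => Y i j) (fun i => v i j) L
      simp only [v0, vbig L j (by omega), hYz] at this
      have h2 : ∑ i ∈ Finset.range L, X i j * Y i j = ∑ i ∈ Finset.range L, Y i j * (v (i+1) j - v i j) :=
        Finset.sum_congr rfl fun i _ => by simp only [X]; ring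
      linarith
    have e2 : ∑ i ∈ Finset.range L, ∑ j ∈ Finset.range L, z i (j+1) ^ 2 =
        ∑ i ∈ Finset.range L, ∑ j ∈ Finset.range L, z (i+1) (j+1) ^ 2 := by
      have h1 := Finset.sum_range_succ (fun i => ∑ j ∈ Finset.range L, z i (j+1) ^ 2) L
      have h2 := Finset.sum_range_succ' (fun i => ∑ j ∈ Finset.range L, z i (j+1) ^ 2) L
      have h3 : ∑ j ∈ Finset.range L, z L (j+1) ^ 2 = 0 := by
        apply Finset.sum_eq_zero; intro j _; rw [zs, vbig _ _ (by omega), vbig _ _ (by omega)]; ring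
      have h4 : ∑ j ∈ Finset.range L, z 0 (j+1) ^ 2 = 0 := by
        apply Finset.sum_eq_zero; intro j _; rw [zs, v0, v0]; ring
      linarith
    rw [e1, e2, Finset.sum_comm, ← Finset.sum_neg_distrib]
    refine Finset.sum_congr rfl fun i _ => ?_
    have := abel (fun j => v (i+1) j) (fun j => z (i+1) j) L
    simp only [z0, vbig (i+1) L (by omega)] at this
    have h2 : ∑ j ∈ Finset.range L, z (i+1) (j+1) ^ 2 =
        ∑ j ∈ Finset.range L, z (i+1) (j+1) * (v (i+1) (j+1) - v (i+1) j) :=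
      Finset.sum_congr rfl fun j _ => by rw [zs]; ring
    linarith
  -- (c)
  have hdiag : ∀ F : ℕ → ℕ → ℝ, (∀ i j, N + 1 ≤ i + j → F i j = 0) →
      ∑ i ∈ Finset.range L, ∑ j ∈ Finset.range L, F i j =
       ∑ p ∈ SS N, F p.1 p.2 + ∑ k ∈ Finset.range (N+1), F k (N-k) := by
    intro F hF
    rw [sum_SS N F (L := L) (by omega)]
    have : ∑ k ∈ Finset.range (N+1), F k (N-k) = ∑ i ∈ Finset.range L, ∑ j ∈ Finset.range L,
        if i + j = N then F i j else 0 := by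
      rw [Finset.sum_range_succ _ (N+1)]
      have : ∑ j ∈ Finset.range L, (if N + 1 + j = N then F (N+1) j else 0) = 0 := by
        apply Finset.sum_eq_zero; intro i _; rw [if_neg (by omega)]
      rw [this, add_zero]
      refine Finset.sum_congr rfl fun i hi => ?_
      rw [Finset.mem_range] at hi
      rw [Finset.sum_eq_single (N - i)]
      · rw [if_pos (by omega)]
      · intro j _ hj; rw [if_neg (by omega)]
      · intro h; exfalso; apply h; rw [Finset.mem_range]; omega
    rw [this]
    simp only [← Finset.sum_add_distrib]
    refine Finset.sum_congr rfl fun i _ => Finset.sum_congr rfl fun j _ => ?_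
    by_cases h : i + j < N
    · rw [if_pos h, if_neg (by omega)]; ring
    · by_cases h' : i + j = N
      · rw [if_neg h, if_pos h']; ring
      · rw [if_neg h, if_neg h', hF _ _ (by omega)]; ring
  rw [hdiag (fun i j => X i j * Y i j) (by
      intro i j h
      simp only [X]; rw [vbig _ _ (by omega), vbig _ _ (by omega)]; ring),
    hdiag (fun i j => z i (j+1)^2) (by
      intro i j h
      rw [zs, vbig _ _ (by omega), vbig _ _ (by omega)]; ring)] at hb
  have hd : ∑ k ∈ Finset.range (N+1), X k (N-k) * Y k (N-k) ≤ ∑ k ∈ Finset.range (N+1), z k (N-k+1)^2 := by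
    have e1 : ∑ k ∈ Finset.range (N+1), z k (N-k+1)^2 = ∑ k ∈ Finset.range (N+1), v k (N-k)^2 := by
      refine Finset.sum_congr rfl fun i hi => ?_
      rw [Finset.mem_range] at hi
      rw [zs, vbig i (N-i+1) (by omega)]; ring
    have e2 : ∑ k ∈ Finset.range (N+1), w k (N-k)^2 ≤ ∑ k ∈ Finset.range (N+1), v k (N-k)^2 := by
      rw [Finset.sum_range_succ, Finset.sum_range_succ', Nat.sub_self, w0]
      have : ∑ k ∈ Finset.range N, w k (N-k)^2 = ∑ k ∈ Finset.range N, v (k+1) (N-(k+1))^2 := by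
        refine Finset.sum_congr rfl fun i hi => ?_
        rw [Finset.mem_range] at hi
        have : N - i = (N-(i+1)) + 1 := by omega
        rw [this, ws, vs, hu i (N-(i+1)+1) (by omega), hu (i+1) (N-(i+1)) (by omega)]
      rw [this]
      nlinarith [sq_nonneg (v 0 (N-0))]
    have e3 : ∑ k ∈ Finset.range (N+1), X k (N-k) * Y k (N-k) ≤
        ∑ k ∈ Finset.range (N+1), (v k (N-k)^2 / 2 + w k (N-k)^2 / 2) := by
      refine Finset.sum_le_sum fun i hi => ?_
      rw [Finset.mem_range] at hi
      simp only [X, Y]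
      rw [vbig (i+1) (N-i) (by omega), wbig i (N-i+1) (by omega)]
      nlinarith [sq_nonneg (v i (N-i) - w i (N-i))]
    rw [Finset.sum_add_distrib, ← Finset.sum_div, ← Finset.sum_div] at e3
    linarith
  have hfin := hEL g hg
  rw [hMg, ha, hB] at hfin
  have hE : BB N α β v v = ∑ p ∈ SS N, α * X p.1 p.2 ^2 + β * ∑ p ∈ SS N, z p.1 (p.2+1)^2 := by
    unfold BB
    rw [Finset.mul_sum, ← Finset.sum_add_distrib]
    refine Finset.sum_congr rfl fun p _ => ?_
    simp only [X, zs]; ring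
  have hle : BB N α β v v ≤ lam * MM (N+1) v v := by
    rw [Finset.sum_add_distrib, ← Finset.mul_sum (SS N) _ β] at hfin
    rw [hE]
    have : ∑ p ∈ SS N, z p.1 (p.2+1)^2 ≤ ∑ p ∈ SS N, X p.1 p.2 * Y p.1 p.2 := by linarith
    have := mul_le_mul_of_nonneg_left this hβ.le
    linarith
  refine ⟨v, lam, v0, ?_, hle, hmin⟩
  have hnn : 0 ≤ MM (N+1) v v := Finset.sum_nonneg fun p _ => mul_self_nonneg _
  refine lt_of_le_of_ne hnn fun h0 => ?_
  have hall : ∀ i j, v i j = 0 := by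
    intro i j
    by_cases h : i + j < N + 1
    · have := (Finset.sum_eq_zero_iff_of_nonneg (fun p _ => mul_self_nonneg (v p.1 p.2))).1 h0.symm (i, j) (mem_SS.2 h)
      exact mul_self_eq_zero.1 this
    · exact vbig _ _ (by omega)
  have huc : ∀ j i, u i j = u 0 j := by
    intro j i
    induction i with
    | zero => rfl
    | succ n ih => have := hall (n+1) j; rw [vs] at this; linarith
  have hu0 : ∀ i j, u i j = 0 := by
    intro i j
    rw [huc, ← huc j N, hu _ _ (by omega)]
  have : MM N u u = 0 := Finset.sum_eq_zero fun p _ => by rw [hu0]; ring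
  linarith

lemma sum_SS' (N : ℕ) (F : ℕ → ℕ → ℝ) {L : ℕ} (hL : N ≤ L) :
    ∑ p ∈ SS N, F p.1 p.2 = ∑ j ∈ Finset.range L, ∑ i ∈ Finset.range (N - j), F i j := by
  rw [sum_SS N F hL, Finset.sum_comm]
  refine Finset.sum_congr rfl fun j _ => ?_
  rw [← Finset.sum_filter]
  apply Finset.sum_congr _ (fun _ _ => rfl)
  ext p; simp only [Finset.mem_filter, Finset.mem_range]; omega

lemma trace1 (f : ℕ → ℝ) (h0 : f 0 = 0) (ε : ℝ) (hε : 0 < ε) (n : ℕ) :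
    f n ^ 2 ≤ ∑ i ∈ Finset.range n, (f (i+1) - f i)^2 / (2 * ε)
      + 2 * ε * ∑ i ∈ Finset.range (n+1), f i * f i := by
  have h1 : f n ^ 2 ≤ ∑ i ∈ Finset.range n, ((f (i+1) - f i)^2 / (2 * ε)
      + ε * (f (i+1) * f (i+1) + f i * f i)) := by
    induction n with
    | zero => simp [h0]
    | succ n ih =>
      rw [Finset.sum_range_succ]
      set d := f (n+1) - f n with hd
      set s := f (n+1) + f n with hs
      have h1 : f (n+1)^2 = f n ^2 + d * s := by rw [hd, hs]; ring
      have h2 : d * s ≤ d^2 / (2*ε) + ε/2 * s^2 := by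
        have : d^2 / (2*ε) + ε/2 * s^2 - d * s = (d - ε * s)^2 / (2*ε) := by field_simp; ring
        have : 0 ≤ (d - ε * s)^2 / (2*ε) := by positivity
        linarith
      have h3 : ε/2 * s^2 ≤ ε * (f (n+1) * f (n+1) + f n * f n) := by
        rw [hs]; nlinarith [mul_nonneg hε.le (sq_nonneg (f (n+1) - f n))]
      linarith
  have h2 : ∑ i ∈ Finset.range n, f i * f i ≤ ∑ i ∈ Finset.range (n+1), f i * f i := by
    rw [Finset.sum_range_succ]; nlinarith [mul_self_nonneg (f n)]
  have h3 : ∑ i ∈ Finset.range n, f (i+1) * f (i+1) ≤ ∑ i ∈ Finset.range (n+1), f i * f i := by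
    rw [Finset.sum_range_succ']; nlinarith [mul_self_nonneg (f 0)]
  rw [Finset.sum_add_distrib, ← Finset.mul_sum, Finset.sum_add_distrib] at h1
  nlinarith

lemma layer (v : ℕ → ℕ → ℝ) (h0 : ∀ j, v 0 j = 0) (ε : ℝ) (hε : 0 < ε) (N d : ℕ) (hd : d ≤ N) :
    MM (d+1) v v ≤ MM d v v + BB N 1 1 v v / (2 * ε) + 2 * ε * MM (N+1) v v := by
  have hB : ∑ p ∈ SS N, (v (p.1+1) p.2 - v p.1 p.2)^2 / (2*ε) ≤ BB N 1 1 v v / (2 * ε) := by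
    rw [← Finset.sum_div]
    gcongr
    unfold BB
    refine Finset.sum_le_sum fun p _ => ?_
    nlinarith [sq_nonneg (v p.1 (p.2+1) - v p.1 p.2)]
  have key : MM (d+1) v v ≤ MM d v v + ∑ p ∈ SS N, (v (p.1+1) p.2 - v p.1 p.2)^2 / (2*ε)
     + 2 * ε * MM (N+1) v v := by
    unfold MM
    rw [sum_SS' (d+1) (fun i j => v i j * v i j) (L := N+1) (by omega),
      sum_SS' d (fun i j => v i j * v i j) (L := N+1) (by omega),
      sum_SS' (N+1) (fun i j => v i j * v i j) (L := N+1) (by omega),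
      sum_SS' N (fun i j => (v (i+1) j - v i j)^2 / (2*ε)) (L := N+1) (by omega),
      Finset.mul_sum, ← Finset.sum_add_distrib, ← Finset.sum_add_distrib]
    refine Finset.sum_le_sum fun j _ => ?_
    have p1 : 0 ≤ ∑ i ∈ Finset.range (N - j), (v (i+1) j - v i j)^2 / (2*ε) :=
      Finset.sum_nonneg fun _ _ => by positivity
    have p2 : 0 ≤ ∑ i ∈ Finset.range (N + 1 - j), v i j * v i j :=
      Finset.sum_nonneg fun _ _ => mul_self_nonneg _
    by_cases hj : j ≤ d
    · have : d + 1 - j = (d - j) + 1 := by omega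
      rw [this, Finset.sum_range_succ]
      have h1 := trace1 (fun i => v i j) (h0 j) ε hε (d - j)
      have h2 : ∑ i ∈ Finset.range (d - j), (v (i+1) j - v i j)^2 / (2*ε) ≤
          ∑ i ∈ Finset.range (N - j), (v (i+1) j - v i j)^2 / (2*ε) :=
        Finset.sum_le_sum_of_subset_of_nonneg (Finset.range_subset_range.2 (by omega))
          fun _ _ _ => by positivity
      have h3 : ∑ i ∈ Finset.range (d - j + 1), v i j * v i j ≤
          ∑ i ∈ Finset.range (N + 1 - j), v i j * v i j :=
        Finset.sum_le_sum_of_subset_of_nonneg (Finset.range_subset_range.2 (by omega))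
          fun _ _ _ => mul_self_nonneg _
      have h4 := mul_le_mul_of_nonneg_left h3 (show 0 ≤ 2 * ε by positivity)
      nlinarith
    · have : d + 1 - j = 0 := by omega
      rw [this]
      have h2 : d - j = 0 := by omega
      rw [h2]
      simp only [Finset.range_zero, Finset.sum_empty]
      positivity
  linarith

lemma exists_sigma (ε : ℝ) (hε : 0 < ε) : ∃ σ ρ : ℝ → ℝ, ContDiff ℝ 1 σ ∧
    (∀ x, HasDerivAt σ (ρ x) x) ∧ (∀ x ≤ 0, σ x = 0) ∧ (∀ x, 1 ≤ x → σ x = 1) ∧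
    (∀ x, 0 ≤ σ x) ∧ (∀ x, σ x ≤ 1) ∧ (∀ x, 0 ≤ ρ x) ∧ (∀ x, ρ x ≤ 1 + ε) ∧
    (∀ x ≤ 0, ρ x = 0) ∧ (∀ x, 1 ≤ x → ρ x = 0) := by
  set δ : ℝ := ε / (4 * (1 + ε)) with hδ
  have hδ0 : 0 < δ := by positivity
  have hδ1 : (1 + ε) * (1 - 2 * δ) ≥ 1 := by
    have : (1 + ε) * δ = ε / 4 := by rw [hδ]; field_simp
    nlinarith
  let r : ℝ → ℝ := fun x => max 0 (min 1 (min (x / δ) ((1 - x) / δ)))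
  have rc : Continuous r := by fun_prop
  have r0 : ∀ x, 0 ≤ r x := fun x => le_max_left _ _
  have r1 : ∀ x, r x ≤ 1 := fun x => max_le zero_le_one (min_le_left _ _)
  have rl : ∀ x ≤ 0, r x = 0 := fun x hx => max_eq_left
    ((min_le_right _ _).trans ((min_le_left _ _).trans (div_nonpos_of_nonpos_of_nonneg hx hδ0.le)))
  have rr : ∀ x, 1 ≤ x → r x = 0 := fun x hx => max_eq_left
    ((min_le_right _ _).trans ((min_le_right _ _).trans (div_nonpos_of_nonpos_of_nonneg (by linarith) hδ0.le)))
  have ii : ∀ a b, IntervalIntegrable r volume a b := fun a b => rc.intervalIntegrable a b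
  set I := ∫ x in (0:ℝ)..1, r x with hI
  have hIge : 1 - 2 * δ ≤ I := by
    have hd : δ ≤ 1 - δ := by
      by_contra h
      push Not at h
      nlinarith
    have e1 : I = (∫ x in (0:ℝ)..δ, r x) + (∫ x in δ..(1-δ), r x) + ∫ x in (1-δ)..1, r x := by
      rw [intervalIntegral.integral_add_adjacent_intervals (ii _ _) (ii _ _),
        intervalIntegral.integral_add_adjacent_intervals (ii _ _) (ii _ _)]
    have e2 : 0 ≤ ∫ x in (0:ℝ)..δ, r x := intervalIntegral.integral_nonneg hδ0.le fun x _ => r0 x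
    have e3 : 0 ≤ ∫ x in (1-δ)..1, r x := intervalIntegral.integral_nonneg (by linarith) fun x _ => r0 x
    have e4 : ∫ x in δ..(1-δ), (1:ℝ) ≤ ∫ x in δ..(1-δ), r x := by
      apply intervalIntegral.integral_mono_on hd (by simp) (ii _ _)
      intro x hx
      refine le_max_of_le_right (le_min le_rfl (le_min ?_ ?_))
      · rw [le_div_iff₀ hδ0]; linarith [hx.1]
      · rw [le_div_iff₀ hδ0]; linarith [hx.2]
    rw [intervalIntegral.integral_const] at e4
    simp only [smul_eq_mul, mul_one] at e4
    linarith
  have hIpos : 0 < I := by nlinarith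
  have hd : ∀ x, HasDerivAt (fun x => (∫ t in (0:ℝ)..x, r t) / I) (r x / I) x := fun x =>
    (intervalIntegral.integral_hasDerivAt_right (ii _ _) (rc.stronglyMeasurableAtFilter _ _) rc.continuousAt).div_const I
  have hl : ∀ x ≤ (0:ℝ), ∫ t in (0:ℝ)..x, r t = 0 := by
    intro x hx
    rw [intervalIntegral.integral_congr (g := fun _ => 0)]
    · simp
    · intro t ht
      rw [Set.uIcc_of_ge hx] at ht
      exact rl t ht.2
  have hr : ∀ x, 1 ≤ x → ∫ t in (0:ℝ)..x, r t = I := by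
    intro x hx
    rw [← intervalIntegral.integral_add_adjacent_intervals (ii 0 1) (ii 1 x), ← hI]
    rw [intervalIntegral.integral_congr (a := 1) (b := x) (g := fun _ => 0)]
    · simp
    · intro t ht
      rw [Set.uIcc_of_le hx] at ht
      exact rr t ht.1
  have hmono : Monotone (fun x => (∫ t in (0:ℝ)..x, r t) / I) :=
    monotone_of_hasDerivAt_nonneg hd fun x => div_nonneg (r0 x) hIpos.le
  refine ⟨fun x => (∫ t in (0:ℝ)..x, r t) / I, fun x => r x / I, ?_, hd, ?_, ?_, ?_, ?_, ?_, ?_, ?_, ?_⟩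
  · rw [contDiff_one_iff_deriv]
    refine ⟨fun x => (hd x).differentiableAt, ?_⟩
    have : deriv (fun x => (∫ t in (0:ℝ)..x, r t) / I) = fun x => r x / I := funext fun x => (hd x).deriv
    rw [this]; fun_prop
  · intro x hx; simp [hl x hx]
  · intro x hx; simp only [hr x hx]; field_simp
  · intro x
    rcases le_total x 0 with h | h
    · simp [hl x h]
    · have := hmono h; simpa [hl 0 le_rfl] using this
  · intro x
    rcases le_total 1 x with h | h
    · simp only [hr x h]; rw [div_self hIpos.ne']
    · have := hmono h; simp only [hr 1 le_rfl, div_self hIpos.ne'] at this; exact this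
  · intro x; exact div_nonneg (r0 x) hIpos.le
  · intro x
    rw [div_le_iff₀ hIpos]
    have := r1 x
    nlinarith
  · intro x hx; simp [rl x hx]
  · intro x hx; simp [rr x hx]

/-- open triangle of size R -/
def TR (R : ℝ) : Set (ℝ × ℝ) := {q | 0 < q.1 ∧ 0 < q.2 ∧ q.1 + q.2 < R}

def cell (p : ℕ × ℕ) : Set (ℝ × ℝ) :=
  Set.Ioc (p.1 : ℝ) (p.1 + 1) ×ˢ Set.Ioc (p.2 : ℝ) (p.2 + 1)

lemma TR_open (R : ℝ) : IsOpen (TR R) := by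
  unfold TR
  exact (isOpen_lt continuous_const continuous_fst).inter
    ((isOpen_lt continuous_const continuous_snd).inter
      (isOpen_lt (continuous_fst.add continuous_snd) continuous_const))

lemma TR_meas (R : ℝ) : MeasurableSet (TR R) := (TR_open R).measurableSet

lemma cell_meas (p : ℕ × ℕ) : MeasurableSet (cell p) := measurableSet_Ioc.prod measurableSet_Ioc

lemma TR_sub (R : ℝ) : TR R ⊆ Set.Icc 0 R ×ˢ Set.Icc 0 R := by
  rintro ⟨x, y⟩ ⟨h1, h2, h3⟩
  simp only at h1 h2 h3
  refine ⟨⟨h1.le, ?_⟩, ⟨h2.le, ?_⟩⟩ <;> simp only <;> linarith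

lemma intOn_TR {F : ℝ × ℝ → ℝ} (hF : Continuous F) (R : ℝ) : IntegrableOn F (TR R) :=
  (hF.continuousOn.integrableOn_compact (isCompact_Icc.prod isCompact_Icc)).mono_set (TR_sub R)

lemma intOn_cell {F : ℝ × ℝ → ℝ} (hF : Continuous F) (p : ℕ × ℕ) : IntegrableOn F (cell p) :=
  (hF.continuousOn.integrableOn_compact (isCompact_Icc.prod isCompact_Icc)).mono_set
    (Set.prod_mono Set.Ioc_subset_Icc_self Set.Ioc_subset_Icc_self)

lemma Ioc_nat_eq {x : ℝ} {a b : ℕ} (ha : x ∈ Set.Ioc (a:ℝ) (a+1)) (hb : x ∈ Set.Ioc (b:ℝ) (b+1)) :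
    a = b := by
  have h1 : (a:ℝ) < b + 1 := lt_of_lt_of_le ha.1 hb.2
  have h2 : (b:ℝ) < a + 1 := lt_of_lt_of_le hb.1 ha.2
  have h1' : a < b + 1 := by exact_mod_cast h1
  have h2' : b < a + 1 := by exact_mod_cast h2
  omega

lemma cell_disj : Pairwise (Function.onFun Disjoint cell) := by
  intro p q hpq
  rw [Function.onFun, Set.disjoint_left]
  rintro x hp hq
  exact hpq (Prod.ext (Ioc_nat_eq hp.1 hq.1) (Ioc_nat_eq hp.2 hq.2))

lemma int_cells {F : ℝ × ℝ → ℝ} (hF : Continuous F) (s : Finset (ℕ × ℕ)) :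
    ∫ q in ⋃ p ∈ s, cell p, F q = ∑ p ∈ s, ∫ q in cell p, F q :=
  integral_biUnion_finset s (fun p _ => cell_meas p) (fun p _ q _ h => cell_disj h)
    (fun p _ => intOn_cell hF p)

lemma int_upper {F : ℝ × ℝ → ℝ} (hF : Continuous F) (h0 : ∀ q, 0 ≤ F q) (n : ℕ) :
    ∫ q in TR n, F q ≤ ∑ p ∈ SS n, ∫ q in cell p, F q := by
  rw [← int_cells hF]
  apply setIntegral_mono_set
  · exact integrableOn_finset_iUnion.2 fun p _ => intOn_cell hF p
  · exact Filter.Eventually.of_forall fun q => h0 q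
  · apply HasSubset.Subset.eventuallyLE
    rintro ⟨x, y⟩ ⟨h1, h2, h3⟩
    simp only at h1 h2 h3
    have hx : ∀ x : ℝ, 0 < x → x ∈ Set.Ioc (((⌈x⌉₊ - 1 : ℕ)):ℝ) (((⌈x⌉₊ - 1 : ℕ)):ℝ) ∪ Set.Ioc (((⌈x⌉₊ - 1 : ℕ)):ℝ) (((⌈x⌉₊ - 1 : ℕ):ℝ) + 1) := by
      intro x hx
      right
      have : 1 ≤ ⌈x⌉₊ := Nat.one_le_ceil_iff.2 hx
      rw [Nat.cast_sub this]
      refine ⟨?_, ?_⟩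
      · have := Nat.ceil_lt_add_one hx.le; push_cast; linarith
      · have := Nat.le_ceil x; push_cast; linarith
    have hx1 := hx x h1
    have hy1 := hx y h2
    simp only [Set.Ioc_self, Set.empty_union] at hx1 hy1
    simp only [Set.mem_iUnion]
    refine ⟨(⌈x⌉₊ - 1, ⌈y⌉₊ - 1), ?_, hx1, hy1⟩
    rw [mem_SS]
    have : (((⌈x⌉₊ - 1) + (⌈y⌉₊ - 1) : ℕ) : ℝ) < n := by
      rw [Nat.cast_add]; linarith [hx1.1, hy1.1]
    exact_mod_cast this

lemma int_lower {F : ℝ × ℝ → ℝ} (hF : Continuous F) (h0 : ∀ q, 0 ≤ F q) (m : ℕ) :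
    ∑ p ∈ SS m, ∫ q in cell p, F q ≤ ∫ q in TR (m + 2 : ℕ), F q := by
  rw [← int_cells hF]
  apply setIntegral_mono_set
  · exact intOn_TR hF _
  · exact Filter.Eventually.of_forall fun q => h0 q
  · apply HasSubset.Subset.eventuallyLE
    rintro ⟨x, y⟩ h
    simp only [Set.mem_iUnion] at h
    obtain ⟨p, hp, h1, h2⟩ := h
    rw [mem_SS] at hp
    have hp' : (p.1 : ℝ) + p.2 + 1 ≤ m := by exact_mod_cast hp
    simp only [Set.mem_Ioc] at h1 h2
    have i1 : (0:ℝ) ≤ p.1 := Nat.cast_nonneg _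
    have i2 : (0:ℝ) ≤ p.2 := Nat.cast_nonneg _
    refine ⟨?_, ?_, ?_⟩ <;> simp only <;> push_cast <;> linarith

lemma cell_const (p : ℕ × ℕ) (c : ℝ) : ∫ _ in cell p, c = c := by
  have h : (volume (cell p)) = 1 := by
    unfold cell
    rw [Measure.volume_eq_prod, Measure.prod_prod]; simp
  rw [setIntegral_const, Measure.real, h]; simp

lemma int_sig (σ : ℝ → ℝ) (hσ : Continuous σ) (k : ℕ) (a b : ℝ) :
    ∫ x in Set.Ioc (k:ℝ) (k+1), ((1 - σ (x - k)) * a + σ (x - k) * b) =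
      (1 - ∫ x in (0:ℝ)..1, σ x) * a + (∫ x in (0:ℝ)..1, σ x) * b := by
  rw [← intervalIntegral.integral_of_le (by linarith)]
  rw [intervalIntegral.integral_comp_sub_right (fun x => (1 - σ x) * a + σ x * b)]
  rw [intervalIntegral.integral_add, intervalIntegral.integral_mul_const,
    intervalIntegral.integral_mul_const, intervalIntegral.integral_sub]
  · simp
  all_goals apply Continuous.intervalIntegrable; fun_prop

lemma cell_sig_y (σ : ℝ → ℝ) (hσ : Continuous σ) (p : ℕ × ℕ) (a b : ℝ) :
    ∫ q in cell p, ((1 - σ (q.2 - p.2)) * a + σ (q.2 - p.2) * b) =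
      (1 - ∫ x in (0:ℝ)..1, σ x) * a + (∫ x in (0:ℝ)..1, σ x) * b := by
  have := setIntegral_prod_mul (μ := (volume : Measure ℝ)) (ν := (volume : Measure ℝ))
    (fun _ => (1:ℝ)) (fun y => (1 - σ (y - p.2)) * a + σ (y - p.2) * b)
    (Set.Ioc (p.1:ℝ) (p.1+1)) (Set.Ioc (p.2:ℝ) (p.2+1))
  rw [int_sig σ hσ] at this
  simp only [one_mul, setIntegral_const] at this
  unfold cell
  rw [Measure.volume_eq_prod, this]; simp

lemma cell_sig_x (σ : ℝ → ℝ) (hσ : Continuous σ) (p : ℕ × ℕ) (a b : ℝ) :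
    ∫ q in cell p, ((1 - σ (q.1 - p.1)) * a + σ (q.1 - p.1) * b) =
      (1 - ∫ x in (0:ℝ)..1, σ x) * a + (∫ x in (0:ℝ)..1, σ x) * b := by
  have := setIntegral_prod_mul (μ := (volume : Measure ℝ)) (ν := (volume : Measure ℝ))
    (fun x => (1 - σ (x - p.1)) * a + σ (x - p.1) * b) (fun _ => (1:ℝ))
    (Set.Ioc (p.1:ℝ) (p.1+1)) (Set.Ioc (p.2:ℝ) (p.2+1))
  rw [int_sig σ hσ] at this
  simp only [mul_one, setIntegral_const] at this
  unfold cell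
  rw [Measure.volume_eq_prod, this]; simp

lemma sum_two {φ : ℝ → ℝ} (h1 : ∀ x ≤ -1, φ x = 0) (h2 : ∀ x, 1 ≤ x → φ x = 0) (c : ℕ → ℝ) {L k : ℕ}
    (hk : k + 1 < L) {x : ℝ} (hx : x ∈ Set.Icc (k:ℝ) (k+1)) :
    ∑ m ∈ Finset.range L, c m * φ (x - m) = c k * φ (x - k) + c (k+1) * φ (x - k - 1) := by
  have hs : ({k, k+1} : Finset ℕ) ⊆ Finset.range L := by
    intro m hm; simp at hm ⊢; omega
  rw [← Finset.sum_subset hs, Finset.sum_pair (by omega)]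
  · push_cast; rw [sub_sub]
  · intro m _ hm
    simp only [Finset.mem_insert, Finset.mem_singleton, not_or] at hm
    rcases Nat.lt_or_ge m k with h | h
    · have : (m:ℝ) + 1 ≤ k := by exact_mod_cast h
      rw [h2 _ (by linarith [hx.1])]; ring
    · have : (k:ℝ) + 2 ≤ m := by
        have : k + 2 ≤ m := by omega
        exact_mod_cast this
      rw [h1 _ (by linarith [hx.2])]; ring

lemma SS_mono {a b : ℕ} (h : a ≤ b) : SS a ⊆ SS b := by
  intro p hp; rw [mem_SS] at *; omega

lemma sum_SS_mono {F : ℕ → ℕ → ℝ} (h0 : ∀ i j, 0 ≤ F i j) {a b : ℕ} (h : a ≤ b) :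
    ∑ p ∈ SS a, F p.1 p.2 ≤ ∑ p ∈ SS b, F p.1 p.2 :=
  Finset.sum_le_sum_of_subset_of_nonneg (SS_mono h) fun _ _ _ => h0 _ _

lemma sum_shift {F : ℕ → ℕ → ℝ} (h0 : ∀ i j, 0 ≤ F i j) {a b : ℕ} (s t : ℕ) (h : a + s + t ≤ b) :
    ∑ p ∈ SS a, F (p.1 + s) (p.2 + t) ≤ ∑ p ∈ SS b, F p.1 p.2 := by
  classical
  have : ∑ p ∈ SS a, F (p.1 + s) (p.2 + t) =
      ∑ p ∈ (SS a).image (fun p => (p.1 + s, p.2 + t)), F p.1 p.2 := by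
    rw [Finset.sum_image]
    rintro ⟨x, y⟩ _ ⟨x', y'⟩ _ hh
    simp only [Prod.mk.injEq] at hh
    ext <;> simp <;> omega
  rw [this]
  refine Finset.sum_le_sum_of_subset_of_nonneg ?_ fun _ _ _ => h0 _ _
  intro p hp
  rw [Finset.mem_image] at hp
  obtain ⟨q, hq, rfl⟩ := hp
  rw [mem_SS] at *
  simp only; omega

lemma fderiv_x {W : ℝ × ℝ → ℝ} {q : ℝ × ℝ} (hW : DifferentiableAt ℝ W q) {d : ℝ}
    (hd : HasDerivAt (fun x => W (x, q.2)) d q.1) : fderiv ℝ W q (1, 0) = d := by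
  have h1 : HasDerivAt (fun x : ℝ => (x, q.2)) (1, 0) q.1 :=
    (hasDerivAt_id q.1).prodMk (hasDerivAt_const q.1 q.2)
  have h2 : HasFDerivAt W (fderiv ℝ W q) ((fun x : ℝ => (x, q.2)) q.1) := hW.hasFDerivAt
  exact (h2.comp_hasDerivAt q.1 h1).unique hd

lemma fderiv_y {W : ℝ × ℝ → ℝ} {q : ℝ × ℝ} (hW : DifferentiableAt ℝ W q) {d : ℝ}
    (hd : HasDerivAt (fun y => W (q.1, y)) d q.2) : fderiv ℝ W q (0, 1) = d := by
  have h1 : HasDerivAt (fun y : ℝ => (q.1, y)) (0, 1) q.2 :=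
    (hasDerivAt_const q.2 q.1).prodMk (hasDerivAt_id q.2)
  have h2 : HasFDerivAt W (fderiv ℝ W q) ((fun y : ℝ => (q.1, y)) q.2) := hW.hasFDerivAt
  exact (h2.comp_hasDerivAt q.2 h1).unique hd

lemma conv_sq {r s a b C : ℝ} (hr0 : 0 ≤ r) (hr : r ≤ C) (hs0 : 0 ≤ s) (hs1 : s ≤ 1) :
    (r * ((1 - s) * a + s * b))^2 ≤ (1 - s) * (C^2 * a^2) + s * (C^2 * b^2) := by
  have h1 : ((1 - s) * a + s * b)^2 ≤ (1 - s) * a^2 + s * b^2 := by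
    have : (1 - s) * a^2 + s * b^2 - ((1 - s) * a + s * b)^2 = s * (1 - s) * (a - b)^2 := by ring
    have : 0 ≤ s * (1 - s) * (a - b)^2 := by
      have : 0 ≤ 1 - s := by linarith
      positivity
    linarith
  have h2 : r^2 ≤ C^2 := by gcongr
  calc (r * ((1 - s) * a + s * b))^2 = r^2 * ((1 - s) * a + s * b)^2 := by ring
    _ ≤ C^2 * ((1 - s) * a^2 + s * b^2) := by gcongr
    _ = _ := by ring

lemma mass_low {ε X Y a b c d : ℝ} (hε : 0 < ε) (hX0 : 0 ≤ X) (hX1 : X ≤ 1)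
    (hY0 : 0 ≤ Y) (hY1 : Y ≤ 1) :
    (1 - ε) * a^2 - 3 / ε * ((b - a)^2 + (c - a)^2 + (d - c)^2) ≤
      ((1 - X) * ((1 - Y) * a + Y * c) + X * ((1 - Y) * b + Y * d))^2 := by
  set e := X * (1 - Y) * (b - a) + Y * (c - a) + X * Y * (d - c) with he
  have e1 : (1 - X) * ((1 - Y) * a + Y * c) + X * ((1 - Y) * b + Y * d) = a + e := by rw [he]; ring
  rw [e1]
  have h3 : ∀ t z : ℝ, 0 ≤ t → t ≤ 1 → (t * z)^2 ≤ z^2 := by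
    intro t z h0 h1
    rw [mul_pow]
    have : t^2 ≤ 1 := by nlinarith
    nlinarith [sq_nonneg z]
  have k1 := h3 (X * (1 - Y)) (b - a) (mul_nonneg hX0 (by linarith)) (by nlinarith)
  have k2 := h3 Y (c - a) hY0 hY1
  have k3 := h3 (X * Y) (d - c) (by positivity) (by nlinarith)
  have h2 : e^2 ≤ 3 * ((b - a)^2 + (c - a)^2 + (d - c)^2) := by
    have : ∀ p q r : ℝ, (p + q + r)^2 ≤ 3 * (p^2 + q^2 + r^2) := by
      intro p q r; nlinarith [sq_nonneg (p - q), sq_nonneg (q - r), sq_nonneg (p - r)]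
    have := this (X * (1 - Y) * (b - a)) (Y * (c - a)) (X * Y * (d - c))
    rw [← he] at this
    linarith
  have h4 : (1 - ε) * a^2 - e^2 / ε ≤ (a + e)^2 := by
    have : (a + e)^2 - ((1 - ε) * a^2 - e^2 / ε) = (ε * a + e)^2 / ε + e^2 := by field_simp; ring
    have : 0 ≤ (ε * a + e)^2 / ε + e^2 := by positivity
    linarith
  have h5 : e^2 / ε ≤ 3 * ((b - a)^2 + (c - a)^2 + (d - c)^2) / ε := by gcongr
  have h6 : 3 * ((b - a)^2 + (c - a)^2 + (d - c)^2) / ε = 3 / ε * ((b - a)^2 + (c - a)^2 + (d - c)^2) := by ring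
  linarith

lemma interp {K ε α β : ℝ} (hK : 0 ≤ K) (hε : 0 < ε) (hε1 : ε ≤ 1) (hα : 0 < α) (hβ : 0 < β) (m : ℕ)
    (H : ∀ W : ℝ × ℝ → ℝ, ContDiff ℝ 1 W → (∀ y, W (0, y) = 0) →
      K * ∫ q in TR (m + 2 : ℕ), W q ^ 2 ≤ ((m + 2 : ℕ) : ℝ)^2 *
        ∫ q in TR (m + 2 : ℕ), (α * (fderiv ℝ W q (1, 0))^2 + β * (fderiv ℝ W q (0, 1))^2))
    (v : ℕ → ℕ → ℝ) (h0 : ∀ j, v 0 j = 0) :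
    K * ((1 - 9 * ε) * MM (m + 4) v v - 8 / ε * BB (m + 3) 1 1 v v) ≤
      ((m + 2 : ℕ) : ℝ)^2 * ((1 + ε)^2 * BB (m + 3) α β v v) := by
  obtain ⟨σ, ρ, hσ, hd, hσ0, hσ1, hσn, hσl, hρn, hρl, hρ0, hρ1⟩ := exists_sigma ε hε
  have hσc : Continuous σ := hσ.continuous
  let η : ℝ → ℝ := fun x => σ (x + 1) - σ x
  let η' : ℝ → ℝ := fun x => ρ (x + 1) - ρ x
  have hηd : ∀ x, HasDerivAt η (η' x) x := fun x => ((hd (x+1)).comp_add_const x 1).sub (hd x)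
  have hηC : ContDiff ℝ 1 η := by simp only [η]; fun_prop
  have e1 : ∀ x ≤ -1, η x = 0 := fun x hx => by
    simp only [η]; rw [hσ0 _ (by linarith), hσ0 _ (by linarith)]; ring
  have e2 : ∀ x, 1 ≤ x → η x = 0 := fun x hx => by
    simp only [η]; rw [hσ1 _ (by linarith), hσ1 _ (by linarith)]; ring
  have e1' : ∀ x ≤ -1, η' x = 0 := fun x hx => by
    simp only [η']; rw [hρ0 _ (by linarith), hρ0 _ (by linarith)]; ring
  have e2' : ∀ x, 1 ≤ x → η' x = 0 := fun x hx => by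
    simp only [η']; rw [hρ1 _ (by linarith), hρ1 _ (by linarith)]; ring
  let L := m + 4
  have s1 : ∀ (c : ℕ → ℝ) (k : ℕ) (x : ℝ), k + 1 < L → x ∈ Set.Icc (k:ℝ) (k+1) →
      ∑ i ∈ Finset.range L, c i * η (x - i) = (1 - σ (x - k)) * c k + σ (x - k) * c (k+1) := by
    intro c k x hk hx
    rw [sum_two e1 e2 c hk hx]
    simp only [η]
    rw [hσ1 (x - k + 1) (by linarith [hx.1]), hσ0 (x - k - 1) (by linarith [hx.2]),
      show x - k - 1 + 1 = x - k by ring]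
    ring
  have s2 : ∀ (c : ℕ → ℝ) (k : ℕ) (x : ℝ), k + 1 < L → x ∈ Set.Icc (k:ℝ) (k+1) →
      ∑ i ∈ Finset.range L, c i * η' (x - i) = ρ (x - k) * (c (k+1) - c k) := by
    intro c k x hk hx
    rw [sum_two e1' e2' c hk hx]
    simp only [η']
    rw [hρ1 (x - k + 1) (by linarith [hx.1]), hρ0 (x - k - 1) (by linarith [hx.2]),
      show x - k - 1 + 1 = x - k by ring]
    ring
  let W : ℝ × ℝ → ℝ := fun q =>
    ∑ i ∈ Finset.range L, (∑ j ∈ Finset.range L, v i j * η (q.2 - j)) * η (q.1 - i)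
  have hWC : ContDiff ℝ 1 W := by simp only [W]; fun_prop
  have hWc : Continuous W := hWC.continuous
  have hW0 : ∀ y, W (0, y) = 0 := by
    intro y
    simp only [W]
    rw [s1 _ 0 0 (by simp only [L]; omega) (by simp)]
    simp [h0, hσ0 0 le_rfl]
  have hWd : Differentiable ℝ W := hWC.differentiable (by norm_num)
  have hWx : ∀ q : ℝ × ℝ, fderiv ℝ W q (1, 0) =
      ∑ i ∈ Finset.range L, (∑ j ∈ Finset.range L, v i j * η (q.2 - j)) * η' (q.1 - i) := by
    intro q
    apply fderiv_x (hWd q)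
    apply HasDerivAt.fun_sum
    intro i _
    dsimp only
    exact ((hηd (q.1 - i)).comp_sub_const q.1 i).const_mul _
  have hWy : ∀ q : ℝ × ℝ, fderiv ℝ W q (0, 1) =
      ∑ i ∈ Finset.range L, (∑ j ∈ Finset.range L, v i j * η' (q.2 - j)) * η (q.1 - i) := by
    intro q
    apply fderiv_y (hWd q)
    apply HasDerivAt.fun_sum
    intro i _
    dsimp only
    apply HasDerivAt.mul_const
    apply HasDerivAt.fun_sum
    intro j _
    exact ((hηd (q.2 - j)).comp_sub_const q.2 j).const_mul _
  have hcx : Continuous fun q => fderiv ℝ W q (1, 0) :=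
    (hWC.continuous_fderiv (by norm_num)).clm_apply continuous_const
  have hcy : Continuous fun q => fderiv ℝ W q (0, 1) :=
    (hWC.continuous_fderiv (by norm_num)).clm_apply continuous_const
  have mI : ∀ {p : ℕ × ℕ} {q : ℝ × ℝ}, q ∈ cell p → q.1 ∈ Set.Icc (p.1:ℝ) (p.1+1) ∧ q.2 ∈ Set.Icc (p.2:ℝ) (p.2+1) :=
    fun h => ⟨Set.Ioc_subset_Icc_self h.1, Set.Ioc_subset_Icc_self h.2⟩
  set μ := ∫ x in (0:ℝ)..1, σ x with hμ
  have hμ0 : 0 ≤ μ := intervalIntegral.integral_nonneg zero_le_one fun x _ => hσn x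
  have hμ1 : μ ≤ 1 := by
    have : μ ≤ ∫ x in (0:ℝ)..1, (1:ℝ) :=
      intervalIntegral.integral_mono_on zero_le_one (hσc.intervalIntegrable _ _) (by simp) fun x _ => hσl x
    simpa using this
  -- energy
  have Ex : ∫ q in TR (m + 2 : ℕ), (fderiv ℝ W q (1, 0))^2 ≤
      (1 + ε)^2 * ∑ p ∈ SS (m+3), (v (p.1+1) p.2 - v p.1 p.2)^2 := by
    refine (int_upper (hcx.pow 2) (fun q => sq_nonneg _) (m+2)).trans ?_
    have hcell : ∀ p ∈ SS (m+2), ∫ q in cell p, (fderiv ℝ W q (1, 0))^2 ≤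
        (1 - μ) * ((1+ε)^2 * (v (p.1+1) p.2 - v p.1 p.2)^2) +
          μ * ((1+ε)^2 * (v (p.1+1) (p.2+1) - v p.1 (p.2+1))^2) := by
      intro p hp
      rw [mem_SS] at hp
      rw [hμ, ← cell_sig_y σ hσc p]
      apply setIntegral_mono_on (intOn_cell (hcx.pow 2) p) (intOn_cell (by fun_prop) p) (cell_meas p)
      intro q hq
      simp only [Pi.pow_apply]
      rw [hWx, s2 _ p.1 _ (by simp only [L]; omega) (mI hq).1,
        s1 _ p.2 _ (by simp only [L]; omega) (mI hq).2, s1 _ p.2 _ (by simp only [L]; omega) (mI hq).2]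
      have := conv_sq (a := v (p.1+1) p.2 - v p.1 p.2) (b := v (p.1+1) (p.2+1) - v p.1 (p.2+1))
        (hρn (q.1 - p.1)) (hρl (q.1 - p.1)) (hσn (q.2 - p.2)) (hσl (q.2 - p.2))
      refine le_of_eq_of_le ?_ this
      ring
    refine (Finset.sum_le_sum hcell).trans ?_
    rw [Finset.sum_add_distrib, ← Finset.mul_sum, ← Finset.mul_sum, ← Finset.mul_sum, ← Finset.mul_sum]
    have t1 := sum_SS_mono (F := fun i j => (v (i+1) j - v i j)^2) (fun _ _ => sq_nonneg _) (show m + 2 ≤ m + 3 by omega)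
    have t2 := sum_shift (F := fun i j => (v (i+1) j - v i j)^2) (fun _ _ => sq_nonneg _) (a := m+2) (b := m+3) 0 1 (by omega)
    simp only [add_zero] at t2
    have t3 := mul_le_mul_of_nonneg_left t1 (show 0 ≤ (1+ε)^2 * (1 - μ) by
      have : 0 ≤ 1 - μ := by linarith
      positivity)
    have t4 := mul_le_mul_of_nonneg_left t2 (show 0 ≤ (1+ε)^2 * μ by positivity)
    linarith
  have Ey : ∫ q in TR (m + 2 : ℕ), (fderiv ℝ W q (0, 1))^2 ≤
      (1 + ε)^2 * ∑ p ∈ SS (m+3), (v p.1 (p.2+1) - v p.1 p.2)^2 := by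
    refine (int_upper (hcy.pow 2) (fun q => sq_nonneg _) (m+2)).trans ?_
    have hcell : ∀ p ∈ SS (m+2), ∫ q in cell p, (fderiv ℝ W q (0, 1))^2 ≤
        (1 - μ) * ((1+ε)^2 * (v p.1 (p.2+1) - v p.1 p.2)^2) +
          μ * ((1+ε)^2 * (v (p.1+1) (p.2+1) - v (p.1+1) p.2)^2) := by
      intro p hp
      rw [mem_SS] at hp
      rw [hμ, ← cell_sig_x σ hσc p]
      apply setIntegral_mono_on (intOn_cell (hcy.pow 2) p) (intOn_cell (by fun_prop) p) (cell_meas p)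
      intro q hq
      simp only [Pi.pow_apply]
      rw [hWy, s1 _ p.1 _ (by simp only [L]; omega) (mI hq).1,
        s2 _ p.2 _ (by simp only [L]; omega) (mI hq).2, s2 _ p.2 _ (by simp only [L]; omega) (mI hq).2]
      have := conv_sq (a := v p.1 (p.2+1) - v p.1 p.2) (b := v (p.1+1) (p.2+1) - v (p.1+1) p.2)
        (hρn (q.2 - p.2)) (hρl (q.2 - p.2)) (hσn (q.1 - p.1)) (hσl (q.1 - p.1))
      refine le_of_eq_of_le ?_ this
      ring
    refine (Finset.sum_le_sum hcell).trans ?_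
    rw [Finset.sum_add_distrib, ← Finset.mul_sum, ← Finset.mul_sum, ← Finset.mul_sum, ← Finset.mul_sum]
    have t1 := sum_SS_mono (F := fun i j => (v i (j+1) - v i j)^2) (fun _ _ => sq_nonneg _) (show m + 2 ≤ m + 3 by omega)
    have t2 := sum_shift (F := fun i j => (v i (j+1) - v i j)^2) (fun _ _ => sq_nonneg _) (a := m+2) (b := m+3) 1 0 (by omega)
    simp only [add_zero] at t2
    have t3 := mul_le_mul_of_nonneg_left t1 (show 0 ≤ (1+ε)^2 * (1 - μ) by
      have : 0 ≤ 1 - μ := by linarith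
      positivity)
    have t4 := mul_le_mul_of_nonneg_left t2 (show 0 ≤ (1+ε)^2 * μ by positivity)
    linarith
  have hBB : ∀ a b : ℝ, BB (m+3) a b v v = a * ∑ p ∈ SS (m+3), (v (p.1+1) p.2 - v p.1 p.2)^2
      + b * ∑ p ∈ SS (m+3), (v p.1 (p.2+1) - v p.1 p.2)^2 := by
    intro a b
    unfold BB
    rw [Finset.mul_sum, Finset.mul_sum, ← Finset.sum_add_distrib]
    exact Finset.sum_congr rfl fun p _ => by ring
  have hE : ∫ q in TR (m + 2 : ℕ), (α * (fderiv ℝ W q (1, 0))^2 + β * (fderiv ℝ W q (0, 1))^2) ≤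
      (1 + ε)^2 * BB (m + 3) α β v v := by
    rw [integral_add (intOn_TR (by fun_prop) _) (intOn_TR (by fun_prop) _),
      integral_const_mul, integral_const_mul, hBB]
    have := mul_le_mul_of_nonneg_left Ex hα.le
    have := mul_le_mul_of_nonneg_left Ey hβ.le
    linarith
  -- mass
  have hMs : (1 - ε) * MM m v v - 6 / ε * BB (m+3) 1 1 v v ≤ ∫ q in TR (m + 2 : ℕ), W q ^ 2 := by
    refine le_trans ?_ (int_lower (hWc.pow 2) (fun q => sq_nonneg _) m)
    have hcell : ∀ p ∈ SS m, (1 - ε) * (v p.1 p.2)^2 - 3/ε * ((v (p.1+1) p.2 - v p.1 p.2)^2 +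
        (v p.1 (p.2+1) - v p.1 p.2)^2 + (v (p.1+1) (p.2+1) - v p.1 (p.2+1))^2) ≤ ∫ q in cell p, W q ^ 2 := by
      intro p hp
      rw [mem_SS] at hp
      rw [← cell_const p ((1 - ε) * (v p.1 p.2)^2 - _)]
      apply setIntegral_mono_on (intOn_cell continuous_const p) (intOn_cell (hWc.pow 2) p) (cell_meas p)
      intro q hq
      simp only [Pi.pow_apply]
      simp only [W]
      rw [s1 _ p.1 _ (by simp only [L]; omega) (mI hq).1,
        s1 _ p.2 _ (by simp only [L]; omega) (mI hq).2, s1 _ p.2 _ (by simp only [L]; omega) (mI hq).2]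
      exact mass_low hε (hσn _) (hσl _) (hσn _) (hσl _)
    refine le_trans ?_ (Finset.sum_le_sum hcell)
    rw [Finset.sum_sub_distrib, ← Finset.mul_sum, ← Finset.mul_sum, Finset.sum_add_distrib, Finset.sum_add_distrib, hBB]
    have t1 := sum_SS_mono (F := fun i j => (v (i+1) j - v i j)^2) (fun _ _ => sq_nonneg _) (show m ≤ m + 3 by omega)
    have t2 := sum_shift (F := fun i j => (v (i+1) j - v i j)^2) (fun _ _ => sq_nonneg _) (a := m) (b := m+3) 0 1 (by omega)
    have t3 := sum_SS_mono (F := fun i j => (v i (j+1) - v i j)^2) (fun _ _ => sq_nonneg _) (show m ≤ m + 3 by omega)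
    have t4 : 0 ≤ ∑ p ∈ SS (m+3), (v p.1 (p.2+1) - v p.1 p.2)^2 := Finset.sum_nonneg fun _ _ => sq_nonneg _
    simp only [add_zero] at t2
    have t5 : MM m v v = ∑ p ∈ SS m, v p.1 p.2 ^ 2 := Finset.sum_congr rfl fun p _ => by ring
    rw [t5]
    have t6 : ∀ x y : ℝ, x ≤ 2 * y → 3 / ε * x ≤ 6 / ε * y := by
      intro x y h
      have := mul_le_mul_of_nonneg_left h (show 0 ≤ 3 / ε by positivity)
      calc _ ≤ _ := this
        _ = _ := by ring
    have := t6 (∑ p ∈ SS m, (v (p.1+1) p.2 - v p.1 p.2)^2 + ∑ p ∈ SS m, (v p.1 (p.2+1) - v p.1 p.2)^2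
      + ∑ p ∈ SS m, (v (p.1+1) (p.2+1) - v p.1 (p.2+1))^2) (1 * ∑ p ∈ SS (m+3), (v (p.1+1) p.2 - v p.1 p.2)^2
      + 1 * ∑ p ∈ SS (m+3), (v p.1 (p.2+1) - v p.1 p.2)^2) (by linarith)
    linarith
  have l0 := layer v h0 ε hε (m+3) m (by omega)
  have l1 := layer v h0 ε hε (m+3) (m+1) (by omega)
  have l2 := layer v h0 ε hε (m+3) (m+2) (by omega)
  have l3 := layer v h0 ε hε (m+3) (m+3) (by omega)
  have hBn : 0 ≤ BB (m+3) 1 1 v v := by rw [hBB]; positivity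
  have hMn : 0 ≤ MM (m+4) v v := Finset.sum_nonneg fun _ _ => mul_self_nonneg _
  have hmass : (1 - 9 * ε) * MM (m + 4) v v - 8 / ε * BB (m + 3) 1 1 v v ≤ ∫ q in TR (m + 2 : ℕ), W q ^ 2 := by
    refine le_trans ?_ hMs
    have e : BB (m+3) 1 1 v v / (2 * ε) = (1 / ε * BB (m+3) 1 1 v v) / 2 := by field_simp
    have e8 : 8 / ε * BB (m+3) 1 1 v v = 8 * (1 / ε * BB (m+3) 1 1 v v) := by ring
    have e6 : 6 / ε * BB (m+3) 1 1 v v = 6 * (1 / ε * BB (m+3) 1 1 v v) := by ring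
    rw [e8, e6]
    rw [e] at l0 l1 l2 l3
    have hb : 0 ≤ 1 / ε * BB (m+3) 1 1 v v := by positivity
    set b := 1 / ε * BB (m+3) 1 1 v v
    have l : MM (m+4) v v - 2 * b - 8 * ε * MM (m+4) v v ≤ MM m v v := by
      simp only [show m + 3 + 1 = m + 4 by ring, show m + 2 + 1 = m + 3 by ring, show m + 1 + 1 = m + 2 by ring] at l0 l1 l2 l3
      linarith
    have := mul_le_mul_of_nonneg_left l (show 0 ≤ 1 - ε by linarith)
    nlinarith [mul_nonneg (mul_nonneg hε.le hε.le) hMn, mul_nonneg hε.le hb]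
  calc _ ≤ K * ∫ q in TR (m + 2 : ℕ), W q ^ 2 := mul_le_mul_of_nonneg_left hmass hK
    _ ≤ _ := H W hWC hW0
    _ ≤ _ := mul_le_mul_of_nonneg_left hE (by positivity)

def TC : Set (ℝ × ℝ) := {q | 0 ≤ q.1 ∧ 0 ≤ q.2 ∧ q.1 + q.2 ≤ 1}

lemma TC_convex : Convex ℝ TC := by
  rintro ⟨x, y⟩ ⟨h1, h2, h3⟩ ⟨x', y'⟩ ⟨h1', h2', h3'⟩ a b ha hb hab
  simp only at h1 h2 h3 h1' h2' h3'
  refine ⟨?_, ?_, ?_⟩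
  · simp; positivity
  · simp; positivity
  · simp; nlinarith

lemma TR_convex (R : ℝ) : Convex ℝ (TR R) := by
  have h1 : Convex ℝ {q : ℝ × ℝ | 0 < q.1} := convex_halfSpace_gt (f := Prod.fst) ⟨fun _ _ => rfl, fun _ _ => rfl⟩ 0
  have h2 : Convex ℝ {q : ℝ × ℝ | 0 < q.2} := convex_halfSpace_gt (f := Prod.snd) ⟨fun _ _ => rfl, fun _ _ => rfl⟩ 0
  have h3 : Convex ℝ {q : ℝ × ℝ | q.1 + q.2 < R} := convex_halfSpace_lt (f := fun q : ℝ × ℝ => q.1 + q.2)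
    ⟨fun x y => by simp; ring, fun c x => by simp; ring⟩ R
  exact h1.inter (h2.inter h3)

lemma TC_closed : IsClosed TC :=
  (isClosed_le continuous_const continuous_fst).inter
    ((isClosed_le continuous_const continuous_snd).inter
      (isClosed_le (continuous_fst.add continuous_snd) continuous_const))

lemma TC_compact : IsCompact TC := by
  refine IsCompact.of_isClosed_subset (isCompact_Icc.prod isCompact_Icc : IsCompact (Set.Icc (0:ℝ) 1 ×ˢ Set.Icc (0:ℝ) 1)) TC_closed ?_
  rintro ⟨x, y⟩ ⟨h1, h2, h3⟩
  simp only at h1 h2 h3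
  refine ⟨⟨h1, ?_⟩, ⟨h2, ?_⟩⟩ <;> simp only <;> linarith

lemma TR_sub_TC : TR 1 ⊆ TC := fun _ h => ⟨h.1.le, h.2.1.le, h.2.2.le⟩

lemma TC_sub : TC ⊆ closure (TR 1) := by
  rintro ⟨x, y⟩ ⟨h1, h2, h3⟩
  simp only at h1 h2 h3
  have ht : Filter.Tendsto (fun t : ℝ => (((1 - t) * x + t * (1/3), (1 - t) * y + t * (1/3)) : ℝ × ℝ))
      (nhdsWithin 0 (Set.Ioi 0)) (nhds (x, y)) := by
    have : Continuous (fun t : ℝ => (((1 - t) * x + t * (1/3), (1 - t) * y + t * (1/3)) : ℝ × ℝ)) := by fun_prop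
    have := this.tendsto 0
    simp only [sub_zero, one_mul, zero_mul, add_zero] at this
    exact this.mono_left nhdsWithin_le_nhds
  refine mem_closure_of_tendsto ht ?_
  have : Set.Ioo (0:ℝ) 1 ∈ nhdsWithin (0:ℝ) (Set.Ioi 0) := Ioo_mem_nhdsGT one_pos
  filter_upwards [this] with t ht
  obtain ⟨t0, t1⟩ := ht
  refine ⟨?_, ?_, ?_⟩ <;> simp only
  · have : 0 ≤ (1 - t) * x := mul_nonneg (by linarith) h1
    linarith
  · have : 0 ≤ (1 - t) * y := mul_nonneg (by linarith) h2
    linarith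
  · nlinarith

lemma TR_closure : closure (TR 1) = TC :=
  Set.Subset.antisymm (closure_minimal TR_sub_TC TC_closed) TC_sub

def cellN (N : ℕ) (p : ℕ × ℕ) : Set (ℝ × ℝ) :=
  Set.Ico ((p.1 : ℝ) / N) ((p.1 + 1) / N) ×ˢ Set.Ico ((p.2 : ℝ) / N) ((p.2 + 1) / N)

lemma mem_IcoN {N : ℕ} (hN : 0 < N) (k : ℕ) (x : ℝ) :
    x ∈ Set.Ico ((k : ℝ) / N) ((k + 1) / N) ↔ 0 ≤ x ∧ ⌊(N:ℝ) * x⌋₊ = k := by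
  have hN' : (0:ℝ) < N := by exact_mod_cast hN
  rw [Set.mem_Ico, div_le_iff₀ hN', lt_div_iff₀ hN', mul_comm x]
  constructor
  · rintro ⟨a, b⟩
    have h0 : 0 ≤ x := by
      have : 0 ≤ (N:ℝ) * x := le_trans (Nat.cast_nonneg k) a
      exact nonneg_of_mul_nonneg_right this hN'
    exact ⟨h0, (Nat.floor_eq_iff (by positivity)).2 ⟨a, b⟩⟩
  · rintro ⟨a, b⟩
    exact (Nat.floor_eq_iff (by positivity)).1 b

lemma riemann (c : ℕ → ℕ → ℕ → ℝ) (G : ℝ × ℝ → ℝ) (M : ℝ)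
    (hM : ∀ N i j, i + j < N → |c N i j| ≤ M)
    (hG : ∀ q ∈ TR 1, Filter.Tendsto (fun N : ℕ => c N ⌊(N:ℝ) * q.1⌋₊ ⌊(N:ℝ) * q.2⌋₊) Filter.atTop (nhds (G q))) :
    Filter.Tendsto (fun N : ℕ => (∑ p ∈ SS N, c N p.1 p.2) / (N:ℝ)^2) Filter.atTop
      (nhds (∫ q in TR 1, G q)) := by
  let F : ℕ → ℝ × ℝ → ℝ := fun N q => ∑ p ∈ SS N, (cellN N p).indicator (fun _ => c N p.1 p.2) q
  have cm : ∀ N p, MeasurableSet (cellN N p) := fun N p => measurableSet_Ico.prod measurableSet_Ico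
  have hF : ∀ N : ℕ, 0 < N → ∀ q : ℝ × ℝ, F N q =
      if 0 ≤ q.1 ∧ 0 ≤ q.2 ∧ ⌊(N:ℝ) * q.1⌋₊ + ⌊(N:ℝ) * q.2⌋₊ < N then c N ⌊(N:ℝ) * q.1⌋₊ ⌊(N:ℝ) * q.2⌋₊ else 0 := by
    intro N hN q
    have hmem : ∀ p, q ∈ cellN N p ↔ (0 ≤ q.1 ∧ ⌊(N:ℝ) * q.1⌋₊ = p.1) ∧ (0 ≤ q.2 ∧ ⌊(N:ℝ) * q.2⌋₊ = p.2) := by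
      intro p
      rw [← mem_IcoN hN, ← mem_IcoN hN]; rfl
    split_ifs with h
    · simp only [F]
      rw [Finset.sum_eq_single (⌊(N:ℝ) * q.1⌋₊, ⌊(N:ℝ) * q.2⌋₊)]
      · rw [Set.indicator_of_mem]
        rw [hmem]; exact ⟨⟨h.1, rfl⟩, ⟨h.2.1, rfl⟩⟩
      · intro p _ hp
        rw [Set.indicator_of_notMem]
        rw [hmem]
        rintro ⟨⟨_, a⟩, ⟨_, b⟩⟩
        exact hp (Prod.ext a.symm b.symm)
      · intro hh
        exact absurd (by rw [mem_SS]; exact h.2.2) hh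
    · apply Finset.sum_eq_zero
      intro p hp
      rw [Set.indicator_of_notMem]
      rw [hmem]
      rintro ⟨⟨a0, a⟩, ⟨b0, b⟩⟩
      rw [mem_SS] at hp
      exact h ⟨a0, b0, by rw [a, b]; exact hp⟩
  have hvol : ∀ N : ℕ, 0 < N → ∀ p, volume.real (cellN N p) = 1 / (N:ℝ)^2 := by
    intro N hN p
    have hN' : (0:ℝ) < N := by exact_mod_cast hN
    unfold cellN
    rw [Measure.volume_eq_prod, measureReal_prod_prod, Real.volume_real_Ico_of_le, Real.volume_real_Ico_of_le]
    · field_simp; ring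
    · gcongr; linarith
    · gcongr; linarith
  have hint : ∀ N : ℕ, 0 < N → ∫ q, F N q = (∑ p ∈ SS N, c N p.1 p.2) / (N:ℝ)^2 := by
    intro N hN
    simp only [F]
    rw [integral_finsetSum]
    · rw [Finset.sum_div]
      refine Finset.sum_congr rfl fun p _ => ?_
      rw [integral_indicator_const _ (cm N p), hvol N hN, smul_eq_mul]; ring
    · intro p _
      refine (integrable_indicator_iff (cm N p)).2 ?_
      refine integrableOn_const ?_
      have : volume.real (cellN N p) ≠ 0 := by
        rw [hvol N hN]
        have hN' : (0:ℝ) < N := by exact_mod_cast hN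
        positivity
      intro h
      exact this (by simp [Measure.real, h])
  rw [← integral_indicator (TR_meas 1)]
  have main : Filter.Tendsto (fun N : ℕ => ∫ q, F N q) Filter.atTop (nhds (∫ q, (TR 1).indicator G q)) := by
    have hM0 : 0 ≤ M := le_trans (abs_nonneg _) (hM 1 0 0 (by norm_num))
    refine tendsto_integral_filter_of_dominated_convergence
      ((Set.Icc (0:ℝ) 1 ×ˢ Set.Icc (0:ℝ) 1).indicator fun _ => M) ?_ ?_ ?_ ?_
    · refine Filter.Eventually.of_forall fun N => ?_
      refine (Finset.measurable_sum _ fun p _ => ?_).aestronglyMeasurable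
      exact measurable_const.indicator (cm N p)
    · filter_upwards [Filter.eventually_gt_atTop 0] with N hN
      refine Filter.Eventually.of_forall fun q => ?_
      have hN' : (0:ℝ) < N := by exact_mod_cast hN
      rw [hF N hN]
      split_ifs with h
      · rw [Set.indicator_of_mem]
        · exact hM _ _ _ h.2.2
        · have a1 : ∀ x : ℝ, ⌊(N:ℝ) * x⌋₊ < N → x ≤ 1 := by
            intro x hx
            have h1 := Nat.lt_floor_add_one ((N:ℝ) * x)
            have h2 : ((⌊(N:ℝ) * x⌋₊ : ℕ) : ℝ) + 1 ≤ N := by exact_mod_cast hx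
            by_contra hh
            push Not at hh
            nlinarith
          exact ⟨⟨h.1, a1 _ (by omega)⟩, ⟨h.2.1, a1 _ (by omega)⟩⟩
      · rw [norm_zero]
        exact Set.indicator_nonneg (fun _ _ => hM0) _
    · refine (integrable_indicator_iff (measurableSet_Icc.prod measurableSet_Icc)).2 ?_
      exact integrableOn_const (isCompact_Icc.prod isCompact_Icc).measure_lt_top.ne
    · have hnull : volume (frontier (TR 1)) = 0 := (TR_convex 1).addHaar_frontier volume
      have hae : ∀ᵐ q : ℝ × ℝ, q ∉ frontier (TR 1) := by
        rw [ae_iff]; simpa using hnull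
      filter_upwards [hae] with q hq
      by_cases hT : q ∈ TR 1
      · rw [Set.indicator_of_mem hT]
        refine (hG q hT).congr' ?_
        filter_upwards [Filter.eventually_gt_atTop 0] with N hN
        rw [hF N hN, if_pos]
        have hN' : (0:ℝ) < N := by exact_mod_cast hN
        refine ⟨hT.1.le, hT.2.1.le, ?_⟩
        have b1 := Nat.floor_le (show 0 ≤ (N:ℝ) * q.1 from mul_nonneg hN'.le hT.1.le)
        have b2 := Nat.floor_le (show 0 ≤ (N:ℝ) * q.2 from mul_nonneg hN'.le hT.2.1.le)
        have b3 := hT.2.2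
        have : ((⌊(N:ℝ) * q.1⌋₊ + ⌊(N:ℝ) * q.2⌋₊ : ℕ) : ℝ) < N := by
          push_cast; nlinarith
        exact_mod_cast this
      · rw [Set.indicator_of_notMem hT]
        have hc : q ∉ TC := by
          intro hc
          rw [← TR_closure] at hc
          apply hq
          rw [frontier, (TR_open 1).interior_eq]
          exact ⟨hc, hT⟩
        refine tendsto_const_nhds.congr' ?_
        obtain ⟨N0, hN0⟩ := exists_nat_gt (2 / (q.1 + q.2 - 1))
        filter_upwards [Filter.eventually_gt_atTop 0, Filter.eventually_ge_atTop N0] with N hN hNN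
        have hN' : (0:ℝ) < N := by exact_mod_cast hN
        rw [hF N hN, if_neg]
        rintro ⟨a, b, d⟩
        have h1 : 1 < q.1 + q.2 := by
          by_contra h; push Not at h
          exact hc ⟨a, b, h⟩
        have h2 : 0 < q.1 + q.2 - 1 := by linarith
        have h3 : (N0:ℝ) ≤ N := by exact_mod_cast hNN
        have h4 : 2 / (q.1 + q.2 - 1) < N := by linarith
        rw [div_lt_iff₀ h2] at h4
        have b1 := Nat.lt_floor_add_one ((N:ℝ) * q.1)
        have b2 := Nat.lt_floor_add_one ((N:ℝ) * q.2)
        have b3 : ((⌊(N:ℝ) * q.1⌋₊ : ℕ) : ℝ) + (⌊(N:ℝ) * q.2⌋₊ : ℕ) < N := by exact_mod_cast d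
        nlinarith
  refine main.congr' ?_
  filter_upwards [Filter.eventually_gt_atTop 0] with N hN
  exact hint N hN

lemma floor_tendsto {x : ℝ} (hx : 0 ≤ x) :
    Filter.Tendsto (fun N : ℕ => ((⌊(N:ℝ) * x⌋₊ : ℕ) : ℝ) / N) Filter.atTop (nhds x) := by
  have h := (tendsto_nat_floor_mul_div_atTop (R := ℝ) hx).comp tendsto_natCast_atTop_atTop
  refine h.congr fun N => ?_
  simp only [Function.comp, mul_comm]

lemma strict_lim {U : ℝ × ℝ → ℝ} {q : ℝ × ℝ} {L : ℝ × ℝ →L[ℝ] ℝ} (hs : HasStrictFDerivAt U L q)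
    (a : ℕ → ℝ × ℝ) (ha : Filter.Tendsto a Filter.atTop (nhds q)) (e : ℝ × ℝ) :
    Filter.Tendsto (fun N : ℕ => (N:ℝ) * (U (a N + (1 / (N:ℝ)) • e) - U (a N))) Filter.atTop (nhds (L e)) := by
  have h1 : Filter.Tendsto (fun N : ℕ => (1 / (N:ℝ)) • e) Filter.atTop (nhds 0) := by
    have := (tendsto_one_div_atTop_nhds_zero_nat (𝕜 := ℝ)).smul_const e
    simpa using this
  have h2 : Filter.Tendsto (fun N : ℕ => (a N + (1 / (N:ℝ)) • e, a N)) Filter.atTop (nhds (q, q)) := by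
    have := ha.add h1
    rw [add_zero] at this
    exact this.prodMk_nhds ha
  have h3 := hs.isLittleO.comp_tendsto h2
  have h4 : (fun N : ℕ => U (a N + (1 / (N:ℝ)) • e) - U (a N) - L ((1 / (N:ℝ)) • e)) =o[Filter.atTop]
      (fun N : ℕ => 1 / (N:ℝ)) := by
    have h5 : (fun N : ℕ => (1 / (N:ℝ)) • e) =O[Filter.atTop] (fun N : ℕ => 1 / (N:ℝ)) := by
      refine Asymptotics.IsBigO.of_bound ‖e‖ (Filter.Eventually.of_forall fun N => ?_)
      rw [norm_smul, mul_comm]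
    refine Asymptotics.IsLittleO.trans_isBigO ?_ h5
    refine h3.congr (fun N => ?_) (fun N => ?_) <;> simp [Function.comp]
  have h6 := h4.tendsto_div_nhds_zero
  have h7 := h6.add_const (L e)
  rw [zero_add] at h7
  refine h7.congr' ?_
  filter_upwards [Filter.eventually_gt_atTop 0] with N hN
  have hN' : (N:ℝ) ≠ 0 := by positivity
  rw [map_smul, smul_eq_mul]
  field_simp
  ring

lemma TC_mem_nhds {q : ℝ × ℝ} (hq : q ∈ TR 1) : TC ∈ nhds q :=
  Filter.mem_of_superset ((TR_open 1).mem_nhds hq) TR_sub_TC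

lemma sampling {U : ℝ × ℝ → ℝ} (hU : ContDiffOn ℝ 1 U TC) (h0 : ∀ q ∈ TC, q.1 + q.2 = 1 → U q = 0) (α β : ℝ) :
    ∃ f : ℕ → ℕ → ℕ → ℝ, (∀ N i j, N ≤ i + j → f N i j = 0) ∧
      Filter.Tendsto (fun N : ℕ => MM N (f N) (f N) / (N:ℝ)^2) Filter.atTop (nhds (∫ q in TR 1, U q ^ 2)) ∧
      Filter.Tendsto (fun N : ℕ => BB N α β (f N) (f N)) Filter.atTop
        (nhds (∫ q in TR 1, (α * (fderiv ℝ U q (1, 0))^2 + β * (fderiv ℝ U q (0, 1))^2))) := by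
  let f : ℕ → ℕ → ℕ → ℝ := fun N i j => if i + j < N then U ((i:ℝ) / N, (j:ℝ) / N) else 0
  have hmem : ∀ {N i j : ℕ}, 0 < N → i + j ≤ N → (((i:ℝ) / N, (j:ℝ) / N) : ℝ × ℝ) ∈ TC := by
    intro N i j hN h
    have hN' : (0:ℝ) < N := by exact_mod_cast hN
    have h' : (i:ℝ) + j ≤ N := by exact_mod_cast h
    refine ⟨?_, ?_, ?_⟩ <;> simp only
    · positivity
    · positivity
    · rw [← add_div, div_le_one hN']; exact h'
  have hf : ∀ {N i j : ℕ}, 0 < N → i + j ≤ N → f N i j = U ((i:ℝ) / N, (j:ℝ) / N) := by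
    intro N i j hN h
    simp only [f]
    split_ifs with hh
    · rfl
    · have hN' : (0:ℝ) < N := by exact_mod_cast hN
      symm
      apply h0 _ (hmem hN h)
      simp only
      rw [← add_div, div_eq_one_iff_eq hN'.ne']
      have : i + j = N := by omega
      exact_mod_cast this
  obtain ⟨M, hM⟩ := TC_compact.exists_bound_of_continuousOn hU.continuousOn
  have huniq : UniqueDiffOn ℝ TC := by
    apply uniqueDiffOn_convex TC_convex
    refine ⟨(1/4, 1/4), ?_⟩
    rw [mem_interior_iff_mem_nhds]
    apply TC_mem_nhds
    refine ⟨?_, ?_, ?_⟩ <;> norm_num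
  obtain ⟨D, hD⟩ := TC_compact.exists_bound_of_continuousOn (hU.continuousOn_fderivWithin huniq le_rfl)
  have hlip : ∀ x ∈ TC, ∀ y ∈ TC, |U y - U x| ≤ D * ‖y - x‖ := fun x hx y hy =>
    TC_convex.norm_image_sub_le_of_norm_fderivWithin_le (hU.differentiableOn (by norm_num)) hD hx hy
  have hdx : ∀ {N i j : ℕ}, i + j < N → |(N:ℝ) * (f N (i+1) j - f N i j)| ≤ D := by
    intro N i j h
    have hN : 0 < N := by omega
    have hN' : (0:ℝ) < N := by exact_mod_cast hN
    rw [hf hN (by omega), hf hN (by omega), abs_mul, abs_of_pos hN']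
    have := hlip _ (hmem hN (show i + j ≤ N by omega)) _ (hmem hN (show (i+1) + j ≤ N by omega))
    have e : ‖((((i+1:ℕ):ℝ) / N, (j:ℝ) / N) : ℝ × ℝ) - ((i:ℝ) / N, (j:ℝ) / N)‖ = 1 / N := by
      rw [Prod.mk_sub_mk, sub_self, Prod.norm_mk, norm_zero, ← sub_div]
      push_cast
      rw [add_sub_cancel_left, max_eq_left (norm_nonneg _), Real.norm_of_nonneg (by positivity)]
    rw [e] at this
    calc _ ≤ (N:ℝ) * (D * (1 / N)) := mul_le_mul_of_nonneg_left this hN'.le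
      _ = D := by field_simp
  have hdy : ∀ {N i j : ℕ}, i + j < N → |(N:ℝ) * (f N i (j+1) - f N i j)| ≤ D := by
    intro N i j h
    have hN : 0 < N := by omega
    have hN' : (0:ℝ) < N := by exact_mod_cast hN
    rw [hf hN (by omega), hf hN (by omega), abs_mul, abs_of_pos hN']
    have := hlip _ (hmem hN (show i + j ≤ N by omega)) _ (hmem hN (show i + (j+1) ≤ N by omega))
    have e : ‖(((i:ℝ) / N, ((j+1:ℕ):ℝ) / N) : ℝ × ℝ) - ((i:ℝ) / N, (j:ℝ) / N)‖ = 1 / N := by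
      rw [Prod.mk_sub_mk, sub_self, Prod.norm_mk, norm_zero, ← sub_div]
      push_cast
      rw [add_sub_cancel_left, max_eq_right (norm_nonneg _), Real.norm_of_nonneg (by positivity)]
    rw [e] at this
    calc _ ≤ (N:ℝ) * (D * (1 / N)) := mul_le_mul_of_nonneg_left this hN'.le
      _ = D := by field_simp
  have hfl : ∀ q ∈ TR 1, ∀ N : ℕ, 0 < N → ⌊(N:ℝ) * q.1⌋₊ + ⌊(N:ℝ) * q.2⌋₊ < N := by
    intro q hT N hN
    have hN' : (0:ℝ) < N := by exact_mod_cast hN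
    have b1 := Nat.floor_le (show 0 ≤ (N:ℝ) * q.1 from mul_nonneg hN'.le hT.1.le)
    have b2 := Nat.floor_le (show 0 ≤ (N:ℝ) * q.2 from mul_nonneg hN'.le hT.2.1.le)
    have b3 := hT.2.2
    have : ((⌊(N:ℝ) * q.1⌋₊ + ⌊(N:ℝ) * q.2⌋₊ : ℕ) : ℝ) < N := by
      push_cast; nlinarith
    exact_mod_cast this
  have ha : ∀ q ∈ TR 1, Filter.Tendsto (fun N : ℕ => ((((⌊(N:ℝ) * q.1⌋₊ : ℕ) : ℝ) / N,
      ((⌊(N:ℝ) * q.2⌋₊ : ℕ) : ℝ) / N) : ℝ × ℝ)) Filter.atTop (nhds q) := fun q hq =>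
    (floor_tendsto hq.1.le).prodMk_nhds (floor_tendsto hq.2.1.le)
  refine ⟨f, ?_, ?_, ?_⟩
  · intro N i j h
    simp only [f]; rw [if_neg (by omega)]
  · refine riemann (fun N i j => f N i j * f N i j) (fun q => U q ^ 2) (M * M) ?_ ?_
    · intro N i j h
      rw [hf (by omega) h.le, abs_mul]
      have := hM _ (hmem (by omega : 0 < N) h.le)
      rw [Real.norm_eq_abs] at this
      have hM0 : 0 ≤ M := le_trans (abs_nonneg _) this
      gcongr
    · intro q hq
      have hc : ContinuousAt U q := hU.continuousOn.continuousAt (TC_mem_nhds hq)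
      have h1 := hc.tendsto.comp (ha q hq)
      have h2 := h1.mul h1
      rw [← pow_two] at h2
      refine h2.congr' ?_
      filter_upwards [Filter.eventually_gt_atTop 0] with N hN
      rw [hf hN (hfl q hq N hN).le]; rfl
  · have := riemann (fun N i j => α * ((N:ℝ) * (f N (i+1) j - f N i j))^2 + β * ((N:ℝ) * (f N i (j+1) - f N i j))^2)
      (fun q => α * (fderiv ℝ U q (1, 0))^2 + β * (fderiv ℝ U q (0, 1))^2) (|α| * D^2 + |β| * D^2) ?_ ?_
    · refine this.congr' ?_
      filter_upwards [Filter.eventually_gt_atTop 0] with N hN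
      have hN' : (0:ℝ) < N := by exact_mod_cast hN
      unfold BB
      rw [Finset.sum_div]
      refine Finset.sum_congr rfl fun p _ => ?_
      field_simp
    · intro N i j h
      refine (abs_add_le _ _).trans ?_
      rw [abs_mul, abs_mul, abs_pow, abs_pow]
      have h1 := hdx h
      have h2 := hdy h
      gcongr
    · intro q hq
      have hs : HasStrictFDerivAt U (fderiv ℝ U q) q :=
        (hU.contDiffAt (TC_mem_nhds hq)).hasStrictFDerivAt (by norm_num)
      have l1 := strict_lim hs _ (ha q hq) (1, 0)
      have l2 := strict_lim hs _ (ha q hq) (0, 1)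
      refine (((l1.pow 2).const_mul α).add ((l2.pow 2).const_mul β)).congr' ?_
      filter_upwards [Filter.eventually_gt_atTop 0] with N hN
      have hlt := hfl q hq N hN
      rw [hf hN hlt.le, hf hN (by omega), hf hN (by omega)]
      simp only [Prod.smul_mk, Prod.mk_add_mk, smul_eq_mul, mul_one, mul_zero, add_zero, ← add_div, Nat.cast_add, Nat.cast_one]

lemma core_s7 {K α β : ℝ} (hK : 0 ≤ K) (hα : 0 < α) (hβ : 0 < β)
    (H : ∀ (m : ℕ) (W : ℝ × ℝ → ℝ), ContDiff ℝ 1 W → (∀ y, W (0, y) = 0) →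
      K * ∫ q in TR (m + 2 : ℕ), W q ^ 2 ≤ ((m + 2 : ℕ) : ℝ)^2 *
        ∫ q in TR (m + 2 : ℕ), (α * (fderiv ℝ W q (1, 0))^2 + β * (fderiv ℝ W q (0, 1))^2))
    {U : ℝ × ℝ → ℝ} (hU : ContDiffOn ℝ 1 U TC) (h0 : ∀ q ∈ TC, q.1 + q.2 = 1 → U q = 0)
    (hI : 0 < ∫ q in TR 1, U q ^ 2) :
    K ≤ (∫ q in TR 1, (α * (fderiv ℝ U q (1, 0))^2 + β * (fderiv ℝ U q (0, 1))^2)) / ∫ q in TR 1, U q ^ 2 := by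
  obtain ⟨f, hf0, hfM, hfB⟩ := sampling hU h0 α β
  set I := ∫ q in TR 1, U q ^ 2
  set E := ∫ q in TR 1, (α * (fderiv ℝ U q (1, 0))^2 + β * (fderiv ℝ U q (0, 1))^2)
  let ρ : ℕ → ℝ := fun N => BB N α β (f N) (f N) / (MM N (f N) (f N) / (N:ℝ)^2)
  have hρ : Filter.Tendsto ρ Filter.atTop (nhds (E / I)) := hfB.div hfM hI.ne'
  set γ := min α β with hγ
  have hγ0 : 0 < γ := lt_min hα hβ
  have key : ∀ ε : ℝ, 0 < ε → ε ≤ 1 → K * (1 - 9 * ε) ≤ (1 + ε)^2 * (E / I) := by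
    intro ε hε hε1
    have hev : ∀ᶠ N : ℕ in Filter.atTop, K * ((1 - 9 * ε) - 8 / (ε * γ) * (ρ N * (1 / (N:ℝ))* (1 / (N:ℝ)))) ≤ (1 + ε)^2 * ρ N := by
      filter_upwards [hfM.eventually (lt_mem_nhds hI), Filter.eventually_ge_atTop 3] with N ha hN
      obtain ⟨m, rfl⟩ : ∃ m, N = m + 3 := ⟨N - 3, by omega⟩
      obtain ⟨v, lam, hv0, hvM, hvB, hlam⟩ := disc_main (m + 3) (by omega) α β hβ
      have h1 := hlam (f (m+3)) (hf0 (m+3))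
      have h2 := interp hK hε hε1 hα hβ m (H m) v hv0
      have hN' : (0:ℝ) < ((m + 3 : ℕ) : ℝ) := by positivity
      set n : ℝ := ((m + 3 : ℕ) : ℝ) with hn
      set Mv := MM (m + 3 + 1) v v with hMv
      set Bv := BB (m + 3) α β v v with hBv
      set B1 := BB (m + 3) 1 1 v v with hB1
      have hBB0 : 0 ≤ Bv := by
        rw [hBv]; unfold BB
        refine Finset.sum_nonneg fun p _ => ?_
        have e1 := mul_nonneg hα.le (sq_nonneg (v (p.1 + 1) p.2 - v p.1 p.2))
        have e2 := mul_nonneg hβ.le (sq_nonneg (v p.1 (p.2 + 1) - v p.1 p.2))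
        linarith
      have hB1B : γ * B1 ≤ Bv := by
        rw [hBv, hB1]; unfold BB
        rw [Finset.mul_sum]
        refine Finset.sum_le_sum fun p _ => ?_
        have e1 := mul_le_mul_of_nonneg_right (min_le_left α β) (sq_nonneg (v (p.1 + 1) p.2 - v p.1 p.2))
        have e2 := mul_le_mul_of_nonneg_right (min_le_right α β) (sq_nonneg (v p.1 (p.2 + 1) - v p.1 p.2))
        rw [← hγ] at e1 e2
        linarith
      have hlr : n^2 * lam ≤ ρ (m+3) := by
        simp only [ρ]
        rw [le_div_iff₀ ha]
        calc n^2 * lam * (MM (m+3) (f (m+3)) (f (m+3)) / n^2) = lam * MM (m+3) (f (m+3)) (f (m+3)) := by field_simp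
          _ ≤ _ := h1
      have h3 : n^2 * Bv ≤ ρ (m+3) * Mv := by
        have e1 := mul_le_mul_of_nonneg_left hvB (sq_nonneg n)
        have e2 := mul_le_mul_of_nonneg_right hlr hvM.le
        linarith
      have h4 : ((m + 2 : ℕ) : ℝ)^2 * ((1 + ε)^2 * Bv) ≤ (1 + ε)^2 * (ρ (m+3) * Mv) := by
        have e1 : ((m + 2 : ℕ) : ℝ)^2 ≤ n^2 := by
          rw [hn]; gcongr; omega
        have e2 := mul_le_mul_of_nonneg_right e1 hBB0
        have e3 := mul_le_mul_of_nonneg_left (e2.trans h3) (sq_nonneg (1 + ε))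
        linarith
      have h5 : 8 / ε * B1 ≤ 8 / (ε * γ) * (ρ (m+3) * (1 / n) * (1 / n)) * Mv := by
        have e1 : B1 ≤ ρ (m+3) * Mv / (n^2 * γ) := by
          rw [le_div_iff₀ (by positivity)]
          have := mul_le_mul_of_nonneg_left hB1B (sq_nonneg n)
          linarith
        have e2 := mul_le_mul_of_nonneg_left e1 (show 0 ≤ 8 / ε by positivity)
        refine e2.trans (le_of_eq ?_)
        field_simp
      have h6 : K * ((1 - 9 * ε) - 8 / (ε * γ) * (ρ (m+3) * (1 / n)* (1 / n))) * Mv ≤ (1 + ε)^2 * ρ (m+3) * Mv := by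
        have e1 := mul_le_mul_of_nonneg_left h5 hK
        linarith
      exact le_of_mul_le_mul_right h6 hvM
    have t0 := tendsto_one_div_atTop_nhds_zero_nat (𝕜 := ℝ)
    have lim1 : Filter.Tendsto (fun N : ℕ => K * ((1 - 9 * ε) - 8 / (ε * γ) * (ρ N * (1 / (N:ℝ))* (1 / (N:ℝ))))) Filter.atTop
        (nhds (K * ((1 - 9 * ε) - 8 / (ε * γ) * (E / I * 0 * 0)))) :=
      ((((hρ.mul t0).mul t0).const_mul _).const_sub _).const_mul _
    have := le_of_tendsto_of_tendsto lim1 (hρ.const_mul ((1 + ε)^2)) hev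
    simpa using this
  have c1 : Filter.Tendsto (fun ε : ℝ => K * (1 - 9 * ε)) (nhdsWithin 0 (Set.Ioi 0)) (nhds K) := by
    have : Continuous (fun ε : ℝ => K * (1 - 9 * ε)) := by fun_prop
    have := this.tendsto 0
    simp only [mul_zero, sub_zero, mul_one] at this
    exact this.mono_left nhdsWithin_le_nhds
  have c2 : Filter.Tendsto (fun ε : ℝ => (1 + ε)^2 * (E / I)) (nhdsWithin 0 (Set.Ioi 0)) (nhds (E / I)) := by
    have : Continuous (fun ε : ℝ => (1 + ε)^2 * (E / I)) := by fun_prop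
    have := this.tendsto 0
    simp only [add_zero, one_pow, one_mul] at this
    exact this.mono_left nhdsWithin_le_nhds
  refine le_of_tendsto_of_tendsto c1 c2 ?_
  have : Set.Ioo (0:ℝ) 1 ∈ nhdsWithin (0:ℝ) (Set.Ioi 0) := Ioo_mem_nhdsGT one_pos
  filter_upwards [this] with ε he
  exact key ε he.1 he.2.le

open scoped Pointwise in
lemma scaleH {K α β : ℝ} 
    (H : ∀ (W : ℝ × ℝ → ℝ), ContDiff ℝ 1 W → (∀ y, W (0, y) = 0) →
      K * ∫ q in TR 1, W q ^ 2 ≤ 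
        ∫ q in TR 1, (α * (fderiv ℝ W q (1, 0))^2 + β * (fderiv ℝ W q (0, 1))^2))
    (m : ℕ) (W : ℝ × ℝ → ℝ) (hW : ContDiff ℝ 1 W) (hW0 : ∀ y, W (0, y) = 0) :
      K * ∫ q in TR (m + 2 : ℕ), W q ^ 2 ≤ ((m + 2 : ℕ) : ℝ)^2 *
        ∫ q in TR (m + 2 : ℕ), (α * (fderiv ℝ W q (1, 0))^2 + β * (fderiv ℝ W q (0, 1))^2) := by
  have hR : (0:ℝ) < ((m + 2 : ℕ) : ℝ) := by positivity
  set R : ℝ := ((m + 2 : ℕ) : ℝ)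
  have hset : R • TR 1 = TR R := by
    ext q
    rw [Set.mem_smul_set_iff_inv_smul_mem₀ hR.ne']
    have e : R⁻¹ * q.1 + R⁻¹ * q.2 < 1 ↔ q.1 + q.2 < R := by
      rw [← mul_add, inv_mul_lt_iff₀ hR, mul_one]
    have e' : ∀ x : ℝ, 0 < R⁻¹ * x ↔ 0 < x := fun x => by
      rw [mul_pos_iff_of_pos_left (inv_pos.2 hR)]
    unfold TR
    simp only [Set.mem_ofPred_eq, Prod.smul_fst, Prod.smul_snd, smul_eq_mul, e, e']
  have hint : ∀ F : ℝ × ℝ → ℝ, ∫ q in TR 1, F (R • q) = (R^2)⁻¹ * ∫ q in TR R, F q := by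
    intro F
    rw [Measure.setIntegral_comp_smul_of_pos volume F (TR 1) hR, hset]
    simp
  have hd : ∀ q e, fderiv ℝ (fun q => W (R • q)) q e = R * fderiv ℝ W (R • q) e := by
    intro q e
    have h1 : HasFDerivAt (fun q : ℝ × ℝ => R • q) (R • ContinuousLinearMap.id ℝ (ℝ × ℝ)) q :=
      (hasFDerivAt_id q).const_smul R
    have h2 := ((hW.differentiable (by norm_num) (R • q)).hasFDerivAt).comp q h1
    have h3 := h2.fderiv
    have : fderiv ℝ (fun q => W (R • q)) q = _ := h3
    rw [this]
    simp
  have := H (fun q => W (R • q)) (hW.comp (contDiff_const_smul R)) (fun y => by simp [hW0])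
  simp only [hd] at this
  rw [hint (fun q => W q ^ 2)] at this
  have e : ∀ q, α * (R * fderiv ℝ W (R • q) (1, 0))^2 + β * (R * fderiv ℝ W (R • q) (0, 1))^2 =
      (fun q => R^2 * (α * (fderiv ℝ W q (1, 0))^2 + β * (fderiv ℝ W q (0, 1))^2)) (R • q) := by
    intro q; simp only; ring
  simp only [e] at this
  rw [hint (fun q => R^2 * (α * (fderiv ℝ W q (1, 0))^2 + β * (fderiv ℝ W q (0, 1))^2)), integral_const_mul] at this
  have h := mul_le_mul_of_nonneg_left this (sq_nonneg R)
  have hR2 : R^2 ≠ 0 := by positivity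
  calc _ = R^2 * (K * ((R^2)⁻¹ * ∫ q in TR R, W q ^ 2)) := by field_simp
    _ ≤ _ := h
    _ = _ := by field_simp

lemma grad_alg {p0 p1 q0 q1 g0 g1 : ℝ} (hp : p0^2 + p1^2 ≠ 0) (hq : q0^2 + q1^2 ≠ 0)
    (h : p0 * q0 + p1 * q1 = 0) :
    g0^2 + g1^2 = 1 / (p0^2 + p1^2) * (p0 * g0 + p1 * g1)^2 + 1 / (q0^2 + q1^2) * (q0 * g0 + q1 * g1)^2 := by
  obtain ⟨t, ht0, ht1⟩ : ∃ t, q0 = -t * p1 ∧ q1 = t * p0 := by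
    refine ⟨(p0 * q1 - p1 * q0) / (p0^2 + p1^2), ?_, ?_⟩
    · field_simp; linear_combination p0 * h
    · field_simp; linear_combination p1 * h
  subst ht0 ht1
  have ht : t ≠ 0 := by
    rintro rfl; apply hq; ring
  have e : (-t * p1)^2 + (t * p0)^2 = t^2 * (p0^2 + p1^2) := by ring
  rw [e]
  field_simp
  ring

lemma clm_coord (L : Pt →L[ℝ] ℝ) (p : Pt) :
    L p = p 0 * L (EuclideanSpace.single 0 1) + p 1 * L (EuclideanSpace.single 1 1) := by
  have : p = p 0 • EuclideanSpace.single 0 (1:ℝ) + p 1 • EuclideanSpace.single 1 (1:ℝ) := by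
    ext i; fin_cases i <;> simp
  conv_lhs => rw [this]
  simp

lemma grad_eq {p q : Pt} (hp : p ≠ 0) (hq : q ≠ 0) (h : inner ℝ p q = 0) (u : Pt → ℝ) (z : Pt) :
    (pd 0 u z)^2 + (pd 1 u z)^2 = 1 / ‖p‖^2 * (fderiv ℝ u z p)^2 + 1 / ‖q‖^2 * (fderiv ℝ u z q)^2 := by
  have hn : ∀ p : Pt, ‖p‖^2 = p 0^2 + p 1^2 := fun p => by
    rw [EuclideanSpace.norm_sq_eq]; simp
  rw [clm_coord _ p, clm_coord _ q, hn, hn]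
  unfold pd
  apply grad_alg
  · rw [← hn]; simpa using hp
  · rw [← hn]; simpa using hq
  · have : inner ℝ p q = p 0 * q 0 + p 1 * q 1 := by
      simp [PiLp.inner_apply, Fin.sum_univ_two]; ring
    rw [← this, h]

lemma exists_e {p q : Pt} (hp : p ≠ 0) (hq : q ≠ 0) (h : inner ℝ p q = 0) :
    ∃ e : (ℝ × ℝ) ≃L[ℝ] Pt, ∀ x y, e (x, y) = x • p + y • q := by
  let T : (ℝ × ℝ) →ₗ[ℝ] Pt := (LinearMap.toSpanSingleton ℝ Pt p).coprod (LinearMap.toSpanSingleton ℝ Pt q)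
  have hT : ∀ x y, T (x, y) = x • p + y • q := fun x y => by simp [T]
  have hinj : Function.Injective T := by
    rw [← LinearMap.ker_eq_bot, LinearMap.ker_eq_bot']
    rintro ⟨x, y⟩ hxy
    rw [hT] at hxy
    have h1 := congrArg (fun z => inner ℝ p z) hxy
    have h2 := congrArg (fun z => inner ℝ z q) hxy
    simp only [inner_add_right, inner_add_left, inner_smul_right, inner_smul_left, h, inner_zero_right, inner_zero_left,
      mul_zero, add_zero, zero_add, real_inner_self_eq_norm_sq] at h1 h2
    have hp' : ‖p‖^2 ≠ 0 := by simpa using hp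
    have hq' : ‖q‖^2 ≠ 0 := by simpa using hq
    simp at h1 h2
    ext
    · simpa [hp] using h1
    · simpa [hq] using h2
  let E := LinearMap.linearEquivOfInjective T hinj (by simp)
  exact ⟨E.toContinuousLinearEquiv, fun x y => by
    change E (x, y) = _
    rw [LinearMap.linearEquivOfInjective_apply, hT]⟩

lemma chg (e : (ℝ × ℝ) ≃L[ℝ] Pt) (C : Pt) : ∃ c : ℝ, 0 < c ∧ ∀ (s : Set (ℝ × ℝ)) (f : Pt → ℝ),
    ∫ z in (fun q => C + e q) '' s, f z = c * ∫ q in s, f (C + e q) := by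
  let h : ℝ × ℝ ≃ₜ Pt := e.toHomeomorph.trans (Homeomorph.addLeft C)
  have hh : ∀ q, h q = C + e q := fun q => rfl
  have : (Measure.map e (volume : Measure (ℝ × ℝ))).IsAddHaarMeasure := e.isAddHaarMeasure_map volume
  have hc := Measure.isAddLeftInvariant_eq_smul (volume : Measure Pt) (Measure.map e volume)
  have hc0 := Measure.addHaarScalarFactor_pos_of_isAddHaarMeasure (volume : Measure Pt) (Measure.map e volume)
  set c := Measure.addHaarScalarFactor (volume : Measure Pt) (Measure.map e volume)
  have hmap : (volume : Measure Pt) = c • Measure.map h volume := by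
    have : Measure.map h volume = Measure.map (fun z => C + z) (Measure.map e volume) := by
      rw [Measure.map_map (measurable_const_add C) e.continuous.measurable]; rfl
    rw [this, map_add_left_eq_self]
    exact hc
  refine ⟨c, by exact_mod_cast hc0, fun s f => ?_⟩
  have e1 : (fun q => C + e q) '' s = h '' s := rfl
  rw [e1, hmap, Measure.restrict_smul, integral_smul_nnreal_measure, h.measurableEmbedding.setIntegral_map,
    Set.preimage_image_eq _ h.injective]
  rfl

lemma interior_TC : interior TC = TR 1 := by
  rw [← TR_closure]
  rw [(TR_convex 1).interior_closure_eq_interior_of_nonempty_interior]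
  · exact (TR_open 1).interior_eq
  · rw [(TR_open 1).interior_eq]
    refine ⟨(1/4, 1/4), ?_, ?_, ?_⟩ <;> norm_num

lemma tri (A B C : Pt) (hA : A ≠ C) (hB : B ≠ C) (hin : inner ℝ (A - C) (B - C) = 0) :
    lambda1 (interior (convexHull ℝ {A, B, C})) (segment ℝ B C) ≤
      lambda1 (interior (convexHull ℝ {A, B, C})) (segment ℝ A B) := by
  have hp : A - C ≠ 0 := sub_ne_zero.2 hA
  have hq : B - C ≠ 0 := sub_ne_zero.2 hB
  obtain ⟨e, he⟩ := exists_e hp hq hin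
  obtain ⟨c, hc0, hc⟩ := chg e C
  let h : ℝ × ℝ ≃ₜ Pt := e.toHomeomorph.trans (Homeomorph.addLeft C)
  have hh : ∀ q, h q = C + e q := fun q => rfl
  have hs : ∀ z, h.symm z = e.symm (-C + z) := fun z => rfl
  have hhull : convexHull ℝ {A, B, C} = h '' TC := by
    apply Set.Subset.antisymm
    · apply convexHull_min
      · rintro z (rfl | rfl | rfl)
        · exact ⟨(1, 0), ⟨by norm_num, by norm_num, by norm_num⟩, by rw [hh, he]; simp⟩
        · exact ⟨(0, 1), ⟨by norm_num, by norm_num, by norm_num⟩, by rw [hh, he]; simp⟩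
        · exact ⟨(0, 0), ⟨by norm_num, by norm_num, by norm_num⟩, by rw [hh, he]; simp⟩
      · have : h '' TC = (fun z => C + z) '' (e '' TC) := by
          rw [Set.image_image]; rfl
        rw [this]
        exact (TC_convex.linear_image e.toLinearEquiv.toLinearMap).translate C
    · rintro _ ⟨⟨x, y⟩, ⟨h1, h2, h3⟩, rfl⟩
      simp only at h1 h2 h3
      have := (convex_convexHull ℝ ({A, B, C} : Set Pt)).sum_mem (t := Finset.univ) (w := ![x, y, 1 - x - y])
        (z := ![A, B, C]) (by intro i _; fin_cases i <;> simp <;> linarith) (by simp [Fin.sum_univ_three])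
        (by intro i _; apply subset_convexHull; fin_cases i <;> simp)
      simp only [Fin.sum_univ_three, Matrix.cons_val_zero, Matrix.cons_val_one, Matrix.cons_val] at this
      convert this using 1
      rw [hh, he]; module
  have hO : interior (convexHull ℝ {A, B, C}) = (fun q => C + e q) '' TR 1 := by
    rw [hhull, ← h.image_interior, interior_TC]; rfl
  have hOh : interior (convexHull ℝ {A, B, C}) = h '' TR 1 := hO
  have hcl : closure (interior (convexHull ℝ {A, B, C})) = h '' TC := by
    rw [hOh, ← h.image_closure, TR_closure]
  set Ω := interior (convexHull ℝ {A, B, C}) with hΩ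
  have hI : ∀ f : Pt → ℝ, ∫ z in Ω, f z = c * ∫ q in TR 1, f (h q) := by
    intro f
    rw [hO, hc]; rfl
  have hsC : ContDiff ℝ 1 h.symm := by
    have : (h.symm : Pt → ℝ × ℝ) = fun z => e.symm (-C + z) := rfl
    rw [this]
    exact e.symm.contDiff.comp (contDiff_const.add contDiff_id)
  have hhC : ContDiff ℝ 1 h := by
    have : (h : ℝ × ℝ → Pt) = fun z => C + e z := rfl
    rw [this]
    exact contDiff_const.add e.contDiff
  set α := 1 / ‖A - C‖^2 with hα
  set β := 1 / ‖B - C‖^2 with hβ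
  have hα0 : 0 < α := by have := norm_pos_iff.2 hp; positivity
  have hβ0 : 0 < β := by have := norm_pos_iff.2 hq; positivity
  have hgrad : ∀ (u : Pt → ℝ) (q : ℝ × ℝ), DifferentiableAt ℝ u (h q) →
      (pd 0 u (h q))^2 + (pd 1 u (h q))^2 =
        α * (fderiv ℝ (fun q => u (h q)) q (1, 0))^2 + β * (fderiv ℝ (fun q => u (h q)) q (0, 1))^2 := by
    intro u q hu
    have h1 : HasFDerivAt h (e : ℝ × ℝ →L[ℝ] Pt) q := (e.hasFDerivAt (x := q)).const_add C
    have h2 : fderiv ℝ (fun q => u (h q)) q = _ := (hu.hasFDerivAt.comp q h1).fderiv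
    rw [grad_eq hp hq hin, h2]
    simp only [ContinuousLinearMap.comp_apply, ContinuousLinearEquiv.coe_coe, he]
    simp [hα, hβ]
  have hE : ∀ u : Pt → ℝ, (∀ q ∈ TR 1, DifferentiableAt ℝ u (h q)) →
      ∫ z in Ω, ((pd 0 u z)^2 + (pd 1 u z)^2) = c * ∫ q in TR 1,
        (α * (fderiv ℝ (fun q => u (h q)) q (1, 0))^2 + β * (fderiv ℝ (fun q => u (h q)) q (0, 1))^2) := by
    intro u hu
    rw [hI]
    congr 1
    exact setIntegral_congr_fun (TR_meas 1) fun q hq => hgrad u q (hu q hq)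
  have hbdd : ∀ Sig, BddBelow (RayleighSet Ω Sig) := by
    intro Sig
    refine ⟨0, ?_⟩
    rintro r ⟨u, _, _, _, rfl⟩
    apply div_nonneg
    · exact integral_nonneg fun z => by positivity
    · exact integral_nonneg fun z => by positivity
  set K := lambda1 Ω (segment ℝ B C) with hK
  have hK0 : 0 ≤ K := by
    apply Real.sInf_nonneg
    rintro r ⟨u, _, _, _, rfl⟩
    apply div_nonneg
    · exact integral_nonneg fun z => by positivity
    · exact integral_nonneg fun z => by positivity
  have H1 : ∀ (W : ℝ × ℝ → ℝ), ContDiff ℝ 1 W → (∀ y, W (0, y) = 0) →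
      K * ∫ q in TR 1, W q ^ 2 ≤ 
        ∫ q in TR 1, (α * (fderiv ℝ W q (1, 0))^2 + β * (fderiv ℝ W q (0, 1))^2) := by
    intro W hW hW0
    have hn : 0 ≤ ∫ q in TR 1, W q ^ 2 := integral_nonneg fun q => sq_nonneg _
    rcases hn.eq_or_lt with h0 | h0
    · rw [← h0, mul_zero]
      exact integral_nonneg fun z => by positivity
    · rw [← le_div_iff₀ h0]
      have hu : ContDiff ℝ 1 (fun z => W (h.symm z)) := hW.comp hsC
      have i1 : ∫ z in Ω, (W (h.symm z))^2 = c * ∫ q in TR 1, W q ^ 2 := by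
        rw [hI]; simp
      have i2 := hE (fun z => W (h.symm z)) fun q _ => hu.differentiable (by norm_num) _
      simp only [Homeomorph.symm_apply_apply] at i2
      apply csInf_le (hbdd _)
      refine ⟨fun z => W (h.symm z), hu.contDiffOn, ?_, ?_, ?_⟩
      · rintro z ⟨a, b, ha, hb, hab, rfl⟩
        have : a • B + b • C = h (0, a) := by
          rw [hh, he]
          have : b = 1 - a := by linarith
          rw [this]; module
        simp only [this, Homeomorph.symm_apply_apply, hW0]
      · rw [i1]; positivity
      · rw [i1, i2, mul_div_mul_left _ _ hc0.ne']
  have hseg : ∀ z ∈ segment ℝ A B, ∃ a b : ℝ, 0 ≤ a ∧ 0 ≤ b ∧ a + b = 1 ∧ z = h (a, b) := by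
    rintro z ⟨a, b, ha, hb, hab, rfl⟩
    refine ⟨a, b, ha, hb, hab, ?_⟩
    rw [hh, he]
    have : b = 1 - a := by linarith
    rw [this]; module
  apply le_csInf
  · refine ⟨_, fun z => (h.symm z).1 + (h.symm z).2 - 1, ?_, ?_, ?_, rfl⟩
    · have : ContDiff ℝ 1 (fun z => (h.symm z).1 + (h.symm z).2 - 1) := by fun_prop
      exact this.contDiffOn
    · intro z hz
      obtain ⟨a, b, _, _, hab, rfl⟩ := hseg z hz
      simp [hab]
    · rw [hI]
      simp only [Homeomorph.symm_apply_apply]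
      apply mul_ne_zero hc0.ne'
      apply ne_of_gt
      rw [setIntegral_pos_iff_support_of_nonneg_ae]
      · have : TR 1 ⊆ (Function.support fun q : ℝ × ℝ => (q.1 + q.2 - 1)^2) ∩ TR 1 := by
          intro q hq
          refine ⟨?_, hq⟩
          have := hq.2.2
          have h1 : q.1 + q.2 - 1 ≠ 0 := by linarith
          exact pow_ne_zero 2 h1
        refine lt_of_lt_of_le ?_ (measure_mono this)
        exact (TR_open 1).measure_pos _ ⟨(1/4, 1/4), by norm_num, by norm_num, by norm_num⟩
      · exact Filter.Eventually.of_forall fun q => sq_nonneg _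
      · exact intOn_TR (by fun_prop) _
  · rintro r ⟨u, hu, hu0, hune, rfl⟩
    unfold MemH1 at hu
    rw [hcl] at hu
    have hU : ContDiffOn ℝ 1 (fun q => u (h q)) TC := hu.comp hhC.contDiffOn fun q hq => ⟨q, hq, rfl⟩
    have hd : ∀ q ∈ TR 1, DifferentiableAt ℝ u (h q) := by
      intro q hq
      refine (hu.differentiableOn (by norm_num)).differentiableAt ?_
      have : h '' TC ∈ nhds (h q) := h.isOpenMap.image_mem_nhds (TC_mem_nhds hq)
      exact this
    rw [hI] at hune
    have hn : 0 ≤ ∫ q in TR 1, u (h q) ^ 2 := integral_nonneg fun q => sq_nonneg _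
    have hpos := hn.lt_of_ne (Ne.symm (right_ne_zero_of_mul hune))
    rw [hE u hd, hI, mul_div_mul_left _ _ hc0.ne']
    refine core_s7 hK0 hα0 hβ0 (scaleH H1) hU ?_ hpos
    intro q hq hq1
    apply hu0
    refine ⟨q.1, q.2, hq.1, hq.2.1, hq1, ?_⟩
    have : h q = h (q.1, q.2) := rfl
    rw [this, hh, he]
    have : q.2 = 1 - q.1 := by linarith
    rw [this]; module

/-- for a right triangle with catheti `S = [B,C]`, `M = [A,C]` and
hypotenuse `L = [A,B]` (right angle at `C`), `max {λ₁^S, λ₁^M} ≤ λ₁^L`. -/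
theorem lambda1_hypotenuse_max (A B C : Pt)
    (hnd : AffineIndependent ℝ ![A, B, C])
    (hright : EuclideanGeometry.angle A C B = π / 2)
    (hSM : dist B C ≤ dist A C) (hML : dist A C ≤ dist A B) :
    max (lambda1 (interior (convexHull ℝ {A, B, C})) (segment ℝ B C))
        (lambda1 (interior (convexHull ℝ {A, B, C})) (segment ℝ A C)) ≤
      lambda1 (interior (convexHull ℝ {A, B, C})) (segment ℝ A B) := by
  have hA : A ≠ C := hnd.injective.ne (show (0 : Fin 3) ≠ 2 by decide)
  have hB : B ≠ C := hnd.injective.ne (show (1 : Fin 3) ≠ 2 by decide)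
  have hin : inner ℝ (A - C) (B - C) = 0 :=
    (InnerProductGeometry.inner_eq_zero_iff_angle_eq_pi_div_two _ _).2 hright
  apply max_le
  · exact tri A B C hA hB hin
  · have := tri B A C hB hA (by rw [real_inner_comm]; exact hin)
    rw [Set.insert_comm B A, segment_symm ℝ B A] at this
    exact this
end
end
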